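/- Let G be a finitely generated abelian group and let R_{G,φ} be a uniquely ergodic Cantor minimal G-system arising from a free action φ of G on a Cantor set X, with invariant probability measure μ. Let E_μ be the additive subgroup of ℝ generated by {μ(V) : V a clopen subset of X}. Then F(R_{G,φ}) = IM₊(E_μ). -/

import Mathlib

open MeasureTheory
open scoped ENNReal

/-- The group of self-homeomorphisms of a space, under composition. -/
instance homeomorphGroup {X : Type*} [TopologicalSpace X] : Group (X ≃ₜ X) where
  mul f g := g.trans f
  one := Homeomorph.refl X
  inv := Homeomorph.symm
  mul_assoc f g h := rfl
  one_mul f := Homeomorph.ext fun x => rfl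
  mul_one f := Homeomorph.ext fun x => rfl
  inv_mul_cancel f := Homeomorph.ext fun x => f.symm_apply_apply x

section Defs

variable {X Y : Type*} [TopologicalSpace X] [TopologicalSpace Y]

/-- The orbit equivalence relation `R_{G,φ}` of an action of `G` on `X` by homeomorphisms. -/
def orbitRelOf {G : Type*} [Group G] (φ : G →* (X ≃ₜ X)) : Set (X × X) :=
  {p | ∃ g : G, φ g p.1 = p.2}

/-- Freeness of an action by homeomorphisms. -/
def IsFreeAction {G : Type*} [Group G] (φ : G →* (X ≃ₜ X)) : Prop :=
  ∀ g : G, g ≠ 1 → ∀ x : X, φ g x ≠ x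

/-- The orbit relation of a single homeomorphism, i.e. of the generated `ℤ`-action. -/
def orbitRelZ (φ : X ≃ₜ X) : Set (X × X) :=
  {p | ∃ n : ℤ, (φ ^ n) p.1 = p.2}

/-- Freeness of the `ℤ`-action generated by a homeomorphism. -/
def IsFreeZ (φ : X ≃ₜ X) : Prop :=
  ∀ n : ℤ, n ≠ 0 → ∀ x : X, (φ ^ n) x ≠ x

/-- Minimality of an orbit equivalence relation: every class `R[x]` is dense. -/
def IsMinimalRel (R : Set (X × X)) : Prop :=
  ∀ x : X, Dense {y : X | (x, y) ∈ R}

/-- A Borel measure is `R`-invariant if it is invariant under every homeomorphism `h`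
with `(x, h x) ∈ R` for all `x`. -/
def IsInvariantMeasure [MeasurableSpace X] (R : Set (X × X)) (μ : Measure X) : Prop :=
  ∀ h : X ≃ₜ X, (∀ x : X, (x, h x) ∈ R) → Measure.map h μ = μ

/-- Restriction `R|_U = R ∩ (U × U)` of a relation, as a relation on the subtype `U`. -/
def restrictRel (R : Set (X × X)) (U : Set X) : Set (↥U × ↥U) :=
  {p | ((p.1 : X), (p.2 : X)) ∈ R}

/-- `R^n` on `X × {1,…,n}`: `((x,i),(y,j)) ∈ R^n ↔ (x,y) ∈ R`. -/
def finProdRel (R : Set (X × X)) (n : ℕ) : Set ((X × Fin n) × (X × Fin n)) :=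
  {p | (p.1.1, p.2.1) ∈ R}

/-- `R^∞` on `X × ℕ`: `((x,i),(y,j)) ∈ R^∞ ↔ (x,y) ∈ R`. -/
def natProdRel (R : Set (X × X)) : Set ((X × ℕ) × (X × ℕ)) :=
  {p | (p.1.1, p.2.1) ∈ R}

/-- Topological orbit equivalence of two equivalence relations: a homeomorphism `F` of the
underlying spaces with `(F × F)(R₁) = R₂`. -/
def OrbitEquiv (R₁ : Set (X × X)) (R₂ : Set (Y × Y)) : Prop :=
  ∃ F : X ≃ₜ Y, ∀ x y : X, (x, y) ∈ R₁ ↔ (F x, F y) ∈ R₂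

/-- The fundamental group `F(R)` of a uniquely ergodic Cantor minimal system, where `μ` is
the unique invariant probability measure: the set of values `(μ × δ)(U)` (with `δ` counting
measure) over clopen sets `U ⊆ X × {1,…,n}`, `n ∈ ℕ`, such that `R^n|_U` is orbit
equivalent to `R`. -/
noncomputable def fundGroup [MeasurableSpace X] (R : Set (X × X)) (μ : Measure X) : Set ℝ :=
  {l : ℝ | ∃ (n : ℕ) (U : Set (X × Fin n)), IsClopen U ∧
    OrbitEquiv R (restrictRel (finProdRel R n) U) ∧
    l = ((μ.prod Measure.count) U).toReal}

/-- `E_μ`: the additive subgroup of `ℝ` generated by the measures of clopen sets. -/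
noncomputable def clopenValueGroup [MeasurableSpace X] (μ : Measure X) : AddSubgroup ℝ :=
  AddSubgroup.closure {r : ℝ | ∃ V : Set X, IsClopen V ∧ r = (μ V).toReal}

/-- The positive inner multiplier group `IM₊(E)` of an additive subgroup of `ℝ`. -/
def IMplus (E : AddSubgroup ℝ) : Set ℝ :=
  {t : ℝ | 0 < t ∧ t ∈ E ∧ t⁻¹ ∈ E ∧ (fun x => t * x) '' (E : Set ℝ) = (E : Set ℝ)}

end Defs

set_option linter.unusedSectionVars false

namespace CantorFund

open Filter Topology
open scoped Classical Pointwise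

section

/-- Freeness of a group action, as a class. -/
class FreeAct (G X : Type*) [Group G] [MulAction G X] : Prop where
  eq_one : ∀ (g : G) (x : X), g • x = x → g = 1

/-- A map that is piecewise given by group elements on clopen pieces. -/
def PW (G : Type*) {X : Type*} [Group G] [MulAction G X] [TopologicalSpace X] (b : X → X) : Prop :=
  ∃ θ : X → G, IsLocallyConstant θ ∧ ∀ x, b x = θ x • x

/-- The group elements that move `z` into the fibre of `b` over `z`. -/
noncomputable def Phi (G : Type*) {X : Type*} [Group G] [MulAction G X] (b : X → X) (z : X) :
    Finset G :=
  if h : {g : G | b (g • z) = z}.Finite then h.toFinset else ∅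

/-- The fibre of `b` over `z`, as a finite set. -/
noncomputable def fib (G : Type*) {X : Type*} [Group G] [MulAction G X] (b : X → X) (z : X) :
    Finset X := (Phi G b z).image (fun g => g • z)

/-- Summation over the fibres of `b`. -/
noncomputable def sig (G : Type*) {X : Type*} [Group G] [MulAction G X] (b : X → X) (f : X → ℤ)
    (z : X) : ℤ := ∑ x ∈ fib G b z, f x

section Topo

variable {X : Type*} [TopologicalSpace X]

theorem lc_of_ev {α : Type*} {f : X → α} (h : ∀ x, ∀ᶠ y in 𝓝 x, f y = f x) :
    IsLocallyConstant f := (IsLocallyConstant.iff_eventually_eq f).2 h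

theorem lc_ev {α : Type*} {f : X → α} (h : IsLocallyConstant f) (x : X) :
    ∀ᶠ y in 𝓝 x, f y = f x := h.eventually_eq x

theorem lc_mem {C : Set X} (hC : IsClopen C) : IsLocallyConstant (fun x => x ∈ C) := by
  apply lc_of_ev
  intro x
  by_cases hx : x ∈ C
  · filter_upwards [hC.isOpen.mem_nhds hx] with y hy
    simp [hx, hy]
  · filter_upwards [hC.compl.isOpen.mem_nhds hx] with y hy
    simpa [hx] using hy

theorem clopen_of_lc {p : X → Prop} (h : IsLocallyConstant p) : IsClopen {x | p x} := by
  have := h.isClopen_fiber True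
  simpa using this

theorem lc_ite {α : Type*} {C : Set X} (hC : IsClopen C) {f g : X → α} (hf : IsLocallyConstant f)
    (hg : IsLocallyConstant g) : IsLocallyConstant (fun x => if x ∈ C then f x else g x) := by
  apply lc_of_ev
  intro x
  filter_upwards [lc_ev (lc_mem hC) x, lc_ev hf x, lc_ev hg x] with y h1 h2 h3
  rw [h2, h3]
  simp only [h1]

theorem lc_comp2 {α β γ : Type*} {f : X → α} {g : X → β} (F : α → β → γ) (hf : IsLocallyConstant f)
    (hg : IsLocallyConstant g) : IsLocallyConstant (fun x => F (f x) (g x)) :=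
  lc_of_ev fun x => by filter_upwards [lc_ev hf x, lc_ev hg x] with y h2 h3; rw [h2, h3]

variable [CompactSpace X] [T2Space X] [TotallyDisconnectedSpace X]

theorem exists_clopen_ev {x : X} {p : X → Prop} (h : ∀ᶠ y in 𝓝 x, p y) :
    ∃ C : Set X, IsClopen C ∧ x ∈ C ∧ ∀ y ∈ C, p y := by
  obtain ⟨U, hU, hUo, hx⟩ := mem_nhds_iff.1 h
  obtain ⟨C, hC, hxC, hCU⟩ := compact_exists_isClopen_in_isOpen hUo hx
  exact ⟨C, hC, hxC, fun y hy => hU (hCU hy)⟩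

theorem lc_select {α : Type*} [Nonempty α] {P : X → α → Prop}
    (h : ∀ x, ∃ a, ∀ᶠ y in 𝓝 x, P y a) :
    ∃ f : X → α, IsLocallyConstant f ∧ ∀ x, P x (f x) := by
  have key : ∃ C : Set X, IsClopen C ∧ Set.univ ⊆ C ∧ ∃ f : X → α, IsLocallyConstant f ∧
      ∀ x ∈ C, P x (f x) := by
    refine isCompact_univ.induction_on (p := fun s => ∃ C : Set X, IsClopen C ∧ s ⊆ C ∧
      ∃ f : X → α, IsLocallyConstant f ∧ ∀ x ∈ C, P x (f x)) ?_ ?_ ?_ ?_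
    · exact ⟨∅, isClopen_empty, le_rfl, fun _ => Classical.arbitrary α, IsLocallyConstant.const _,
        by simp⟩
    · rintro s t hst ⟨C, hC, htC, r⟩
      exact ⟨C, hC, hst.trans htC, r⟩
    · rintro s t ⟨C, hC, hsC, f, hf, hfC⟩ ⟨D, hD, htD, g, hg, hgD⟩
      refine ⟨C ∪ D, hC.union hD, Set.union_subset_union hsC htD,
        fun x => if x ∈ C then f x else g x, lc_ite hC hf hg, ?_⟩
      intro x hx
      by_cases hxC : x ∈ C
      · simpa [hxC] using hfC x hxC
      · simpa [hxC] using hgD x (hx.resolve_left hxC)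
    · intro x _
      obtain ⟨a, ha⟩ := h x
      obtain ⟨C, hC, hxC, hCP⟩ := exists_clopen_ev ha
      exact ⟨C, mem_nhdsWithin_of_mem_nhds (hC.isOpen.mem_nhds hxC), C, hC, le_rfl,
        fun _ => a, IsLocallyConstant.const _, hCP⟩
  obtain ⟨C, -, hC, f, hf, hP⟩ := key
  exact ⟨f, hf, fun x => hP x (hC trivial)⟩

end Topo

section Recode

variable {X : Type*} [TopologicalSpace X] [CompactSpace X]

theorem lc_recode {α : Type*} {f : X → α} (hf : IsLocallyConstant f) :
    ∃ q : X → ℕ, IsLocallyConstant q ∧ ∀ x y, q x = q y ↔ f x = f y := by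
  have hfin : (Set.range f).Finite := hf.range_finite
  have := hfin.to_subtype
  obtain ⟨n, ⟨e⟩⟩ := Finite.exists_equiv_fin (Set.range f)
  refine ⟨fun x => e ⟨f x, x, rfl⟩, ?_, ?_⟩
  · apply lc_of_ev
    intro x
    filter_upwards [lc_ev hf x] with y hy
    simp only [hy]
  · intro x y
    rw [Fin.val_inj, e.apply_eq_iff_eq]
    exact Subtype.ext_iff

end Recode

section Act

variable {G X : Type*} [CommGroup G] [TopologicalSpace X] [MulAction G X]

theorem lc_smul [ContinuousConstSMul G X] {α : Type*} {f : X → α} (hf : IsLocallyConstant f)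
    (g : G) : IsLocallyConstant (fun x => f (g • x)) :=
  hf.comp_continuous (continuous_const_smul g)

theorem clopen_smul_pre [ContinuousConstSMul G X] {C : Set X} (hC : IsClopen C)
    (g : G) : IsClopen {x | g • x ∈ C} := hC.preimage (continuous_const_smul g)

theorem PW.id : PW G (id : X → X) := ⟨fun _ => 1, IsLocallyConstant.const _, by simp⟩

theorem smul_inj [FreeAct G X] {g h : G} {x : X} : g • x = h • x ↔ g = h := by
  constructor
  · intro H
    have : (h⁻¹ * g) • x = x := by rw [mul_smul, H, inv_smul_smul]
    have := FreeAct.eq_one _ _ this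
    rw [inv_mul_eq_one] at this
    exact this.symm
  · rintro rfl; rfl

theorem PW.continuous [ContinuousConstSMul G X] {b : X → X} (hb : PW G b) : Continuous b := by
  obtain ⟨θ, hθ, h⟩ := hb
  rw [continuous_iff_continuousAt]
  intro x
  have : Tendsto (fun y => θ x • y) (𝓝 x) (𝓝 (b x)) := by
    rw [h]; exact (continuous_const_smul (θ x)).tendsto x
  refine this.congr' ?_
  filter_upwards [lc_ev hθ x] with y hy
  rw [h, hy]

theorem PW.lc_comp [ContinuousConstSMul G X] {α : Type*} {b : X → X} (hb : PW G b) {f : X → α}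
    (hf : IsLocallyConstant f) : IsLocallyConstant (fun x => f (b x)) :=
  hf.comp_continuous hb.continuous

theorem PW.comp [ContinuousConstSMul G X] {a b : X → X} (ha : PW G a) (hb : PW G b) :
    PW G (a ∘ b) := by
  obtain ⟨θ, hθ, h⟩ := hb
  obtain ⟨η, hη, h'⟩ := ha
  have hb : PW G b := ⟨θ, hθ, h⟩
  exact ⟨fun x => η (b x) * θ x, lc_comp2 (fun a b => a * b) (hb.lc_comp hη) hθ,
    fun x => by simp [h', h, mul_smul]⟩

theorem PW.ev_smul [ContinuousConstSMul G X] [FreeAct G X] {b : X → X} (hb : PW G b) (g h : G)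
    (x : X) : ∀ᶠ y in 𝓝 x, (b (g • y) = h • y ↔ b (g • x) = h • x) := by
  obtain ⟨θ, hθ, hh⟩ := hb
  filter_upwards [lc_ev (lc_smul hθ g) x] with y hy
  rw [hh, hh, hy, smul_smul, smul_smul, smul_inj, smul_inj]

theorem PW.lc_smul_eq [ContinuousConstSMul G X] [FreeAct G X] {b : X → X} (hb : PW G b)
    (g h : G) : IsLocallyConstant (fun y => b (g • y) = h • y) :=
  lc_of_ev fun x => by filter_upwards [hb.ev_smul g h x] with y hy; exact propext hy

theorem PW.ev_eq [ContinuousConstSMul G X] [FreeAct G X] {b : X → X} (hb : PW G b) (g h : G)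
    (x : X) : ∀ᶠ y in 𝓝 x, (b (g • y) = b (h • y) ↔ b (g • x) = b (h • x)) := by
  obtain ⟨θ, hθ, hh⟩ := hb
  filter_upwards [lc_ev (lc_smul hθ g) x, lc_ev (lc_smul hθ h) x] with y hy hy'
  rw [hh, hh, hy, hy', hh (g • x), hh (h • x)]
  simp only [smul_smul, smul_inj]

theorem PW.lc_eq [ContinuousConstSMul G X] [FreeAct G X] {b : X → X} (hb : PW G b)
    (g h : G) : IsLocallyConstant (fun y => b (g • y) = b (h • y)) :=
  lc_of_ev fun x => by filter_upwards [hb.ev_eq g h x] with y hy; exact propext hy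

theorem PW.piecewise {C : Set X} (hC : IsClopen C) {a b : X → X} (ha : PW G a) (hb : PW G b) :
    PW G (fun x => if x ∈ C then a x else b x) := by
  obtain ⟨θ, hθ, h⟩ := hb
  obtain ⟨η, hη, h'⟩ := ha
  refine ⟨fun x => if x ∈ C then η x else θ x, lc_ite hC hη hθ, fun x => ?_⟩
  by_cases hx : x ∈ C <;> simp [hx, h, h']

theorem PW.smul (g : G) : PW G (fun x : X => g • x) :=
  ⟨fun _ => g, IsLocallyConstant.const _, by simp⟩

theorem PW.of_local [CompactSpace X] [T2Space X] [TotallyDisconnectedSpace X] {b : X → X}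
    (h : ∀ x, ∃ g : G, ∀ᶠ y in 𝓝 x, b y = g • y) : PW G b := lc_select h

theorem PW.bdd [CompactSpace X] {b : X → X} (hb : PW G b) :
    ∃ T : Finset G, ∀ x, ∃ g ∈ T, b x = g • x := by
  obtain ⟨θ, hθ, h⟩ := hb
  exact ⟨hθ.range_finite.toFinset, fun x => ⟨θ x, by simp, h x⟩⟩

variable [CompactSpace X] [FreeAct G X]

theorem PW.finite {b : X → X} (hb : PW G b) (z : X) : {g : G | b (g • z) = z}.Finite := by
  obtain ⟨T, hT⟩ := hb.bdd
  refine (T.finite_toSet.image (fun g => g⁻¹)).subset ?_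
  intro g hg
  obtain ⟨h, hh, he⟩ := hT (g • z)
  refine ⟨h, hh, ?_⟩
  have : (h * g) • z = z := by rw [mul_smul, ← he]; exact hg
  exact inv_eq_of_mul_eq_one_right (FreeAct.eq_one _ _ this)

theorem mem_Phi {b : X → X} (hb : PW G b) {z : X} {g : G} : g ∈ Phi G b z ↔ b (g • z) = z := by
  simp [Phi, hb.finite z]

theorem mem_fib {b : X → X} (hb : PW G b) {z x : X} : x ∈ fib G b z ↔ b x = z := by
  simp only [fib, Finset.mem_image, mem_Phi hb]
  constructor
  · rintro ⟨g, hg, rfl⟩; exact hg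
  · intro h
    obtain ⟨θ, -, hh⟩ := hb
    refine ⟨(θ x)⁻¹, ?_, ?_⟩ <;> rw [← h, hh x, inv_smul_smul]
    rw [← hh]

theorem sig_eq {b : X → X} (f : X → ℤ) (z : X) :
    sig G b f z = ∑ g ∈ Phi G b z, f (g • z) := by
  rw [sig, fib, Finset.sum_image]
  intro g _ h _ H
  exact smul_inj.1 H

theorem card_fib (b : X → X) (z : X) : (fib G b z).card = (Phi G b z).card := by
  rw [fib, Finset.card_image_of_injective]
  intro g h H
  exact smul_inj.1 H

variable [ContinuousConstSMul G X]

theorem lc_finite_forall {ι : Type*} (s : Finset ι) {α : ι → Type*} {f : ∀ i, X → α i}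
    (h : ∀ i ∈ s, IsLocallyConstant (f i)) (x : X) : ∀ᶠ y in 𝓝 x, ∀ i ∈ s, f i y = f i x := by
  rw [Filter.eventually_all_finset]
  exact fun i hi => lc_ev (h i hi) x

theorem lc_Phi {b : X → X} (hb : PW G b) : IsLocallyConstant (Phi G b) := by
  obtain ⟨T, hT⟩ := hb.bdd
  apply lc_of_ev
  intro z
  have := lc_finite_forall T (f := fun t y => b (t⁻¹ • y) = (1 : G) • y)
    (fun t _ => hb.lc_smul_eq _ _) z
  filter_upwards [this] with y hy
  ext g
  rw [mem_Phi hb, mem_Phi hb]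
  by_cases hg : g⁻¹ ∈ T
  · have := hy _ hg
    simpa using this
  · have aux : ∀ z, b (g • z) ≠ z := by
      intro z hz
      obtain ⟨h, hh, he⟩ := hT (g • z)
      have : (h * g) • z = z := by rw [mul_smul, ← he]; exact hz
      apply hg
      rw [← eq_inv_of_mul_eq_one_left (FreeAct.eq_one _ _ this)]
      exact hh
    simp [aux]

theorem lc_sum {α : Type*} [AddCommMonoid α] (s : X → Finset G) (hs : IsLocallyConstant s)
    {f : X → α} (hf : IsLocallyConstant f) : IsLocallyConstant (fun z => ∑ g ∈ s z, f (g • z)) := by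
  apply lc_of_ev
  intro z
  filter_upwards [lc_ev hs z, lc_finite_forall (s z) (f := fun g z => f (g • z))
    (fun g _ => lc_smul hf g) z] with y h1 h2
  rw [h1]
  exact Finset.sum_congr rfl h2

theorem lc_sig {b : X → X} (hb : PW G b) {f : X → ℤ} (hf : IsLocallyConstant f) :
    IsLocallyConstant (sig G b f) := by
  have := lc_sum _ (lc_Phi hb) hf
  convert this using 1
  ext z; exact sig_eq f z

theorem sig_comp {a b : X → X} (ha : PW G a) (hb : PW G b) (f : X → ℤ) :
    sig G (a ∘ b) f = sig G a (sig G b f) := by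
  ext z
  simp only [sig]
  rw [← Finset.sum_fiberwise_of_maps_to (s := fib G (a ∘ b) z) (t := fib G a z) (g := b)]
  · refine Finset.sum_congr rfl fun w hw => Finset.sum_congr ?_ fun _ _ => rfl
    ext x
    rw [mem_fib ha] at hw
    simp only [Finset.mem_filter, mem_fib (ha.comp hb), mem_fib hb, Function.comp]
    constructor
    · rintro ⟨h1, h2⟩; exact h2
    · rintro rfl; exact ⟨hw, rfl⟩
  · intro x hx
    rw [mem_fib (ha.comp hb)] at hx
    rw [mem_fib ha]; exact hx

theorem sig_id (f : X → ℤ) : sig G (id : X → X) f = f := by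
  ext z
  have : fib G (id : X → X) z = {z} := by
    ext x; simp [mem_fib (G := G) PW.id]
  simp [sig, this]

theorem PW.clopen_image {b : X → X} (hb : PW G b) {A : Set X} (hA : IsClopen A) :
    IsClopen (b '' A) := by
  have : b '' A = {z | ∃ g ∈ Phi G b z, g • z ∈ A} := by
    ext z
    simp only [Set.mem_image, Set.mem_ofPred_eq]
    constructor
    · rintro ⟨x, hx, rfl⟩
      have := (mem_fib hb (z := b x) (x := x)).2 rfl
      rw [fib, Finset.mem_image] at this
      obtain ⟨g, hg, h⟩ := this
      exact ⟨g, hg, by rwa [h]⟩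
    · rintro ⟨g, hg, h⟩
      exact ⟨g • z, h, (mem_Phi hb).1 hg⟩
  rw [this]
  apply clopen_of_lc
  apply lc_of_ev
  intro z
  filter_upwards [lc_ev (lc_Phi hb) z, lc_finite_forall (Phi G b z) (f := fun g z => g • z ∈ A)
    (fun g _ => lc_smul (lc_mem hA) g) z] with y h1 h2
  rw [h1, eq_iff_iff]
  constructor
  · rintro ⟨g, hg, h⟩; exact ⟨g, hg, by rwa [← h2 g hg]⟩
  · rintro ⟨g, hg, h⟩; exact ⟨g, hg, by rwa [h2 g hg]⟩

end Act

end

section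

/-- Indicator function of a set, with integer values. -/
noncomputable def ind {X : Type*} (C : Set X) : X → ℤ := fun x => if x ∈ C then 1 else 0

/-- Integral of an integer valued function. -/
noncomputable def ing {X : Type*} [MeasurableSpace X] (μ : Measure X) (f : X → ℤ) : ℝ :=
  ∫ x, (f x : ℝ) ∂μ

/-- The standing assumptions on a uniquely ergodic minimal system. -/
structure Sys (G : Type*) {X : Type*} [CommGroup G] [TopologicalSpace X] [MulAction G X]
    [MeasurableSpace X] (μ : Measure X) : Prop where
  uniq : ∀ ν : Measure X, IsProbabilityMeasure ν → (∀ g : G, ν.map (fun x => g • x) = ν) → ν = μ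
  dense : ∀ (x : X) (U : Set X), IsOpen U → U.Nonempty → ∃ g : G, g • x ∈ U
  perf : ∀ U : Set X, IsOpen U → U.Nonempty → U.Infinite

section

variable {X : Type*} [TopologicalSpace X]

theorem lc_ind {C : Set X} (hC : IsClopen C) : IsLocallyConstant (ind C) :=
  lc_ite hC (IsLocallyConstant.const 1) (IsLocallyConstant.const 0)

variable [CompactSpace X] [MeasurableSpace X] [BorelSpace X] {μ : Measure X}
  [IsFiniteMeasure μ]

theorem rmono {A B : Set X} (h : A ⊆ B) : μ.real A ≤ μ.real B :=
  measureReal_mono h (measure_ne_top _ _)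

theorem lc_cast {f : X → ℤ} (hf : IsLocallyConstant f) : IsLocallyConstant (fun x => (f x : ℝ)) :=
  hf.comp (fun n : ℤ => (n : ℝ))

theorem lc_integrable {f : X → ℤ} (hf : IsLocallyConstant f) :
    Integrable (fun x => (f x : ℝ)) μ :=
  (lc_cast hf).continuous.integrable_of_hasCompactSupport (HasCompactSupport.of_compactSpace _)

theorem ing_add {f g : X → ℤ} (hf : IsLocallyConstant f) (hg : IsLocallyConstant g) :
    ing μ (f + g) = ing μ f + ing μ g := by
  simp only [ing, Pi.add_apply, Int.cast_add]
  exact integral_add (lc_integrable hf) (lc_integrable hg)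

theorem ing_sub {f g : X → ℤ} (hf : IsLocallyConstant f) (hg : IsLocallyConstant g) :
    ing μ (f - g) = ing μ f - ing μ g := by
  simp only [ing, Pi.sub_apply, Int.cast_sub]
  exact integral_sub (lc_integrable hf) (lc_integrable hg)

theorem ing_zsmul (n : ℤ) (f : X → ℤ) : ing μ (n • f) = n * ing μ f := by
  simp only [ing, Pi.smul_apply, smul_eq_mul, Int.cast_mul]
  exact integral_const_mul _ _

theorem ing_sum {ι : Type*} (s : Finset ι) {f : ι → X → ℤ}
    (hf : ∀ i ∈ s, IsLocallyConstant (f i)) : ing μ (∑ i ∈ s, f i) = ∑ i ∈ s, ing μ (f i) := by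
  simp only [ing, Finset.sum_apply, Int.cast_sum]
  exact integral_finsetSum _ fun i hi => lc_integrable (hf i hi)

theorem ing_ind {C : Set X} (hC : IsClopen C) : ing μ (ind C) = μ.real C := by
  have : (fun x => ((ind C x : ℤ) : ℝ)) = C.indicator 1 := by
    ext x; by_cases hx : x ∈ C <;> simp [ind, hx]
  rw [ing, this, integral_indicator_one hC.isOpen.measurableSet]

theorem ing_zero : ing μ (0 : X → ℤ) = 0 := by simp [ing]

theorem lc_sum_fun {ι : Type*} (s : Finset ι) {f : ι → X → ℤ}
    (hf : ∀ i ∈ s, IsLocallyConstant (f i)) : IsLocallyConstant (∑ i ∈ s, f i) := by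
  apply lc_of_ev
  intro x
  filter_upwards [(Filter.eventually_all_finset s).2 fun i hi => lc_ev (hf i hi) x] with y hy
  simp only [Finset.sum_apply]
  exact Finset.sum_congr rfl hy

end

section Act

variable {G X : Type*} [CommGroup G] [TopologicalSpace X] [MulAction G X]
  [CompactSpace X] [FreeAct G X] [ContinuousConstSMul G X]
  [MeasurableSpace X] [BorelSpace X] {μ : Measure X} [IsFiniteMeasure μ]

theorem sm_map [SMulInvariantMeasure G X μ] (g : G) : μ.map (fun x => g • x) = μ := by
  ext s hs
  rw [Measure.map_apply (continuous_const_smul g).measurable hs]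
  exact measure_preimage_smul_of_nullMeasurableSet hs.nullMeasurableSet g

theorem ing_smul [SMulInvariantMeasure G X μ] {f : X → ℤ} (hf : IsLocallyConstant f) (g : G) :
    ing μ (fun x => f (g • x)) = ing μ f := by
  have := integral_map (μ := μ) (φ := fun x => g • x)
    (continuous_const_smul g).measurable.aemeasurable
    (f := fun x => (f x : ℝ)) (lc_cast hf).continuous.aestronglyMeasurable
  rw [sm_map] at this
  exact this.symm

theorem real_smul_pre [SMulInvariantMeasure G X μ] {A : Set X} (hA : MeasurableSet A) (g : G) :
    μ.real {x | g • x ∈ A} = μ.real A := by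
  have : μ {x | g • x ∈ A} = μ A :=
    measure_preimage_smul_of_nullMeasurableSet hA.nullMeasurableSet g
  simp [Measure.real, this]

theorem real_pre_le [SMulInvariantMeasure G X μ] {b : X → X} {T : Finset G}
    (hT : ∀ x, ∃ g ∈ T, b x = g • x) {A : Set X} (hA : MeasurableSet A) :
    μ.real (b ⁻¹' A) ≤ T.card * μ.real A := by
  have h1 : b ⁻¹' A ⊆ ⋃ g ∈ T, {x | g • x ∈ A} := by
    intro x hx
    obtain ⟨g, hg, h⟩ := hT x
    simp only [Set.mem_iUnion]
    exact ⟨g, hg, by simpa [← h] using hx⟩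
  calc μ.real (b ⁻¹' A) ≤ μ.real (⋃ g ∈ T, {x | g • x ∈ A}) := rmono h1
    _ ≤ ∑ g ∈ T, μ.real {x | g • x ∈ A} := measureReal_biUnion_finset_le _ _
    _ = T.card * μ.real A := by
      rw [Finset.sum_congr rfl fun g _ => real_smul_pre hA g]; simp

theorem real_image_le [SMulInvariantMeasure G X μ] {b : X → X} {T : Finset G} {A : Set X}
    (hT : ∀ x ∈ A, ∃ g ∈ T, b x = g • x) (hA : MeasurableSet A) :
    μ.real (b '' A) ≤ T.card * μ.real A := by
  have h1 : b '' A ⊆ ⋃ g ∈ T, {x | g⁻¹ • x ∈ A} := by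
    rintro _ ⟨x, hx, rfl⟩
    obtain ⟨g, hg, h⟩ := hT x hx
    simp only [Set.mem_iUnion]
    exact ⟨g, hg, by simpa [h] using hx⟩
  calc μ.real (b '' A) ≤ μ.real (⋃ g ∈ T, {x | g⁻¹ • x ∈ A}) := rmono h1
    _ ≤ ∑ g ∈ T, μ.real {x | g⁻¹ • x ∈ A} := measureReal_biUnion_finset_le _ _
    _ = T.card * μ.real A := by
      rw [Finset.sum_congr rfl fun g _ => real_smul_pre hA g⁻¹]; simp

theorem ing_sig [SMulInvariantMeasure G X μ] {b : X → X} (hb : PW G b) {f : X → ℤ}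
    (hf : IsLocallyConstant f) : ing μ (sig G b f) = ing μ f := by
  obtain ⟨T, hT⟩ := hb.bdd
  have hlc : ∀ t : G, IsLocallyConstant (fun x => if b x = t • x then f x else 0) := by
    intro t
    refine lc_comp2 (fun (p : Prop) (n : ℤ) => if p then n else 0) ?_ hf
    simpa using hb.lc_smul_eq 1 t
  have h1 : sig G b f = ∑ t ∈ T, fun z => (fun x => if b x = t • x then f x else 0) (t⁻¹ • z) := by
    ext z
    rw [sig_eq, Finset.sum_apply]
    simp only [smul_inv_smul]
    rw [← Finset.sum_filter]
    refine Finset.sum_bij' (fun g _ => g⁻¹) (fun g _ => g⁻¹) ?_ ?_ ?_ ?_ ?_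
    · intro g hg
      rw [mem_Phi hb] at hg
      obtain ⟨h, hh, he⟩ := hT (g • z)
      have : (h * g) • z = z := by rw [mul_smul, ← he]; exact hg
      have := FreeAct.eq_one _ _ this
      rw [← eq_inv_of_mul_eq_one_left this]
      simp only [Finset.mem_filter]
      refine ⟨hh, ?_⟩
      rw [eq_inv_of_mul_eq_one_left this, inv_inv]; exact hg
    · intro g hg
      simp only [Finset.mem_filter] at hg
      rw [mem_Phi hb]; exact hg.2
    · simp
    · simp
    · simp
  rw [h1, ing_sum _ fun t _ => lc_smul (hlc t) t⁻¹, Finset.sum_congr rfl fun t _ => ing_smul (hlc t) t⁻¹,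
    ← ing_sum _ fun t _ => hlc t]
  congr 1
  ext x
  rw [Finset.sum_apply]
  obtain ⟨g, hg, h⟩ := hT x
  rw [Finset.sum_eq_single_of_mem g hg]
  · simp [h]
  · intro k _ hk
    rw [if_neg]
    rw [h, smul_inj]
    exact fun h => hk h.symm

end Act

section Sys

variable {G X : Type*} [CommGroup G] [TopologicalSpace X] [MulAction G X]
  [CompactSpace X] [FreeAct G X] [ContinuousConstSMul G X]
  [MeasurableSpace X] [BorelSpace X] {μ : Measure X} [IsProbabilityMeasure μ] [SMulInvariantMeasure G X μ]

theorem real_pos (hS : Sys G μ)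
   
    {C : Set X} (hC : IsClopen C) (hne : C.Nonempty) : 0 < μ.real C := by
  by_contra! h
  have h0 : μ.real C = 0 := le_antisymm h measureReal_nonneg
  obtain ⟨t, ht⟩ := isCompact_univ.elim_finite_subcover (fun g : G => {x : X | g • x ∈ C})
    (fun g => (clopen_smul_pre hC g).isOpen) (by
      intro x _
      obtain ⟨g, hg⟩ := hS.dense x C hC.isOpen hne
      exact Set.mem_iUnion.2 ⟨g, hg⟩)
  have : μ.real Set.univ ≤ ∑ g ∈ t, μ.real {x : X | g • x ∈ C} :=
    (rmono ht).trans (measureReal_biUnion_finset_le _ _)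
  rw [Finset.sum_congr rfl fun g _ => real_smul_pre hC.isOpen.measurableSet g, h0] at this
  simp at this
  linarith

variable [T2Space X] [TotallyDisconnectedSpace X]

theorem exists_clopen_disj (H : Finset G) (x : X) {p : X → Prop} (hp : ∀ᶠ y in 𝓝 x, p y) :
    ∃ C : Set X, IsClopen C ∧ x ∈ C ∧ (∀ y ∈ C, p y) ∧
      ∀ g ∈ H, g ≠ 1 → ∀ y ∈ C, g • y ∉ C := by
  have h1 : ∀ g : G, g ≠ 1 → ∃ U : Set X, IsOpen U ∧ x ∈ U ∧ ∀ y ∈ U, g • y ∉ U := by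
    intro g hg
    have : g • x ≠ x := fun h => hg (FreeAct.eq_one _ _ h)
    obtain ⟨U, V, hU, hV, hxU, hxV, hd⟩ := t2_separation this
    refine ⟨V ∩ {y | g • y ∈ U}, hV.inter (hU.preimage (continuous_const_smul g)),
      ⟨hxV, hxU⟩, ?_⟩
    rintro y ⟨_, hy⟩ ⟨hy', _⟩
    exact Set.disjoint_left.1 hd hy hy'
  choose! U hU hxU hdU using h1
  have h2 : ∀ᶠ y in 𝓝 x, ∀ g ∈ H.filter (· ≠ 1), y ∈ U g :=
    (Filter.eventually_all_finset _).2 fun g hg => (hU g (by simp at hg; exact hg.2)).mem_nhds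
      (hxU g (by simp at hg; exact hg.2))
  obtain ⟨C, hC, hxC, h⟩ := exists_clopen_ev (hp.and h2)
  refine ⟨C, hC, hxC, fun y hy => (h y hy).1, fun g hg hg1 y hy hgy => ?_⟩
  have hm : g ∈ H.filter (· ≠ 1) := by simp [hg, hg1]
  exact hdU g hg1 y ((h y hy).2 g hm) ((h _ hgy).2 g hm)

theorem infinite_group (hS : Sys G μ) : Infinite G := by
  have hne : Nonempty X := by
    by_contra h
    rw [not_nonempty_iff] at h
    have := measure_univ (μ := μ)
    rw [Set.univ_eq_empty_iff.2 h] at this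
    simp at this
  by_contra hfin
  rw [not_infinite_iff_finite] at hfin
  obtain ⟨x⟩ := hne
  have hinf := hS.perf Set.univ isOpen_univ ⟨x, trivial⟩
  have hf : (Set.range fun g : G => g • x).Finite := Set.finite_range _
  obtain ⟨y, hy⟩ : ((Set.range fun g : G => g • x)ᶜ).Nonempty := by
    by_contra! h
    rw [Set.compl_empty_iff] at h
    rw [h] at hf
    exact hinf hf
  obtain ⟨g, hg⟩ := hS.dense x _ hf.isClosed.isOpen_compl ⟨y, hy⟩
  exact hg ⟨g, rfl⟩

theorem exists_clopen_small (hS : Sys G μ) (x : X) {ε : ℝ} (hε : 0 < ε) {p : X → Prop}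
    (hp : ∀ᶠ y in 𝓝 x, p y) (H : Finset G) :
    ∃ C : Set X, IsClopen C ∧ x ∈ C ∧ (∀ y ∈ C, p y) ∧ μ.real C < ε ∧
      ∀ g ∈ H, g ≠ 1 → ∀ y ∈ C, g • y ∉ C := by
  have := infinite_group hS
  obtain ⟨n, hn⟩ := exists_nat_gt (1 / ε)
  obtain ⟨t, ht⟩ := Infinite.exists_subset_card_eq G n
  obtain ⟨C, hC, hxC, hpC, hd⟩ := exists_clopen_disj (H ∪ (t ×ˢ t).image fun p => p.1⁻¹ * p.2) x hp
  refine ⟨C, hC, hxC, hpC, ?_, fun g hg => hd g (Finset.mem_union_left _ hg)⟩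
  have h1 : ∑ g ∈ t, μ.real {x : X | g • x ∈ C} = μ.real (⋃ g ∈ t, {x : X | g • x ∈ C}) := by
    rw [measureReal_biUnion_finset]
    · intro g hg h hh hgh
      rw [Function.onFun, Set.disjoint_left]
      intro y hy hy'
      refine hd (g⁻¹ * h) (Finset.mem_union_right _ (Finset.mem_image.2 ⟨(g, h),
        Finset.mem_product.2 ⟨hg, hh⟩, rfl⟩)) ?_ _ hy ?_
      · rw [Ne, inv_mul_eq_one]; exact hgh
      · rw [smul_smul, mul_right_comm, inv_mul_cancel, one_mul]; exact hy'
    · exact fun g _ => (clopen_smul_pre hC g).isOpen.measurableSet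
  rw [Finset.sum_congr rfl fun g _ => real_smul_pre hC.isOpen.measurableSet g] at h1
  have h2 : μ.real (⋃ g ∈ t, {x : X | g • x ∈ C}) ≤ 1 := measureReal_le_one
  rw [← h1] at h2
  simp only [Finset.sum_const, ht, nsmul_eq_mul] at h2
  rw [div_lt_iff₀ hε] at hn
  by_contra! hcon
  nlinarith

end Sys

end

section

section Growth

variable {G : Type*} [CommGroup G]

theorem mem_pow_prod (K : Finset G) (r : ℕ) {x : G} (hx : x ∈ K ^ r) :
    ∃ e : K → ℕ, (∀ k, e k ≤ r) ∧ ∏ k : K, (k : G) ^ e k = x := by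
  induction r generalizing x with
  | zero =>
    refine ⟨fun _ => 0, fun _ => le_rfl, ?_⟩
    rw [pow_zero, Finset.mem_one] at hx
    simp [hx]
  | succ r ih =>
    rw [pow_succ, Finset.mem_mul] at hx
    obtain ⟨y, hy, k, hk, rfl⟩ := hx
    obtain ⟨e, he, rfl⟩ := ih hy
    refine ⟨fun j => e j + if j = ⟨k, hk⟩ then 1 else 0, fun j => ?_, ?_⟩
    · have h2 : (if j = ⟨k, hk⟩ then 1 else 0) ≤ 1 := by by_cases h : j = ⟨k, hk⟩ <;> simp [h]
      exact add_le_add (he j) h2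
    · simp only [pow_add, Finset.prod_mul_distrib]
      congr 1
      rw [Finset.prod_eq_single (⟨k, hk⟩ : K)]
      · simp
      · intro b _ hb; simp [hb]
      · simp

theorem card_pow_le (K : Finset G) (r : ℕ) : (K ^ r).card ≤ (r + 1) ^ K.card := by
  have h : K ^ r ⊆ (Fintype.piFinset (fun _ : K => Finset.range (r + 1))).image
      (fun e => ∏ k : K, (k : G) ^ e k) := by
    intro x hx
    obtain ⟨e, he, rfl⟩ := mem_pow_prod K r hx
    rw [Finset.mem_image]
    refine ⟨e, ?_, rfl⟩
    rw [Fintype.mem_piFinset]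
    intro k
    have := he k
    simp only [Finset.mem_range]; omega
  refine (Finset.card_le_card h).trans (Finset.card_image_le.trans ?_)
  simp

theorem pow_mono_of_one_mem {K : Finset G} (h1 : (1 : G) ∈ K) {m n : ℕ} (h : m ≤ n) :
    K ^ m ⊆ K ^ n := Finset.pow_subset_pow_right h1 h

theorem inv_mem_pow {K : Finset G} (hs : ∀ k ∈ K, k⁻¹ ∈ K) {m : ℕ} {g : G} (hg : g ∈ K ^ m) :
    g⁻¹ ∈ K ^ m := by
  have hK : K⁻¹ = K := by
    ext x
    rw [Finset.mem_inv']
    exact ⟨fun h => by simpa using hs _ h, fun h => hs _ h⟩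
  have : g⁻¹ ∈ (K ^ m)⁻¹ := Finset.inv_mem_inv hg
  rwa [← inv_pow, hK] at this

theorem exists_exp_gt (d : ℕ) {ε : ℝ} (hε : 0 < ε) :
    ∃ R : ℕ, ((R : ℝ) + 1) ^ d < (1 + ε) ^ R := by
  have h := tendsto_pow_const_div_const_pow_of_one_lt d (r := 1 + ε) (by linarith)
  have h2 := h.comp (tendsto_add_atTop_nat 1)
  have h3 := h2.eventually (gt_mem_nhds (show (0 : ℝ) < 1 / (1 + ε) by positivity))
  obtain ⟨R, hR⟩ := h3.exists
  refine ⟨R, ?_⟩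
  simp only [Function.comp, Nat.cast_add, Nat.cast_one] at hR
  rw [div_lt_div_iff₀ (by positivity) (by positivity), pow_succ, one_mul] at hR
  exact lt_of_mul_lt_mul_right hR (by positivity)

end Growth

section Tile

variable {G X : Type*} [CommGroup G] [TopologicalSpace X] [MulAction G X]
  [CompactSpace X] [FreeAct G X] [ContinuousConstSMul G X]
  [MeasurableSpace X] [BorelSpace X] {μ : Measure X}
  [IsProbabilityMeasure μ] [SMulInvariantMeasure G X μ]
  [T2Space X] [TotallyDisconnectedSpace X]

/-- Points where `b` is not invariant under translation by `K`. -/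
def cut (K : Finset G) (b : X → X) : Set X := {x | ∃ k ∈ K, b (k • x) ≠ b x}

/-- A partially defined tiling. -/
structure TileInv (μ : Measure X) (K : Finset G) (ε : ℝ) (P Q : Set X) (τ : X → X) : Prop where
  cP : IsClopen P
  cQ : IsClopen Q
  pw : PW G τ
  le : μ.real Q ≤ ε * μ.real P
  eq : ∀ x ∈ P, ∀ k ∈ K, k • x ∈ P → τ (k • x) = τ x ∨ x ∈ Q ∨ k • x ∈ Q
  shell : ∀ x ∈ P, ∀ k ∈ K, k • x ∉ P → k • x ∈ Q

theorem clopen_exists_smul (T : Finset G) {C : Set X} (hC : IsClopen C) :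
    IsClopen {x | ∃ g ∈ T, g • x ∈ C} := by
  have : {x | ∃ g ∈ T, g • x ∈ C} = ⋃ g ∈ T, {x | g • x ∈ C} := by ext; simp
  rw [this]
  exact T.finite_toSet.isClopen_biUnion fun g _ => clopen_smul_pre hC g

theorem tile_step {K : Finset G} (hs : ∀ k ∈ K, k⁻¹ ∈ K) (h1 : 1 ∈ K) {ε : ℝ} (hε : 0 < ε)
    {R : ℕ} (hR : ((R : ℝ) + 1) ^ K.card < (1 + ε) ^ R) {P Q : Set X} {τ : X → X}
    (h : TileInv μ K ε P Q τ) {V : Set X} (hV : IsClopen V)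
    (hVd : ∀ g ∈ K ^ (2 * R + 2), g ≠ 1 → ∀ y ∈ V, g • y ∉ V) :
    ∃ P' Q' τ', P ⊆ P' ∧ V ⊆ P' ∧ TileInv μ K ε P' Q' τ' := by
  set V' := V \ P with hV'
  have cV' : IsClopen V' := hV.diff h.cP
  set B : ℕ → Set X := fun ρ => {x | ∃ g ∈ K ^ ρ, g • x ∈ V'} with hB
  have cB : ∀ ρ, IsClopen (B ρ) := fun ρ => clopen_exists_smul _ cV'
  have B0 : B 0 = V' := by ext x; simp [hB]
  have Bm : ∀ {m n}, m ≤ n → B m ⊆ B n := by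
    rintro m n hmn x ⟨g, hg, hx⟩
    exact ⟨g, pow_mono_of_one_mem h1 hmn hg, hx⟩
  set f : ℕ → ℝ := fun ρ => μ.real (B ρ \ P) with hf
  have hf0 : f 0 = μ.real V' := by
    simp only [hf, B0]; congr 1; ext x; simp [hV']
  have hfR : f R ≤ ((R : ℝ) + 1) ^ K.card * μ.real V' := by
    calc f R ≤ μ.real (B R) := rmono Set.sdiff_subset
      _ ≤ μ.real (⋃ g ∈ K ^ R, {x | g • x ∈ V'}) := rmono (by intro x hx; simpa [hB] using hx)
      _ ≤ ∑ g ∈ K ^ R, μ.real {x | g • x ∈ V'} := measureReal_biUnion_finset_le _ _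
      _ = (K ^ R).card * μ.real V' := by
        rw [Finset.sum_congr rfl fun g _ => real_smul_pre cV'.isOpen.measurableSet g]; simp
      _ ≤ _ := by
        refine mul_le_mul_of_nonneg_right ?_ measureReal_nonneg
        exact_mod_cast card_pow_le K R
  obtain ⟨ρ, hρ, hfρ⟩ : ∃ ρ < R, f (ρ + 1) ≤ (1 + ε) * f ρ := by
    by_contra! hcon
    have hR0 : R ≠ 0 := by rintro rfl; simp at hR
    have hnn : ∀ ρ, 0 ≤ f ρ := fun ρ => measureReal_nonneg
    have hind : ∀ ρ ≤ R, (1 + ε) ^ ρ * f 0 ≤ f ρ := by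
      intro ρ
      induction ρ with
      | zero => intro _; simp
      | succ ρ ih =>
        intro hρ
        have := ih (by omega)
        have h3 := hcon ρ (by omega)
        rw [pow_succ]
        nlinarith
    have h4 := hind R le_rfl
    rw [hf0] at h4
    have h5 : μ.real V' = 0 := by
      have := measureReal_nonneg (μ := μ) (s := V')
      by_contra hne
      have : 0 < μ.real V' := lt_of_le_of_ne this (Ne.symm hne)
      nlinarith
    rw [h5, mul_zero] at hfR
    have h6 := hcon (R - 1) (by omega)
    rw [Nat.sub_add_cancel (by omega)] at h6
    have := hnn (R - 1)
    nlinarith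
  set A := B ρ \ P with hA
  have cA : IsClopen A := (cB ρ).diff h.cP
  obtain ⟨θ, hθ, hθ'⟩ := lc_select (X := X) (α := G)
    (P := fun x g => x ∈ A → g ∈ K ^ ρ ∧ g • x ∈ V') (by
      intro x
      by_cases hx : x ∈ A
      · obtain ⟨g, hg, hgx⟩ := hx.1
        refine ⟨g, ?_⟩
        filter_upwards [(clopen_smul_pre cV' g).isOpen.mem_nhds hgx] with y hy _
        exact ⟨hg, hy⟩
      · refine ⟨1, ?_⟩
        filter_upwards [cA.compl.isOpen.mem_nhds hx] with y hy hy'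
        exact absurd hy' hy)
  refine ⟨P ∪ A, Q ∪ ((B (ρ + 1) \ B ρ) \ P), fun x => if x ∈ A then θ x • x else τ x,
    Set.subset_union_left, ?_, ?_, ?_, ?_, ?_, ?_, ?_⟩
  · intro x hx
    by_cases hxP : x ∈ P
    · exact Or.inl hxP
    · exact Or.inr ⟨Bm (Nat.zero_le _) (by rw [B0]; exact ⟨hx, hxP⟩), hxP⟩
  · exact h.cP.union cA
  · exact h.cQ.union (((cB _).diff (cB _)).diff h.cP)
  · convert PW.piecewise cA (a := fun x => θ x • x) ⟨θ, hθ, fun _ => rfl⟩ h.pw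
  · have e1 : μ.real (P ∪ A) = μ.real P + f ρ :=
      measureReal_union (by rw [Set.disjoint_left]; intro x hx hx'; exact hx'.2 hx)
        cA.isOpen.measurableSet
    have e2 : f (ρ + 1) = f ρ + μ.real ((B (ρ + 1) \ B ρ) \ P) := by
      rw [hf]
      dsimp only
      rw [← measureReal_union]
      · apply congrArg
        ext x
        have := @Bm ρ (ρ + 1) (by omega) x
        simp only [Set.mem_union, Set.mem_sdiff]
        tauto
      · rw [Set.disjoint_left]; intro x hx hx'; exact hx'.1.2 hx.1
      · exact (((cB _).diff (cB _)).diff h.cP).isOpen.measurableSet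
    have e3 := measureReal_union_le (μ := μ) Q ((B (ρ + 1) \ B ρ) \ P)
    have := h.le
    rw [e1]
    nlinarith
  · have key : ∀ x ∈ P ∪ A, ∀ k ∈ K, k • x ∈ P ∪ A → x ∈ A → k • x ∈ A → θ (k • x) • k • x = θ x • x := by
      intro x _ k hk _ hx hkx
      obtain ⟨a1, a2⟩ := hθ' x hx
      obtain ⟨b1, b2⟩ := hθ' _ hkx
      by_contra hne
      have hg : θ (k • x) * k * (θ x)⁻¹ ∈ K ^ (2 * R + 2) := by
        have : θ (k • x) * k * (θ x)⁻¹ ∈ K ^ ρ * K * K ^ ρ :=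
          Finset.mul_mem_mul (Finset.mul_mem_mul b1 hk) (inv_mem_pow hs a1)
        rw [← pow_succ, ← pow_add] at this
        exact pow_mono_of_one_mem h1 (by omega) this
      refine hVd _ hg ?_ _ a2.1 ?_
      · intro he
        apply hne
        rw [smul_smul, smul_inj]
        rwa [mul_inv_eq_one] at he
      · rw [mul_smul, inv_smul_smul, mul_smul]; exact b2.1
    intro x hx k hk hkx
    by_cases hxA : x ∈ A <;> by_cases hkA : k • x ∈ A
    · left; simp only [if_pos hxA, if_pos hkA]; exact key x hx k hk hkx hxA hkA
    · right; left; left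
      have hkP := hkx.resolve_right hkA
      have := h.shell _ hkP k⁻¹ (hs k hk)
      rw [inv_smul_smul] at this
      exact this hxA.2
    · right; right; left
      exact h.shell x (hx.resolve_right hxA) k hk hkA.2
    · simp only [if_neg hxA, if_neg hkA]
      rcases h.eq x (hx.resolve_right hxA) k hk (hkx.resolve_right hkA) with h | h | h
      · exact Or.inl h
      · exact Or.inr (Or.inl (Or.inl h))
      · exact Or.inr (Or.inr (Or.inl h))
  · intro x hx k hk hkx
    rw [Set.mem_union, not_or] at hkx
    by_cases hxP : x ∈ P
    · exact Or.inl (h.shell x hxP k hk hkx.1)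
    · have hxA := hx.resolve_left hxP
      obtain ⟨g, hg, hgx⟩ := hxA.1
      refine Or.inr ⟨⟨⟨g * k⁻¹, ?_, ?_⟩, fun hb => hkx.2 ⟨hb, hkx.1⟩⟩, hkx.1⟩
      · rw [pow_succ]; exact Finset.mul_mem_mul hg (hs k hk)
      · rwa [mul_smul, inv_smul_smul]

theorem clopen_cut {b : X → X} (hb : PW G b) (K : Finset G) : IsClopen (cut K b) := by
  have : cut K b = ⋃ k ∈ K, {x | b (k • x) = b ((1 : G) • x)}ᶜ := by ext; simp [cut]
  rw [this]
  exact K.finite_toSet.isClopen_biUnion fun g _ => (clopen_of_lc (hb.lc_eq g 1)).compl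

theorem tile (μ : Measure X) [IsProbabilityMeasure μ] [SMulInvariantMeasure G X μ]
    {K : Finset G} (hs : ∀ k ∈ K, k⁻¹ ∈ K) (h1 : 1 ∈ K) {ε : ℝ} (hε : 0 < ε) :
    ∃ τ : X → X, PW G τ ∧ μ.real (cut K τ) ≤ ε := by
  set ε' := ε / (1 + K.card) with hε'
  have hp : (0 : ℝ) < 1 + K.card := by positivity
  have hε'0 : 0 < ε' := by positivity
  obtain ⟨R, hR⟩ := exists_exp_gt K.card hε'0
  have hc : ∀ x : X, ∃ C : Set X, IsClopen C ∧ x ∈ C ∧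
      ∀ g ∈ K ^ (2 * R + 2), g ≠ 1 → ∀ y ∈ C, g • y ∉ C := by
    intro x
    obtain ⟨C, h1, h2, -, h3⟩ := exists_clopen_disj (K ^ (2 * R + 2)) x (p := fun _ => True) (by simp)
    exact ⟨C, h1, h2, h3⟩
  choose C hC hxC hCd using hc
  obtain ⟨t, ht⟩ := isCompact_univ.elim_finite_subcover C (fun x => (hC x).isOpen)
    (fun x _ => Set.mem_iUnion.2 ⟨x, hxC x⟩)
  have main : ∀ s : Finset X, ∃ P Q τ, (∀ x ∈ s, C x ⊆ P) ∧ TileInv μ K ε' P Q τ := by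
    intro s
    induction s using Finset.induction_on with
    | empty =>
      exact ⟨∅, ∅, id, by simp, isClopen_empty, isClopen_empty, PW.id, by simp, by simp, by simp⟩
    | insert x s _ ih =>
      obtain ⟨P, Q, τ, hs', h⟩ := ih
      obtain ⟨P', Q', τ', hP, hV, h'⟩ := tile_step hs h1 hε'0 hR h (hC x) (hCd x)
      refine ⟨P', Q', τ', ?_, h'⟩
      intro y hy
      rcases Finset.mem_insert.1 hy with rfl | hy
      · exact hV
      · exact (hs' y hy).trans hP
  obtain ⟨P, Q, τ, hP, h⟩ := main t
  have hPu : ∀ x, x ∈ P := by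
    intro x
    have := ht (Set.mem_univ x)
    simp only [Set.mem_iUnion] at this
    obtain ⟨y, hy, hxy⟩ := this
    exact hP y hy hxy
  refine ⟨τ, h.pw, ?_⟩
  have hsub : cut K τ ⊆ Q ∪ ⋃ k ∈ K, {x | k • x ∈ Q} := by
    rintro x ⟨k, hk, hne⟩
    rcases h.eq x (hPu x) k hk (hPu _) with h | h | h
    · exact absurd h hne
    · exact Or.inl h
    · right; simp only [Set.mem_iUnion]; exact ⟨k, hk, h⟩
  have hQ : μ.real Q ≤ ε' := by
    have := h.le
    have h2 : μ.real P ≤ 1 := measureReal_le_one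
    nlinarith
  calc μ.real (cut K τ) ≤ μ.real (Q ∪ ⋃ k ∈ K, {x | k • x ∈ Q}) := rmono hsub
    _ ≤ μ.real Q + μ.real (⋃ k ∈ K, {x | k • x ∈ Q}) := measureReal_union_le _ _
    _ ≤ μ.real Q + ∑ k ∈ K, μ.real {x | k • x ∈ Q} :=
      add_le_add le_rfl (measureReal_biUnion_finset_le _ _)
    _ = (1 + K.card) * μ.real Q := by
      rw [Finset.sum_congr rfl fun g _ => real_smul_pre h.cQ.isOpen.measurableSet g]
      simp; ring
    _ ≤ (1 + K.card) * ε' := by gcongr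
    _ = ε := by rw [hε']; field_simp

end Tile

end

section

open scoped Classical Pointwise BoundedContinuousFunction

section Erg

variable {G X : Type*} [CommGroup G] [TopologicalSpace X] [MulAction G X]
  [CompactSpace X] [ContinuousConstSMul G X]
  [MeasurableSpace X] [BorelSpace X] {μ : Measure X}
  [IsProbabilityMeasure μ] [SMulInvariantMeasure G X μ]
  [TopologicalSpace.MetrizableSpace X]

/-- The empirical measure of a finite piece of an orbit. -/
noncomputable def empir (Φ : Finset G) (x : X) : Measure X :=
  (Φ.card : ℝ≥0∞)⁻¹ • ∑ g ∈ Φ, Measure.dirac (g • x)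

theorem empir_prob {Φ : Finset G} (h : Φ.Nonempty) (x : X) : IsProbabilityMeasure (empir Φ x) := by
  constructor
  simp only [empir, Measure.smul_apply, Measure.finsetSum_apply, measure_univ, smul_eq_mul,
    Finset.sum_const, nsmul_eq_mul, mul_one]
  refine ENNReal.inv_mul_cancel ?_ (ENNReal.natCast_ne_top _)
  have := h.card_pos
  simp only [ne_eq, Nat.cast_eq_zero]; omega

theorem integral_empir (Φ : Finset G) (x : X) {F : X → ℝ} (hF : Continuous F) :
    ∫ y, F y ∂(empir Φ x) = (Φ.card : ℝ)⁻¹ * ∑ g ∈ Φ, F (g • x) := by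
  rw [empir, integral_smul_measure, integral_finsetSum_measure]
  · simp only [integral_dirac, smul_eq_mul, ENNReal.toReal_inv, ENNReal.toReal_natCast]
  · intro g _
    exact hF.integrable_of_hasCompactSupport (HasCompactSupport.of_compactSpace _)

theorem sum_shift_le (Φ : Finset G) (h : G) (x : X) {F : X → ℝ} {C : ℝ} (hC : ∀ x, |F x| ≤ C) :
    |∑ g ∈ Φ, F (h • g • x) - ∑ g ∈ Φ, F (g • x)| ≤
      2 * C * (Φ.filter fun g => h * g ∉ Φ).card := by
  have e1 : ∑ g ∈ Φ, F (h • g • x) = ∑ g ∈ Φ.image (fun g => h * g), F (g • x) := by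
    rw [Finset.sum_image (fun a _ b _ hab => mul_left_cancel hab)]
    simp [mul_smul]
  set Ψ := Φ.image (fun g => h * g) with hΨ
  have e2 : ∑ g ∈ Ψ, F (g • x) = ∑ g ∈ Ψ ∩ Φ, F (g • x) + ∑ g ∈ Ψ \ Φ, F (g • x) :=
    (Finset.sum_inter_add_sum_sdiff _ _ _).symm
  have e3 : ∑ g ∈ Φ, F (g • x) = ∑ g ∈ Φ ∩ Ψ, F (g • x) + ∑ g ∈ Φ \ Ψ, F (g • x) :=
    (Finset.sum_inter_add_sum_sdiff _ _ _).symm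
  have c1 : (Ψ \ Φ).card = (Φ.filter fun g => h * g ∉ Φ).card := by
    rw [← Finset.card_image_of_injective (Φ.filter fun g => h * g ∉ Φ) (mul_right_injective h)]
    congr 1
    ext g
    simp only [hΨ, Finset.mem_sdiff, Finset.mem_image, Finset.mem_filter]
    constructor
    · rintro ⟨⟨a, ha, rfl⟩, hn⟩; exact ⟨a, ⟨ha, hn⟩, rfl⟩
    · rintro ⟨a, ⟨ha, hn⟩, rfl⟩; exact ⟨⟨a, ha, rfl⟩, hn⟩
  have c2 : (Φ \ Ψ).card = (Ψ \ Φ).card := by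
    apply Finset.card_sdiff_comm
    rw [hΨ, Finset.card_image_of_injective _ (mul_right_injective h)]
  have b : ∀ S : Finset G, |∑ g ∈ S, F (g • x)| ≤ S.card * C := by
    intro S
    refine (Finset.abs_sum_le_sum_abs _ _).trans ?_
    refine (Finset.sum_le_sum fun g _ => hC (g • x)).trans ?_
    simp
  have b1 := b (Ψ \ Φ)
  have b2 := b (Φ \ Ψ)
  rw [e1, e2, e3, Finset.inter_comm Φ Ψ, add_sub_add_left_eq_sub]
  rw [c2, c1] at b2
  rw [c1] at b1
  calc _ ≤ _ := abs_sub _ _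
    _ ≤ _ := add_le_add b1 b2
    _ = _ := by ring

theorem uniform_avg (hS : Sys G μ) {f : X → ℤ} (hf : IsLocallyConstant f) {ε : ℝ} (hε : 0 < ε) :
    ∃ (H : Finset G) (δ : ℝ), 0 < δ ∧ ∀ Φ : Finset G, Φ.Nonempty →
      (∀ h ∈ H, ((Φ.filter fun g => h * g ∉ Φ).card : ℝ) ≤ δ * Φ.card) →
      ∀ x : X, |((∑ g ∈ Φ, f (g • x) : ℤ) : ℝ) - Φ.card * ing μ f| ≤ ε * Φ.card := by
  by_contra! hcon
  have hcon' : ∀ i : Finset G × ℕ, ∃ (Φ : Finset G) (x : X), Φ.Nonempty ∧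
      (∀ h ∈ i.1, ((Φ.filter fun g => h * g ∉ Φ).card : ℝ) ≤ 1 / (i.2 + 1) * Φ.card) ∧
      ε * Φ.card < |((∑ g ∈ Φ, f (g • x) : ℤ) : ℝ) - Φ.card * ing μ f| := by
    intro i
    obtain ⟨Φ, h1, h2, x, h3⟩ := hcon i.1 (1 / (i.2 + 1)) (by positivity)
    exact ⟨Φ, x, h1, h2, h3⟩
  choose Φ x hne hFol hdev using hcon'
  let ν : Finset G × ℕ → ProbabilityMeasure X := fun i => ⟨empir (Φ i) (x i), empir_prob (hne i) _⟩
  let 𝒰 : Ultrafilter (Finset G × ℕ) := Ultrafilter.of atTop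
  have h𝒰 : (𝒰 : Filter (Finset G × ℕ)) ≤ atTop := Ultrafilter.of_le _
  obtain ⟨ν₀, -, hν₀⟩ := isCompact_univ.ultrafilter_le_nhds (𝒰.map ν) (by simp)
  have hlim : Tendsto ν 𝒰 (𝓝 ν₀) := hν₀
  rw [ProbabilityMeasure.tendsto_iff_forall_integral_tendsto] at hlim
  have h_integral : ∀ (F : X →ᵇ ℝ) i, ∫ y, F y ∂(ν i : Measure X) =
      ((Φ i).card : ℝ)⁻¹ * ∑ g ∈ Φ i, F (g • x i) := fun F i => integral_empir _ _ F.continuous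
  have hinv : ∀ g : G, (ν₀ : Measure X).map (fun x => g • x) = ν₀ := by
    intro h
    have hmeas : Measurable (fun x : X => h • x) := (continuous_const_smul h).measurable
    have : IsProbabilityMeasure ((ν₀ : Measure X).map (fun x => h • x)) :=
      Measure.isProbabilityMeasure_map hmeas.aemeasurable
    apply ext_of_forall_integral_eq_of_IsFiniteMeasure
    intro F
    rw [integral_map hmeas.aemeasurable F.continuous.aestronglyMeasurable]
    let F' : X →ᵇ ℝ := F.compContinuous ⟨fun x => h • x, continuous_const_smul h⟩
    have l1 := (hlim F').sub (hlim F)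
    have l2 : Tendsto (fun i => ∫ y, F' y ∂(ν i : Measure X) - ∫ y, F y ∂(ν i : Measure X)) 𝒰
        (𝓝 0) := by
      have l3 : Tendsto (fun i : Finset G × ℕ => 2 * ‖F‖ * (1 / ((i.2 : ℝ) + 1))) atTop (𝓝 0) := by
        have : Tendsto (fun i : Finset G × ℕ => i.2) atTop atTop := by
          rw [← prod_atTop_atTop_eq]; exact tendsto_snd
        have := (tendsto_one_div_add_atTop_nhds_zero_nat (𝕜 := ℝ)).comp this
        simpa using this.const_mul (2 * ‖F‖)
      refine squeeze_zero_norm' ?_ (l3.mono_left h𝒰)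
      apply h𝒰
      filter_upwards [eventually_ge_atTop (({h} : Finset G), 0)] with i hi
      have hh : h ∈ i.1 := hi.1 (Finset.mem_singleton_self h)
      have hc : (0 : ℝ) < (Φ i).card := by exact_mod_cast (hne i).card_pos
      rw [h_integral, h_integral, ← mul_sub, Real.norm_eq_abs, abs_mul, abs_of_pos (inv_pos.2 hc),
        inv_mul_le_iff₀ hc]
      have := sum_shift_le (Φ i) h (x i) (F := F) (C := ‖F‖) (fun x => by
        simpa using F.norm_coe_le_norm x)
      refine this.trans ?_
      have h4 := hFol i h hh
      have := norm_nonneg F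
      calc 2 * ‖F‖ * _ ≤ 2 * ‖F‖ * (1 / (i.2 + 1) * (Φ i).card) := by gcongr
        _ = _ := by ring
    have := tendsto_nhds_unique l1 l2
    exact sub_eq_zero.1 this
  have heq := hS.uniq ν₀ inferInstance hinv
  let F : X →ᵇ ℝ := BoundedContinuousFunction.mkOfCompact ⟨fun x => (f x : ℝ), (lc_cast hf).continuous⟩
  have h5 := hlim F
  rw [heq] at h5
  have h6 := h5.eventually (Metric.ball_mem_nhds _ hε)
  obtain ⟨i, hi⟩ := h6.exists
  have hc : (0 : ℝ) < (Φ i).card := by exact_mod_cast (hne i).card_pos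
  rw [h_integral, Real.dist_eq] at hi
  have h7 := hdev i
  have e : ((Φ i).card : ℝ)⁻¹ * ∑ g ∈ Φ i, F (g • x i) - ∫ y, F y ∂μ =
      ((Φ i).card : ℝ)⁻¹ * (((∑ g ∈ Φ i, f (g • x i) : ℤ) : ℝ) - (Φ i).card * ing μ f) := by
    rw [mul_sub, inv_mul_cancel_left₀ hc.ne', Int.cast_sum]
    rfl
  rw [e, abs_mul, abs_of_pos (inv_pos.2 hc), inv_mul_lt_iff₀ hc] at hi
  linarith

end Erg

end

section

section Gen

variable {G : Type*} [CommGroup G]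

/-- A finite symmetric generating set containing the identity. -/
structure GenSet (K : Finset G) : Prop where
  symm : ∀ k ∈ K, k⁻¹ ∈ K
  one : 1 ∈ K
  gen : ∀ g, ∃ s : ℕ, g ∈ K ^ s

theorem exists_genSet [Group.FG G] : ∃ K : Finset G, GenSet K := by
  obtain ⟨S, hS⟩ := (Group.FG.out : (⊤ : Subgroup G).FG)
  set K : Finset G := insert 1 (S ∪ S⁻¹) with hK
  have hsymm : ∀ k ∈ K, k⁻¹ ∈ K := by
    intro k hk
    simp only [hK, Finset.mem_insert, Finset.mem_union, Finset.mem_inv', inv_eq_one, inv_inv] at hk ⊢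
    tauto
  refine ⟨K, hsymm, by simp [hK], ?_⟩
  intro g
  have hg : g ∈ Subgroup.closure (S : Set G) := by rw [hS]; trivial
  induction hg using Subgroup.closure_induction with
  | mem x hx => exact ⟨1, by rw [pow_one]; simp only [hK, Finset.mem_insert, Finset.mem_union]; exact Or.inr (Or.inl hx)⟩
  | one => exact ⟨0, by simp⟩
  | mul x y _ _ hx hy =>
    obtain ⟨s, hs⟩ := hx
    obtain ⟨t, ht⟩ := hy
    exact ⟨s + t, by rw [pow_add]; exact Finset.mul_mem_mul hs ht⟩
  | inv x _ hx =>
    obtain ⟨s, hs⟩ := hx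
    exact ⟨s, inv_mem_pow hsymm hs⟩

theorem GenSet.exists_sub {K : Finset G} (hK : GenSet K) (H : Finset G) : ∃ s, H ⊆ K ^ s := by
  induction H using Finset.induction_on with
  | empty => exact ⟨0, by simp⟩
  | insert x H _ ih =>
    obtain ⟨s, hs⟩ := ih
    obtain ⟨t, ht⟩ := hK.gen x
    refine ⟨max s t, ?_⟩
    rw [Finset.insert_subset_iff]
    exact ⟨pow_mono_of_one_mem hK.one (le_max_right _ _) ht,
      hs.trans (pow_mono_of_one_mem hK.one (le_max_left _ _))⟩

theorem GenSet.card_mono {K : Finset G} (hK : GenSet K) {m n : ℕ} (h : m ≤ n) :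
    (K ^ m).card ≤ (K ^ n).card := Finset.card_le_card (pow_mono_of_one_mem hK.one h)

theorem GenSet.card_pos {K : Finset G} (hK : GenSet K) (m : ℕ) : 0 < (K ^ m).card :=
  Finset.card_pos.2 (Finset.Nonempty.pow ⟨1, hK.one⟩)

theorem folner_of_growth (K : Finset G) {n s : ℕ} (hK : GenSet K) {δ : ℝ}
    (hg : ((K ^ (n + s)).card : ℝ) ≤ (1 + δ) * (K ^ n).card) {h : G} (hh : h ∈ K ^ s) :
    (((K ^ n).filter fun g => h * g ∉ K ^ n).card : ℝ) ≤ δ * (K ^ n).card := by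
  have h1 : (((K ^ n).filter fun g => h * g ∉ K ^ n).card : ℝ) ≤ ((K ^ (n + s)) \ K ^ n).card := by
    rw [← Finset.card_image_of_injective ((K ^ n).filter fun g => h * g ∉ K ^ n) (mul_right_injective h)]
    norm_cast
    apply Finset.card_le_card
    intro x hx
    simp only [Finset.mem_image, Finset.mem_filter] at hx
    obtain ⟨a, ⟨ha, hn⟩, rfl⟩ := hx
    rw [Finset.mem_sdiff]
    refine ⟨?_, hn⟩
    rw [add_comm, pow_add]; exact Finset.mul_mem_mul hh ha
  rw [Finset.card_sdiff_of_subset (pow_mono_of_one_mem hK.one (Nat.le_add_right _ _)), Nat.cast_sub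
    (hK.card_mono (Nat.le_add_right _ _))] at h1
  linarith

theorem exists_slow {K : Finset G} (hK : GenSet K) {n s L : ℕ} {C δ : ℝ} (hδ : 0 < δ)
    (hL : C < (1 + δ) ^ L) (h : ((K ^ (n + s * L)).card : ℝ) ≤ C * (K ^ n).card) :
    ∃ j < L, ((K ^ (n + s * j + s)).card : ℝ) ≤ (1 + δ) * (K ^ (n + s * j)).card := by
  by_contra! hcon
  have hind : ∀ j ≤ L, (1 + δ) ^ j * (K ^ n).card ≤ ((K ^ (n + s * j)).card : ℝ) := by
    intro j
    induction j with
    | zero => simp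
    | succ j ih =>
      intro hj
      have h1 := ih (by omega)
      have h2 := hcon j (by omega)
      rw [show n + s * (j + 1) = n + s * j + s by ring, pow_succ]
      nlinarith
  have := hind L le_rfl
  have hp : (0 : ℝ) < (K ^ n).card := by exact_mod_cast hK.card_pos n
  nlinarith

theorem exists_doubling {K : Finset G} (hK : GenSet K) (N : ℕ) :
    ∃ n ≥ N, ((K ^ (4 * n)).card : ℝ) ≤ (2 * 4 ^ K.card) * (K ^ n).card := by
  by_contra! hcon
  have hind : ∀ j, (2 * 4 ^ K.card : ℝ) ^ j ≤ ((K ^ (4 ^ j * (N + 1))).card : ℝ) := by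
    intro j
    induction j with
    | zero =>
      simp only [pow_zero, one_mul]
      exact_mod_cast hK.card_pos _
    | succ j ih =>
      have h4 : 1 ≤ 4 ^ j := Nat.one_le_pow _ _ (by norm_num)
      have h2 := hcon (4 ^ j * (N + 1)) (by nlinarith)
      rw [show 4 ^ (j + 1) * (N + 1) = 4 * (4 ^ j * (N + 1)) by ring, pow_succ]
      have : (0 : ℝ) < 2 * 4 ^ K.card := by positivity
      nlinarith
  have hb : ∀ j : ℕ, (2 : ℝ) ^ j ≤ (N + 2) ^ K.card := by
    intro j
    have h1 := hind j
    have h2 : ((K ^ (4 ^ j * (N + 1))).card : ℝ) ≤ ((4 ^ j * (N + 2) : ℝ)) ^ K.card := by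
      refine le_trans (b := (((4 ^ j * (N + 1) + 1) ^ K.card : ℕ) : ℝ)) ?_ ?_
      · exact_mod_cast card_pow_le K _
      · have h4 : 1 ≤ 4 ^ j := Nat.one_le_pow _ _ (by norm_num)
        have : (4 ^ j * (N + 1) + 1) ^ K.card ≤ (4 ^ j * (N + 2)) ^ K.card :=
          Nat.pow_le_pow_left (by nlinarith) _
        exact_mod_cast this
    have h3 := h1.trans h2
    rw [mul_pow, mul_pow, ← pow_mul, ← pow_mul, mul_comm K.card j, mul_comm ((2 : ℝ) ^ j)] at h3
    exact le_of_mul_le_mul_left h3 (by positivity)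
  obtain ⟨j, hj⟩ := pow_unbounded_of_one_lt ((N + 2 : ℝ) ^ K.card) (by norm_num : (1 : ℝ) < 2)
  exact absurd (hb j) (not_le.2 hj)

end Gen

section Compare

variable {G X : Type*} [CommGroup G] [TopologicalSpace X] [MulAction G X]
  [CompactSpace X] [FreeAct G X] [ContinuousConstSMul G X]

theorem greedy {A D : Set X} (hA : IsClopen A) (hD : IsClopen D) (S : Finset G) :
    ∃ (M : Set X) (θ : X → G), IsClopen M ∧ M ⊆ A ∧ IsLocallyConstant θ ∧
      (∀ x ∈ M, θ x ∈ S ∧ θ x • x ∈ D) ∧ (∀ x ∈ M, ∀ y ∈ M, θ x • x = θ y • y → x = y) ∧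
      ∀ x ∈ A, x ∉ M → ∀ g ∈ S, g • x ∈ D → ∃ a ∈ M, θ a • a = g • x := by
  induction S using Finset.induction_on with
  | empty =>
    exact ⟨∅, fun _ => 1, isClopen_empty, by simp, IsLocallyConstant.const _, by simp, by simp,
      by simp⟩
  | insert g S _ ih =>
    obtain ⟨M, θ, hM, hMA, hθ, h1, h2, h3⟩ := ih
    set U := (fun x => θ x • x) '' M with hU
    have cU : IsClopen U := PW.clopen_image (G := G) ⟨θ, hθ, fun _ => rfl⟩ hM
    refine ⟨M ∪ ((A \ M) ∩ {x | g • x ∈ D \ U}), fun x => if x ∈ M then θ x else g, ?_, ?_, ?_, ?_,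
      ?_, ?_⟩
    · exact hM.union ((hA.diff hM).inter (clopen_smul_pre (hD.diff cU) g))
    · exact Set.union_subset hMA (Set.inter_subset_left.trans Set.sdiff_subset)
    · exact lc_ite hM hθ (IsLocallyConstant.const _)
    · rintro x (hx | ⟨⟨hxA, hxM⟩, hx⟩)
      · simp only [if_pos hx]
        exact ⟨Finset.mem_insert_of_mem (h1 x hx).1, (h1 x hx).2⟩
      · simp only [if_neg hxM]
        exact ⟨Finset.mem_insert_self _ _, hx.1⟩
    · have aux : ∀ x ∈ M, ∀ y, g • y ∈ D \ U → θ x • x ≠ g • y :=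
        fun x hx y hy h => hy.2 ⟨x, hx, h⟩
      rintro x (hx | ⟨⟨hxA, hxM⟩, hx⟩) y (hy | ⟨⟨hyA, hyM⟩, hy⟩) h
      · simp only [if_pos hx, if_pos hy] at h; exact h2 x hx y hy h
      · simp only [if_pos hx, if_neg hyM] at h; exact absurd h (aux x hx y hy)
      · simp only [if_pos hy, if_neg hxM] at h; exact absurd h.symm (aux y hy x hx)
      · simp only [if_neg hyM, if_neg hxM] at h
        exact (MulAction.injective g) h
    · intro x hx hxM k hk hkD
      rw [Set.mem_union, not_or] at hxM
      have old : (∃ a ∈ M, θ a • a = k • x) → ∃ a ∈ M ∪ ((A \ M) ∩ {x | g • x ∈ D \ U}),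
          (if a ∈ M then θ a else g) • a = k • x := by
        rintro ⟨a, ha, h⟩
        exact ⟨a, Or.inl ha, by simpa [ha] using h⟩
      rcases Finset.mem_insert.1 hk with rfl | hk
      · apply old
        by_contra hcon
        exact hxM.2 ⟨⟨hx, hxM.1⟩, hkD, fun hu => hcon hu⟩
      · exact old (h3 x hx hxM.1 k hk hkD)

variable [MeasurableSpace X] [BorelSpace X] {μ : Measure X}
  [IsProbabilityMeasure μ] [SMulInvariantMeasure G X μ]
  [TopologicalSpace.MetrizableSpace X]

theorem sum_ind_eq (S : Finset G) (A : Set X) (x : X) :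
    ∑ g ∈ S, ind A (g • x) = (S.filter fun g => g • x ∈ A).card := by
  simp [ind]

theorem weak_comparison [Group.FG G] (hS : Sys G μ) :
    ∃ C : ℝ, 0 < C ∧ ∀ A D : Set X, IsClopen A → IsClopen D → C * μ.real A < μ.real D →
      ∃ θ : X → G, IsLocallyConstant θ ∧ (∀ x ∈ A, θ x • x ∈ D) ∧
        ∀ x ∈ A, ∀ y ∈ A, θ x • x = θ y • y → x = y := by
  obtain ⟨K, hK⟩ := exists_genSet (G := G)
  set C : ℝ := 2 * 4 ^ K.card with hC
  have hC0 : 0 < C := by positivity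
  refine ⟨C, hC0, fun A D hA hD hlt => ?_⟩
  set ε : ℝ := (μ.real D - C * μ.real A) / (2 * (C + 1)) with hε
  have hε0 : 0 < ε := div_pos (by linarith) (by linarith)
  have hεe : C * (μ.real A + ε) < μ.real D - ε := by
    have : ε * (2 * (C + 1)) = μ.real D - C * μ.real A := div_mul_cancel₀ _ (by positivity)
    nlinarith
  obtain ⟨H1, δ1, hδ1, hE1⟩ := uniform_avg hS (lc_ind hA) hε0
  obtain ⟨H2, δ2, hδ2, hE2⟩ := uniform_avg hS (lc_ind hD) hε0
  obtain ⟨s, hs⟩ := hK.exists_sub (H1 ∪ H2)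
  set δ := min δ1 δ2 with hδ
  have hδ0 : 0 < δ := lt_min hδ1 hδ2
  obtain ⟨L, hL⟩ := pow_unbounded_of_one_lt C (by linarith : 1 < 1 + δ)
  obtain ⟨n, hn, hdb⟩ := exists_doubling hK (2 * (s * L))
  have mono : ∀ {a b : ℕ}, a ≤ b → ((K ^ a).card : ℝ) ≤ (K ^ b).card :=
    fun h => by exact_mod_cast hK.card_mono h
  obtain ⟨j1, hj1, hg1⟩ := exists_slow hK (n := n) (s := s) hδ0 hL
    ((mono (by omega)).trans hdb)
  obtain ⟨j2, hj2, hg2⟩ := exists_slow hK (n := 3 * n) (s := s) hδ0 hL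
    ((mono (by omega)).trans (hdb.trans (mul_le_mul_of_nonneg_left (mono (by omega)) hC0.le)))
  have hsj1 : s * j1 ≤ s * L := Nat.mul_le_mul_left _ hj1.le
  have hsj2 : s * j2 ≤ s * L := Nat.mul_le_mul_left _ hj2.le
  set n1 := n + s * j1
  set n2 := 3 * n + s * j2
  have hcount : ∀ x : X, ((K ^ n2).filter fun g => g • x ∈ A).card <
      ((K ^ n1).filter fun g => g • x ∈ D).card := by
    intro x
    have a1 := hE1 (K ^ n2) (Finset.card_pos.1 (hK.card_pos _)) (fun h hh => by
      refine (folner_of_growth K hK hg2 (hs (Finset.mem_union_left _ hh))).trans ?_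
      gcongr; exact min_le_left _ _) x
    have a2 := hE2 (K ^ n1) (Finset.card_pos.1 (hK.card_pos _)) (fun h hh => by
      refine (folner_of_growth K hK hg1 (hs (Finset.mem_union_right _ hh))).trans ?_
      gcongr; exact min_le_right _ _) x
    rw [sum_ind_eq, ing_ind hA, abs_le] at a1
    rw [sum_ind_eq, ing_ind hD, abs_le] at a2
    simp only [Int.cast_natCast] at a1 a2
    have m1 : ((K ^ n2).card : ℝ) ≤ C * (K ^ n1).card :=
      (mono (by omega)).trans (hdb.trans (mul_le_mul_of_nonneg_left (mono (by omega)) hC0.le))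
    have hp : (0 : ℝ) < (K ^ n1).card := by exact_mod_cast hK.card_pos n1
    have : ((((K ^ n2).filter fun g => g • x ∈ A).card : ℕ) : ℝ) <
      (((K ^ n1).filter fun g => g • x ∈ D).card : ℕ) := by
      have h0 : 0 ≤ μ.real A := measureReal_nonneg
      calc _ ≤ (K ^ n2).card * (μ.real A + ε) := by linarith [a1.2]
        _ ≤ (C * (K ^ n1).card) * (μ.real A + ε) := by gcongr
        _ < (K ^ n1).card * (μ.real D - ε) := by nlinarith
        _ ≤ _ := by linarith [a2.1]
    exact_mod_cast this
  obtain ⟨M, θ, hM, hMA, hθ, h1, h2, h3⟩ := greedy hA hD (K ^ n1)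
  have hAM : ∀ x ∈ A, x ∈ M := by
    intro x hx
    by_contra hxM
    refine absurd (hcount x) (not_lt.2 ?_)
    have h4 : ∀ g ∈ (K ^ n1).filter (fun g => g • x ∈ D), ∃ a ∈ M, θ a • a = g • x := by
      intro g hg
      rw [Finset.mem_filter] at hg
      exact h3 x hx hxM g hg.1 hg.2
    have : Nonempty X := ⟨x⟩
    choose! a haM hae using h4
    refine Finset.card_le_card_of_injOn (fun g => (θ (a g))⁻¹ * g) ?_ ?_
    · intro g hg
      have e : ((θ (a g))⁻¹ * g) • x = a g := by
        rw [mul_smul, ← hae g hg, inv_smul_smul]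
      simp only [Finset.coe_filter, Set.mem_ofPred_eq]
      refine ⟨?_, by rw [e]; exact hMA (haM g hg)⟩
      have : (θ (a g))⁻¹ * g ∈ K ^ n1 * K ^ n1 :=
        Finset.mul_mem_mul (inv_mem_pow hK.symm (h1 _ (haM g hg)).1) (Finset.mem_filter.1 hg).1
      rw [← pow_add] at this
      exact pow_mono_of_one_mem hK.one (by omega) this
    · intro g hg h hh heq
      have e : ∀ g ∈ (K ^ n1).filter (fun g => g • x ∈ D), ((θ (a g))⁻¹ * g) • x = a g :=
        fun g hg => by rw [mul_smul, ← hae g hg, inv_smul_smul]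
      have : a g = a h := by rw [← e g hg, ← e h hh]; simp only at heq; rw [heq]
      rw [← smul_inj (x := x), ← hae g hg, ← hae h hh, this]
  exact ⟨θ, hθ, fun x hx => (h1 x (hAM x hx)).2, fun x hx y hy => h2 x (hAM x hx) y (hAM y hy)⟩

end Compare

end

section

section StepA

variable {G X : Type*} [CommGroup G] [TopologicalSpace X] [MulAction G X]
  [CompactSpace X] [FreeAct G X] [ContinuousConstSMul G X]

theorem card_fib_le {b : X → X} (hb : PW G b) {T : Finset G} (hT : ∀ x, ∃ g ∈ T, b x = g • x)
    (z : X) : (fib G b z).card ≤ T.card := by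
  have : fib G b z ⊆ T.image (fun t => t⁻¹ • z) := by
    intro x hx
    rw [mem_fib hb] at hx
    obtain ⟨g, hg, h⟩ := hT x
    exact Finset.mem_image.2 ⟨g, hg, by rw [← hx, h, inv_smul_smul]⟩
  exact (Finset.card_le_card this).trans Finset.card_image_le

theorem cut_comp_sub {b τ : X → X} {T : Finset G} (hT : ∀ x, ∃ g ∈ T, b x = g • x)
    (H H' : Finset G) (hH' : ∀ h ∈ H, ∀ s ∈ T, ∀ t ∈ T, s * h * t⁻¹ ∈ H') :
    cut H (τ ∘ b) ⊆ b ⁻¹' cut H' τ := by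
  rintro x ⟨h, hh, hx⟩
  obtain ⟨t, ht, het⟩ := hT x
  obtain ⟨s, hs, hes⟩ := hT (h • x)
  refine ⟨s * h * t⁻¹, hH' h hh s hs t ht, ?_⟩
  have : (s * h * t⁻¹) • b x = b (h • x) := by
    rw [het, hes, mul_smul, inv_smul_smul, mul_smul]
  rw [this]; exact hx

theorem sig_ind (b : X → X) (C : Set X) (z : X) :
    sig G b (ind C) z = ((fib G b z).filter (· ∈ C)).card := by
  simp [sig, ind]

variable [T2Space X] [TotallyDisconnectedSpace X]
variable [MeasurableSpace X] [BorelSpace X] {μ : Measure X}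
  [IsProbabilityMeasure μ] [SMulInvariantMeasure G X μ] [TopologicalSpace.MetrizableSpace X]

theorem uniform_avg_finset (hS : Sys G μ) (F : Finset (X → ℤ))
    (hF : ∀ f ∈ F, IsLocallyConstant f) {ε : ℝ} (hε : 0 < ε) :
    ∃ (H : Finset G) (δ : ℝ), 0 < δ ∧ δ ≤ 1 ∧ ∀ Φ : Finset G, Φ.Nonempty →
      (∀ h ∈ H, ((Φ.filter fun g => h * g ∉ Φ).card : ℝ) ≤ δ * Φ.card) →
      ∀ x : X, ∀ f ∈ F, |((∑ g ∈ Φ, f (g • x) : ℤ) : ℝ) - Φ.card * ing μ f| ≤ ε * Φ.card := by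
  induction F using Finset.induction_on with
  | empty => exact ⟨∅, 1, one_pos, le_rfl, by simp⟩
  | insert f F _ ih =>
    obtain ⟨H, δ, hδ, hδ1, h⟩ := ih fun f hf => hF f (Finset.mem_insert_of_mem hf)
    obtain ⟨H', δ', hδ', h'⟩ := uniform_avg hS (hF f (Finset.mem_insert_self _ _)) hε
    refine ⟨H ∪ H', min δ δ', lt_min hδ hδ', (min_le_left _ _).trans hδ1, ?_⟩
    intro Φ hΦ hi x f0 hf0
    rcases Finset.mem_insert.1 hf0 with rfl | hf0
    · exact h' Φ hΦ (fun g hg => (hi g (Finset.mem_union_right _ hg)).trans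
        (by gcongr; exact min_le_right _ _)) x
    · exact h Φ hΦ (fun g hg => (hi g (Finset.mem_union_left _ hg)).trans
        (by gcongr; exact min_le_left _ _)) x f0 hf0

theorem exists_bounds (F : Finset (X → ℤ)) (hF : ∀ f ∈ F, IsLocallyConstant f)
    (hp : ∀ f ∈ F, 0 < ing μ f) :
    ∃ (M c : ℝ), 0 < M ∧ 0 < c ∧ ∀ f ∈ F, c ≤ ing μ f ∧ ∀ x, |(f x : ℝ)| ≤ M := by
  induction F using Finset.induction_on with
  | empty => exact ⟨1, 1, one_pos, one_pos, by simp⟩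
  | insert f F _ ih =>
    obtain ⟨M, c, hM, hc, h⟩ := ih (fun f hf => hF f (Finset.mem_insert_of_mem hf))
      (fun f hf => hp f (Finset.mem_insert_of_mem hf))
    obtain ⟨M', hM'⟩ := ((hF f (Finset.mem_insert_self _ _)).comp
      (fun n : ℤ => |(n : ℝ)|)).range_finite.bddAbove
    refine ⟨max M M', min c (ing μ f), lt_max_of_lt_left hM,
      lt_min hc (hp f (Finset.mem_insert_self _ _)), ?_⟩
    intro f0 hf0
    rcases Finset.mem_insert.1 hf0 with rfl | hf0
    · exact ⟨min_le_right _ _, fun x => (hM' ⟨x, rfl⟩).trans (le_max_right _ _)⟩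
    · exact ⟨(min_le_left _ _).trans (h f0 hf0).1, fun x => ((h f0 hf0).2 x).trans (le_max_left _ _)⟩

theorem stepA_arith {M c N p n I S E s L : ℝ} (hM : 0 < M) (hN : 0 < N)
    (hp : 0 < p) (hn : 0 < n) (hPs : p * (1 + 4 * M * N + 4 * |L|) < c) (hcf : c ≤ I)
    (e2 : -(p / 2 * n) ≤ S - n * I) (hE : M * E ≤ M * (N * (3 / 2 * p * n))) (hs : -(M * E) ≤ s)
    (h1 : 1 ≤ 3 / 2 * p * n) : L < S + s := by
  have h3 : p * (1 + 4 * M * N + 4 * |L|) * n ≤ c * n := by gcongr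
  have h4 : 0 < M * N * p * n := by positivity
  have h2 : c * n ≤ n * I := by nlinarith
  have h9 := le_abs_self L
  have h6 : |L| ≤ |L| * (3 / 2 * p * n) := by nlinarith [abs_nonneg L]
  have h7 : 0 ≤ |L| * (p * n) := by positivity
  have h8 : 0 < p * n := by positivity
  nlinarith

set_option maxHeartbeats 1000000 in
theorem stepA [Nonempty X] [Group.FG G] (hS : Sys G μ) {b : X → X} (hb : PW G b)
    (F : Finset (X → ℤ))
    (hF : ∀ f ∈ F, IsLocallyConstant f) (hFp : ∀ f ∈ F, 0 < ing μ f) (L : ℤ) {ε : ℝ} (hε : 0 < ε)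
    (K : Finset G) :
    ∃ a : X → X, PW G a ∧ (∀ f ∈ F, ∀ x, L < sig G (a ∘ b) f (a (b x))) ∧
      μ.real (cut K (a ∘ b)) < ε := by
  obtain ⟨T, hT⟩ := hb.bdd
  have hN : (0 : ℝ) < T.card := by
    obtain ⟨g, hg, -⟩ := hT (Classical.arbitrary X)
    exact_mod_cast Finset.card_pos.2 ⟨g, hg⟩
  set N : ℝ := (T.card : ℝ) with hNdef
  obtain ⟨M, c, hM, hc, hb1⟩ := exists_bounds F hF hFp
  obtain ⟨P, cP, hxP, -, hPs, -⟩ := exists_clopen_small hS (Classical.arbitrary X)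
    (ε := c / (1 + 4 * M * N + 4 * |(L : ℝ)|)) (by positivity) (p := fun _ => True) (by simp)
    (∅ : Finset G)
  have hp : 0 < μ.real P := real_pos hS cP ⟨_, hxP⟩
  set p := μ.real P with hpdef
  rw [lt_div_iff₀ (by positivity)] at hPs
  obtain ⟨H, δ, hδ, hδ1, hav⟩ := uniform_avg_finset hS (insert (ind P) F) (by
    intro f hf
    rcases Finset.mem_insert.1 hf with rfl | hf
    · exact lc_ind cP
    · exact hF f hf) (ε := p / 2) (by positivity)
  obtain ⟨C, hC, hcomp⟩ := weak_comparison hS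
  set e : ℝ := min (p / (2 * (C * N + 1))) (ε / (2 * (2 + (K.card : ℝ)))) with he
  have he0 : 0 < e := lt_min (by positivity) (by positivity)
  have he1 : e * (C * N + 1) < p := by
    have : e ≤ p / (2 * (C * N + 1)) := min_le_left _ _
    rw [le_div_iff₀ (by positivity)] at this
    nlinarith
  have he2 : e * (2 + K.card) < ε := by
    have : e ≤ ε / (2 * (2 + K.card)) := min_le_right _ _
    rw [le_div_iff₀ (by positivity)] at this
    nlinarith
  set H0 := T * (H ∪ K) * T⁻¹ with hH0
  set H' : Finset G := insert 1 (H0 ∪ H0⁻¹) with hH'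
  obtain ⟨τ, hτ, hτc⟩ := tile μ (K := H') (by
    intro k hk
    simp only [hH', Finset.mem_insert, Finset.mem_union, Finset.mem_inv', inv_eq_one, inv_inv] at hk ⊢
    tauto) (by simp [hH']) (ε := e * δ / N) (by positivity)
  set b0 := τ ∘ b with hb0
  have pb0 : PW G b0 := hτ.comp hb
  have hcut : μ.real (cut (H ∪ K) b0) ≤ e * δ := by
    have h1 : cut (H ∪ K) b0 ⊆ b ⁻¹' cut H' τ := by
      apply cut_comp_sub hT
      intro h hh s hs t ht
      simp only [hH', Finset.mem_insert, Finset.mem_union]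
      exact Or.inr (Or.inl (Finset.mul_mem_mul (Finset.mul_mem_mul hs hh) (Finset.inv_mem_inv ht)))
    calc _ ≤ N * μ.real (cut H' τ) :=
          (rmono h1).trans (real_pre_le hT (clopen_cut hτ _).isOpen.measurableSet)
      _ ≤ N * (e * δ / N) := by gcongr
      _ = e * δ := by field_simp
  set Bad : Set X := {z | ∃ h ∈ H, δ * (Phi G b0 z).card <
    (((Phi G b0 z).filter fun g => h * g ∉ Phi G b0 z).card : ℝ)} with hBad
  have cBad : IsClopen Bad := clopen_of_lc ((lc_Phi pb0).comp (fun Φ : Finset G => ∃ h ∈ H,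
    δ * Φ.card < ((Φ.filter fun g => h * g ∉ Φ).card : ℝ)))
  set bad := b0 ⁻¹' Bad with hbad
  have cbad : IsClopen bad := cBad.preimage pb0.continuous
  have hbadm : μ.real bad ≤ e := by
    have key : ∀ z, δ * (sig G b0 (ind bad) z : ℝ) ≤ (sig G b0 (ind (cut (H ∪ K) b0)) z : ℝ) := by
      intro z
      by_cases hz : z ∈ Bad
      · have h1 : sig G b0 (ind bad) z = (Phi G b0 z).card := by
          rw [sig_ind, ← card_fib, Finset.filter_true_of_mem]
          intro x hx
          rw [mem_fib pb0] at hx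
          change b0 x ∈ Bad
          rwa [hx]
        obtain ⟨h, hh, hlt⟩ := hz
        rw [h1]
        push_cast
        refine hlt.le.trans ?_
        rw [sig_eq]
        rw [sum_ind_eq]
        push_cast
        norm_cast
        apply Finset.card_le_card
        intro g hg
        rw [Finset.mem_filter] at hg ⊢
        refine ⟨hg.1, h, Finset.mem_union_left _ hh, ?_⟩
        rw [mem_Phi pb0, mem_Phi pb0] at hg
        rw [hg.1, smul_smul]
        exact hg.2
      · have h1 : sig G b0 (ind bad) z = 0 := by
          rw [sig_ind, Finset.filter_false_of_mem]
          · simp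
          intro x hx hxb
          rw [mem_fib pb0] at hx
          apply hz
          rw [← hx]; exact hxb
        rw [h1, sig_ind]
        simp
    have i1 : δ * ing μ (sig G b0 (ind bad)) ≤ ing μ (sig G b0 (ind (cut (H ∪ K) b0))) := by
      simp only [ing]
      rw [← integral_const_mul]
      exact integral_mono ((lc_integrable (lc_sig pb0 (lc_ind cbad))).const_mul _)
        (lc_integrable (lc_sig pb0 (lc_ind (clopen_cut pb0 _)))) key
    rw [ing_sig pb0 (lc_ind cbad), ing_sig pb0 (lc_ind (clopen_cut pb0 _)), ing_ind cbad,
      ing_ind (clopen_cut pb0 _)] at i1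
    have := i1.trans hcut
    rw [mul_comm] at this
    exact le_of_mul_le_mul_right this hδ
  set A := b '' bad with hA
  have cA : IsClopen A := hb.clopen_image cbad
  set D := P \ bad with hD
  have cD : IsClopen D := cP.diff cbad
  have hAm : μ.real A ≤ N * e :=
    (real_image_le (fun x _ => hT x) cbad.isOpen.measurableSet).trans (by gcongr)
  have hDm : p - e ≤ μ.real D := by
    have : p ≤ μ.real D + μ.real bad := by
      refine (rmono (?_ : P ⊆ D ∪ bad)).trans (measureReal_union_le _ _)
      intro x hx
      by_cases h : x ∈ bad
      · exact Or.inr h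
      · exact Or.inl ⟨hx, h⟩
    linarith
  obtain ⟨θ, hθ, hθD, hθi⟩ := hcomp A D cA cD (by
    have : C * μ.real A ≤ C * (N * e) := by gcongr
    nlinarith)
  set a : X → X := fun w => if w ∈ A then b0 (θ w • w) else τ w with ha
  have pa : PW G a := PW.piecewise cA (pb0.comp ⟨θ, hθ, fun _ => rfl⟩) hτ
  have hbA : ∀ x, b x ∈ A ↔ x ∈ bad := by
    intro x
    constructor
    · rintro ⟨y, hy, hyx⟩
      change b0 x ∈ Bad
      have : b0 x = b0 y := by simp [hb0, hyx]
      rw [this]; exact hy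
    · exact fun h => ⟨x, h, rfl⟩
  have pab := pa.comp hb
  have hab1 : ∀ x, x ∉ bad → a (b x) = b0 x := by
    intro x hx
    simp only [ha, hbA, hx, if_false]; rfl
  have hab2 : ∀ x, x ∈ bad → a (b x) = b0 (θ (b x) • b x) := by
    intro x hx
    simp only [ha, hbA, hx, if_true]
  have hgood : ∀ x, a (b x) ∉ Bad := by
    intro x
    by_cases hx : x ∈ bad
    · rw [hab2 x hx]
      exact (hθD _ ((hbA x).2 hx)).2
    · rw [hab1 x hx]; exact hx
  have hne : ∀ x, (Phi G b0 (a (b x))).Nonempty := by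
    intro x
    have : ∃ y, y ∈ fib G b0 (a (b x)) := by
      by_cases hx : x ∈ bad
      · exact ⟨θ (b x) • b x, by rw [mem_fib pb0, hab2 x hx]⟩
      · exact ⟨x, by rw [mem_fib pb0, hab1 x hx]⟩
    obtain ⟨y, hy⟩ := this
    rw [← Finset.card_pos, ← card_fib]
    exact Finset.card_pos.2 ⟨y, hy⟩
  refine ⟨a, pa, ?_, ?_⟩
  · intro f hf x
    set z := a (b x) with hz
    have hav' := hav (Phi G b0 z) (hne x) (by
      intro h hh
      by_contra! hcon
      exact hgood x ⟨h, hh, hcon⟩) z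
    simp only [← sig_eq] at hav'
    have e1 := hav' _ (Finset.mem_insert_self _ _)
    have e2 := hav' f (Finset.mem_insert_of_mem hf)
    rw [ing_ind cP] at e1
    set n : ℝ := ((Phi G b0 z).card : ℝ) with hn
    have hn0 : 0 < n := by rw [hn]; exact_mod_cast Finset.card_pos.2 (hne x)
    rw [abs_le] at e1 e2
    set EX := (fib G (a ∘ b) z) \ (fib G b0 z) with hEX
    have hsub : fib G b0 z ⊆ fib G (a ∘ b) z := by
      intro y hy
      rw [mem_fib pb0] at hy
      rw [mem_fib pab]
      change a (b y) = z
      rw [hab1 y, hy]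
      change b0 y ∉ Bad
      rw [hy]; exact hgood x
    have hsplit : sig G (a ∘ b) f z = sig G b0 f z + ∑ y ∈ EX, f y := by
      rw [sig, sig, hEX, add_comm, Finset.sum_sdiff hsub]
    have hEXb : ∀ y ∈ EX, b y ∈ A ∧ a (b y) = z := by
      intro y hy
      rw [hEX, Finset.mem_sdiff, mem_fib pab, mem_fib pb0] at hy
      refine ⟨?_, hy.1⟩
      by_contra h
      rw [hbA] at h
      apply hy.2
      rw [← hab1 y h]; exact hy.1
    have hEXc : (EX.card : ℝ) ≤ N * (sig G b0 (ind P) z : ℝ) := by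
      rw [sig_ind]
      have := Finset.card_le_mul_card_image_of_maps_to (s := EX)
        (t := (fib G b0 z).filter (· ∈ P)) (f := fun y => θ (b y) • b y) (by
          intro y hy
          obtain ⟨h1, h2⟩ := hEXb y hy
          rw [Finset.mem_filter, mem_fib pb0]
          refine ⟨?_, (hθD _ h1).1⟩
          rw [← hab2 y ((hbA y).1 h1), h2]) T.card (by
          intro w _
          by_cases hem : ∃ y ∈ EX, θ (b y) • b y = w
          · obtain ⟨y, hy, hyw⟩ := hem
            refine (Finset.card_le_card ?_).trans (card_fib_le hb hT (b y))
            intro y' hy'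
            rw [Finset.mem_filter] at hy'
            rw [mem_fib hb]
            exact hθi _ (hEXb y' hy'.1).1 _ (hEXb y hy).1 (by rw [hy'.2, hyw])
          · rw [Finset.filter_false_of_mem]
            · simp
            · intro y hy h
              exact hem ⟨y, hy, h⟩)
      rw [hNdef]
      push_cast
      exact_mod_cast this
    have hsum : |((∑ y ∈ EX, f y : ℤ) : ℝ)| ≤ M * EX.card := by
      push_cast
      refine (Finset.abs_sum_le_sum_abs _ _).trans ?_
      calc _ ≤ ∑ y ∈ EX, M := Finset.sum_le_sum fun y _ => (hb1 f hf).2 y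
        _ = _ := by simp [mul_comm]
    rw [abs_le] at hsum
    have hPc : (sig G b0 (ind P) z : ℝ) ≤ 3 / 2 * p * n := by linarith [e1.2]
    have hP1 : (1 : ℝ) ≤ sig G b0 (ind P) z := by
      have : (0 : ℝ) < sig G b0 (ind P) z := by nlinarith [e1.1]
      have : (0 : ℤ) < sig G b0 (ind P) z := by exact_mod_cast this
      exact_mod_cast this
    have hcf := (hb1 f hf).1
    have hEX2 : M * EX.card ≤ M * (N * (3 / 2 * p * n)) := by
      exact mul_le_mul_of_nonneg_left (hEXc.trans (mul_le_mul_of_nonneg_left hPc hN.le)) hM.le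
    have := stepA_arith hM hN hp hn0 hPs hcf e2.1 hEX2 hsum.1 (hP1.trans hPc)
    rw [hsplit]
    exact_mod_cast this
  · have h1 : cut K (a ∘ b) ⊆ cut (H ∪ K) b0 ∪ (bad ∪ ⋃ k ∈ K, {x | k • x ∈ bad}) := by
      rintro x ⟨k, hk, hx⟩
      by_cases hx1 : x ∈ bad
      · exact Or.inr (Or.inl hx1)
      by_cases hx2 : k • x ∈ bad
      · refine Or.inr (Or.inr ?_)
        simp only [Set.mem_iUnion]
        exact ⟨k, hk, hx2⟩
      · refine Or.inl ⟨k, Finset.mem_union_right _ hk, ?_⟩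
        rw [← hab1 x hx1, ← hab1 _ hx2]
        exact hx
    have h2 : μ.real (⋃ k ∈ K, {x | k • x ∈ bad}) ≤ K.card * e := by
      refine (measureReal_biUnion_finset_le _ _).trans ?_
      rw [Finset.sum_congr rfl fun g _ => real_smul_pre cbad.isOpen.measurableSet g]
      simp only [Finset.sum_const, nsmul_eq_mul]
      gcongr
    have h3 := (rmono (μ := μ) h1).trans (measureReal_union_le _ _)
    have h4 := measureReal_union_le (μ := μ) bad (⋃ k ∈ K, {x | k • x ∈ bad})
    nlinarith

end StepA

end

section

/-- The multiset of labels on a fibre. -/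
noncomputable def ltype (G : Type*) {X : Type*} [Group G] [MulAction G X] (b : X → X) (π : X → ℕ)
    (z : X) : Multiset ℕ := (Phi G b z).val.map fun g => π (g • z)

section Rich

variable {G X : Type*} [CommGroup G] [TopologicalSpace X] [MulAction G X]
  [CompactSpace X] [FreeAct G X] [ContinuousConstSMul G X]

theorem lc_ltype {b : X → X} (hb : PW G b) {π : X → ℕ} (hπ : IsLocallyConstant π) :
    IsLocallyConstant (ltype G b π) := by
  apply lc_of_ev
  intro z
  filter_upwards [lc_ev (lc_Phi hb) z, lc_finite_forall (Phi G b z) (f := fun g z => π (g • z))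
    (fun g _ => lc_smul hπ g) z] with y h1 h2
  simp only [ltype, h1]
  exact Multiset.map_congr rfl h2

theorem sig_ltype (b : X → X) (π : X → ℕ) (F : ℕ → ℤ) (z : X) :
    sig G b (fun x => F (π x)) z = ((ltype G b π z).map F).sum := by
  rw [sig_eq, ltype, Multiset.map_map]; rfl

theorem sig_of_ltype {b : X → X} {π : X → ℕ} {z z' : X} (h : ltype G b π z = ltype G b π z')
    (F : ℕ → ℤ) : sig G b (fun x => F (π x)) z = sig G b (fun x => F (π x)) z' := by
  rw [sig_ltype, sig_ltype, h]

variable [T2Space X] [TotallyDisconnectedSpace X]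
variable [MeasurableSpace X] [BorelSpace X] {μ : Measure X}
  [IsProbabilityMeasure μ] [SMulInvariantMeasure G X μ] [TopologicalSpace.MetrizableSpace X]

theorem exists_near (hS : Sys G μ) (x : X) {p : X → Prop} (hp : ∀ᶠ y in 𝓝 x, p y) (Z : Finset X) :
    ∃ y, p y ∧ y ∉ Z := by
  obtain ⟨U, hU, hUo, hx⟩ := mem_nhds_iff.1 hp
  obtain ⟨y, hy, hyZ⟩ := (hS.perf U hUo ⟨x, hx⟩).exists_notMem_finset Z
  exact ⟨y, hU hy, hyZ⟩

theorem exists_smul_notMem (hS : Sys G μ) (x : X) (Z : Finset X) : ∃ g : G, g • x ∉ Z := by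
  have := infinite_group hS
  have hinj : Function.Injective (fun g : G => g • x) := fun g h H => smul_inj.1 H
  obtain ⟨y, ⟨g, rfl⟩, h⟩ := (Set.infinite_range_of_injective hinj).exists_notMem_finset Z
  exact ⟨g, h⟩

theorem ev_inj {b : X → X} (hb : PW G b) (x : X) : ∃ g : G, ∀ᶠ y in 𝓝 x, b y = g • y := by
  obtain ⟨θ, hθ, h⟩ := hb
  exact ⟨θ x, by filter_upwards [lc_ev hθ x] with y hy; rw [h, hy]⟩

theorem ev_notMem (Z : Finset X) (x : X) : ∀ᶠ y in 𝓝 x, y ∈ Z → y = x := by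
  have : ∀ᶠ y in 𝓝 x, y ∉ Z.erase x :=
    (Z.erase x).finite_toSet.isClosed.isOpen_compl.mem_nhds (by simp)
  filter_upwards [this] with y hy hyZ
  by_contra h
  exact hy (Finset.mem_erase.2 ⟨h, hyZ⟩)

theorem abs_sum_sub_le {A B E : Finset X} {f : X → ℤ} {M : ℤ} (hM : ∀ x, |f x| ≤ M)
    (h1 : A \ B ⊆ E) : ∑ x ∈ A, f x ≤ ∑ x ∈ A ∩ B, f x + E.card * M := by
  rw [← Finset.sum_inter_add_sum_sdiff A B]
  have hM0 : ∀ x ∈ E, 0 ≤ M := fun x _ => (abs_nonneg _).trans (hM x)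
  have : ∑ x ∈ A \ B, f x ≤ ∑ x ∈ A \ B, M :=
    Finset.sum_le_sum fun x _ => (le_abs_self _).trans (hM x)
  have h2 : ∑ x ∈ A \ B, M ≤ ∑ x ∈ E, M :=
    Finset.sum_le_sum_of_subset_of_nonneg h1 fun x hx _ => hM0 x hx
  simp only [Finset.sum_const, nsmul_eq_mul] at this h2
  linarith

theorem cut_perturb_le {b : X → X} (hb : PW G b) {T : Finset G} (hT : ∀ x, ∃ g ∈ T, b x = g • x)
    {O : Set X} (cO : IsClopen O) (K : Finset G) {a a' : X → X}
    (hout : ∀ x, b x ∉ O → a' (b x) = a (b x)) :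
    μ.real (cut K (a' ∘ b)) ≤ μ.real (cut K (a ∘ b)) + (1 + K.card) * (T.card * μ.real O) := by
  have h1 : cut K (a' ∘ b) ⊆ cut K (a ∘ b) ∪ (b ⁻¹' O ∪ ⋃ k ∈ K, {x | k • x ∈ b ⁻¹' O}) := by
    rintro x ⟨k, hk, hx⟩
    by_cases hx1 : b x ∈ O
    · exact Or.inr (Or.inl hx1)
    by_cases hx2 : b (k • x) ∈ O
    · refine Or.inr (Or.inr ?_)
      simp only [Set.mem_iUnion]
      exact ⟨k, hk, hx2⟩
    · refine Or.inl ⟨k, hk, ?_⟩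
      change a (b (k • x)) ≠ a (b x)
      rw [← hout x hx1, ← hout _ hx2]
      exact hx
  have cP : IsClopen (b ⁻¹' O) := cO.preimage hb.continuous
  have h0 : μ.real (b ⁻¹' O) ≤ T.card * μ.real O := real_pre_le hT cO.isOpen.measurableSet
  have h2 : μ.real (⋃ k ∈ K, {x | k • x ∈ b ⁻¹' O}) ≤ K.card * (T.card * μ.real O) := by
    refine (measureReal_biUnion_finset_le _ _).trans ?_
    rw [Finset.sum_congr rfl fun g _ => real_smul_pre cP.isOpen.measurableSet g]
    simp only [Finset.sum_const, nsmul_eq_mul]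
    gcongr
  have h3 := (rmono (μ := μ) h1).trans (measureReal_union_le _ _)
  have h4 := measureReal_union_le (μ := μ) (b ⁻¹' O) (⋃ k ∈ K, {x | k • x ∈ b ⁻¹' O})
  linarith

set_option maxHeartbeats 800000 in
theorem perturb (hS : Sys G μ) {b : X → X} (hb : PW G b) {π : X → ℕ} (hπ : IsLocallyConstant π)
    {T : Finset G} (hT : ∀ x, ∃ g ∈ T, b x = g • x)
    {F : Finset (X → ℤ)} {M : ℤ} (hM : ∀ f ∈ F, ∀ x, |f x| ≤ M) (L : ℤ) {ε : ℝ} (K : Finset G)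
    {a : X → X} (ha : PW G a)
    (hL : ∀ f ∈ F, ∀ x, L + 2 * T.card * M < sig G (a ∘ b) f (a (b x)))
    (hε : μ.real (cut K (a ∘ b)) < ε) (Z : Finset X) (x0 : X) :
    ∃ a' : X → X, PW G a' ∧ (∀ f ∈ F, ∀ x, L < sig G (a' ∘ b) f (a' (b x))) ∧
      μ.real (cut K (a' ∘ b)) < ε ∧ (∀ z ∈ Z, fib G (a' ∘ b) z = fib G (a ∘ b) z) ∧
      ∃ y y', ∀ D : ℕ → ℤ, sig G (a' ∘ b) (fun x => D (π x)) y - sig G (a' ∘ b) (fun x => D (π x)) y'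
        = sig G b (fun x => D (π x)) (b x0) := by
  have pab := ha.comp hb
  -- a base point of the same type away from the protected fibres
  obtain ⟨x1, hx1t, hx1Z⟩ := exists_near hS x0 (lc_ev (hb.lc_comp (lc_ltype hb hπ)) x0)
    (Z.biUnion fun z => fib G (a ∘ b) z)
  set w1 := b x1 with hw1
  have hw1Z : a w1 ∉ Z := by
    intro h
    exact hx1Z (Finset.mem_biUnion.2 ⟨_, h, (mem_fib pab).2 rfl⟩)
  obtain ⟨k, hk⟩ := exists_smul_notMem hS w1 ((insert (a w1) Z).biUnion fun z => fib G (a ∘ b) z)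
  obtain ⟨g, hg⟩ : ∃ g : G, b (k • w1) = g • w1 := by
    obtain ⟨t, -, ht⟩ := hT (k • w1)
    exact ⟨t * k, by rw [ht, mul_smul]⟩
  set y := a (g • w1) with hy
  have hyZ : y ∉ insert (a w1) Z := by
    intro h
    refine hk (Finset.mem_biUnion.2 ⟨_, h, (mem_fib pab).2 ?_⟩)
    rw [hy, ← hg]; rfl
  rw [Finset.mem_insert, not_or] at hyZ
  obtain ⟨x3, hx3t, hx3Z⟩ := exists_near hS (k • w1)
    (lc_ev (pab.lc_comp (lc_ltype pab hπ)) (k • w1))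
    ((fib G (a ∘ b) y) ∪ fib G (a ∘ b) (a w1))
  set y' := a (b x3) with hy'
  have hyt : ltype G (a ∘ b) π y' = ltype G (a ∘ b) π y := by
    rw [hy, ← hg]; exact hx3t
  have hy'1 : y' ≠ y := fun h => hx3Z (Finset.mem_union_left _ ((mem_fib pab).2 h))
  have hy'2 : y' ≠ a w1 := fun h => hx3Z (Finset.mem_union_right _ ((mem_fib pab).2 h))
  -- the moved map
  have pg : PW G (fun x : X => a (g • x)) := ha.comp (PW.smul g)
  set b3 : X → X := fun x => a (g • b x) with hb3
  have pb3 : PW G b3 := pg.comp hb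
  set V : Finset X := insert y (insert y' Z) with hV
  set E : Finset X := V.biUnion fun v => (fib G (a ∘ b) v ∪ fib G b3 v).image b with hE
  obtain ⟨s1, hs1⟩ := ev_inj ha w1
  obtain ⟨s2, hs2⟩ := ev_inj pg w1
  have hev : ∀ᶠ w in 𝓝 w1, (w ∈ E → w = w1) ∧ a w = s1 • w ∧ a (g • w) = s2 • w ∧
      b (k • w) = g • w := by
    filter_upwards [ev_notMem E w1, hs1, hs2, hb.ev_smul k g w1] with w h1 h2 h3 h4
    exact ⟨h1, h2, h3, h4.2 hg⟩
  have hη : 0 < (ε - μ.real (cut K (a ∘ b))) / ((1 + K.card) * (T.card + 1)) :=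
    div_pos (by linarith) (by positivity)
  obtain ⟨O, cO, hwO, hO, hOm, -⟩ := exists_clopen_small hS w1 hη hev ∅
  set a' : X → X := fun w => if w ∈ O then a (g • w) else a w with ha'
  have pa' : PW G a' := PW.piecewise cO pg ha
  have pab' := pa'.comp hb
  have hin : ∀ x, b x ∈ O → a' (b x) = b3 x := fun x hx => by simp [ha', hx, hb3]
  have hout : ∀ x, b x ∉ O → a' (b x) = a (b x) := fun x hx => by simp [ha', hx]
  have hfibV : ∀ v ∈ V, v ≠ y → fib G (a' ∘ b) v = fib G (a ∘ b) v := by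
    intro v hv hvy
    have hva : a w1 ≠ v := by
      rintro rfl
      simp only [hV, Finset.mem_insert] at hv
      rcases hv with h | h | h
      · exact hyZ.1 h.symm
      · exact hy'2 h.symm
      · exact hw1Z h
    ext x
    rw [mem_fib pab', mem_fib pab]
    by_cases hx : b x ∈ O
    · have h3 : b3 x ≠ v := by
        intro h
        have : b x ∈ E := Finset.mem_biUnion.2 ⟨v, hv, Finset.mem_image_of_mem _
          (Finset.mem_union_right _ ((mem_fib pb3).2 h))⟩
        have := (hO _ hx).1 this
        rw [hb3] at h
        simp only [this] at h
        exact hvy h.symm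
      have h4 : a (b x) ≠ v := by
        intro h
        have : b x ∈ E := Finset.mem_biUnion.2 ⟨v, hv, Finset.mem_image_of_mem _
          (Finset.mem_union_left _ ((mem_fib pab).2 h))⟩
        have := (hO _ hx).1 this
        rw [this] at h
        exact hva h
      simp only [Function.comp, hin x hx, h3, h4]
    · simp only [Function.comp, hout x hx]
  have hfiby : fib G (a' ∘ b) y = fib G (a ∘ b) y ∪ fib G b w1 := by
    ext x
    rw [Finset.mem_union, mem_fib pab', mem_fib pab, mem_fib hb]
    have hyV : y ∈ V := by simp [hV]
    by_cases hx : b x ∈ O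
    · have h4 : a (b x) ≠ y := by
        intro h
        have : b x ∈ E := Finset.mem_biUnion.2 ⟨y, hyV, Finset.mem_image_of_mem _
          (Finset.mem_union_left _ ((mem_fib pab).2 h))⟩
        have := (hO _ hx).1 this
        rw [this] at h
        exact hyZ.1 h.symm
      simp only [Function.comp, hin x hx, h4, false_or]
      constructor
      · intro h
        refine (hO _ hx).1 (Finset.mem_biUnion.2 ⟨y, hyV, Finset.mem_image_of_mem _
          (Finset.mem_union_right _ ((mem_fib pb3).2 h))⟩)
      · intro h
        rw [hb3]; simp only [h]; exact hy.symm
    · have : b x ≠ w1 := fun h => hx (h ▸ hwO)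
      simp only [Function.comp, hout x hx, this, or_false]
  have hdisj : Disjoint (fib G (a ∘ b) y) (fib G b w1) := by
    rw [Finset.disjoint_left]
    intro x h1 h2
    rw [mem_fib pab] at h1
    rw [mem_fib hb] at h2
    apply hyZ.1
    rw [← h1, Function.comp, h2]
  refine ⟨a', pa', ?_, ?_, fun z hz => hfibV z (by simp [hV, hz]) (by rintro rfl; exact hyZ.2 hz),
    y, y', ?_⟩
  · intro f hf x
    obtain ⟨x', hx'⟩ : ∃ x', a (b x') = a' (b x) := by
      by_cases hx : b x ∈ O
      · refine ⟨k • b x, ?_⟩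
        rw [hin x hx, (hO _ hx).2.2.2]
      · exact ⟨x, (hout x hx).symm⟩
    have h1 := hL f hf x'
    rw [hx'] at h1
    set v := a' (b x) with hv
    refine lt_of_add_lt_add_right (h1.trans_le ?_)
    have h0 : ∑ x ∈ fib G (a ∘ b) v ∩ fib G (a' ∘ b) v, f x - T.card * M ≤
        sig G (a' ∘ b) f v := by
      set E1 := fib G b (s2⁻¹ • v) with hE1
      have hM0 : 0 ≤ M := (abs_nonneg _).trans (hM f hf x)
      have hcard : (E1.card : ℤ) * M ≤ T.card * M :=
        mul_le_mul_of_nonneg_right (by exact_mod_cast card_fib_le hb hT _) hM0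
      have := abs_sum_sub_le (A := fib G (a' ∘ b) v) (B := fib G (a ∘ b) v) (E := E1)
        (f := fun x => - f x) (M := M) (fun x => by simpa using hM f hf x) (by
          intro u hu
          rw [Finset.mem_sdiff, mem_fib pab', mem_fib pab] at hu
          rw [mem_fib hb]
          have hO' : b u ∈ O := by
            by_contra h
            exact hu.2 (by rw [← hu.1]; exact (hout u h).symm)
          rw [eq_inv_smul_iff, ← (hO _ hO').2.2.1, ← hu.1]
          exact (hin u hO').symm)
      simp only [Finset.sum_neg_distrib] at this
      rw [Finset.inter_comm] at this
      rw [sig]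
      linarith
    have h0' : sig G (a ∘ b) f v ≤
        ∑ x ∈ fib G (a ∘ b) v ∩ fib G (a' ∘ b) v, f x + T.card * M := by
      set E1 := fib G b (s1⁻¹ • v) with hE1
      have hM0 : 0 ≤ M := (abs_nonneg _).trans (hM f hf x)
      have hcard : (E1.card : ℤ) * M ≤ T.card * M :=
        mul_le_mul_of_nonneg_right (by exact_mod_cast card_fib_le hb hT _) hM0
      have := abs_sum_sub_le (A := fib G (a ∘ b) v) (B := fib G (a' ∘ b) v) (E := E1)
        (f := f) (M := M) (hM f hf) (by
          intro u hu
          rw [Finset.mem_sdiff, mem_fib pab', mem_fib pab] at hu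
          rw [mem_fib hb]
          have hO' : b u ∈ O := by
            by_contra h
            exact hu.2 (by rw [← hu.1]; exact hout u h)
          rw [eq_inv_smul_iff, ← (hO _ hO').2.1, ← hu.1]
          rfl)
      rw [sig]
      linarith
    linarith
  · refine (cut_perturb_le hb hT cO K hout).trans_lt ?_
    rw [lt_div_iff₀ (by positivity)] at hOm
    have h5 : 0 ≤ μ.real O * (1 + K.card) := mul_nonneg measureReal_nonneg (by positivity)
    linarith
  · intro D
    have e1 : sig G (a' ∘ b) (fun x => D (π x)) y' = sig G (a ∘ b) (fun x => D (π x)) y' := by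
      rw [sig, sig, hfibV y' (by simp [hV]) hy'1]
    have e2 : sig G (a' ∘ b) (fun x => D (π x)) y =
        sig G (a ∘ b) (fun x => D (π x)) y + sig G b (fun x => D (π x)) w1 := by
      rw [sig, sig, sig, hfiby, Finset.sum_union hdisj]
    rw [e1, e2, sig_of_ltype hyt, sig_of_ltype hx1t]
    ring

theorem exists_rich [Group.FG G] (hS : Sys G μ) {b : X → X} (hb : PW G b) {π : X → ℕ}
    (hπ : IsLocallyConstant π) (F : Finset (X → ℤ))
    (hF : ∀ f ∈ F, IsLocallyConstant f) (hFp : ∀ f ∈ F, 0 < ing μ f) {ε : ℝ} (hε : 0 < ε)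
    (K : Finset G) :
    ∃ a : X → X, PW G a ∧ (∀ f ∈ F, ∀ x, 0 < sig G (a ∘ b) f (a (b x))) ∧
      μ.real (cut K (a ∘ b)) < ε ∧ ∀ w, ∃ y y', ∀ D : ℕ → ℤ,
        sig G (a ∘ b) (fun x => D (π x)) y - sig G (a ∘ b) (fun x => D (π x)) y'
        = sig G b (fun x => D (π x)) w := by
  have hne : Nonempty X := by
    by_contra h
    rw [not_nonempty_iff] at h
    have := measure_univ (μ := μ)
    rw [Set.univ_eq_empty_iff.2 h] at this
    simp at this
  obtain ⟨T, hT⟩ := hb.bdd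
  obtain ⟨M', c, -, -, hM'⟩ := exists_bounds F hF hFp
  obtain ⟨M, hM⟩ : ∃ M : ℤ, ∀ f ∈ F, ∀ x, |f x| ≤ M := by
    obtain ⟨M, hM⟩ := exists_int_gt M'
    exact ⟨M, fun f hf x => by exact_mod_cast ((hM' f hf).2 x).trans hM.le⟩
  have key : ∀ (W : Finset X) (L : ℤ), ∃ a : X → X, PW G a ∧
      (∀ f ∈ F, ∀ x, L < sig G (a ∘ b) f (a (b x))) ∧
      μ.real (cut K (a ∘ b)) < ε ∧ ∃ Z : Finset X, ∀ x0 ∈ W, ∃ y ∈ Z, ∃ y' ∈ Z, ∀ D : ℕ → ℤ,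
        sig G (a ∘ b) (fun x => D (π x)) y - sig G (a ∘ b) (fun x => D (π x)) y'
        = sig G b (fun x => D (π x)) (b x0) := by
    intro W
    induction W using Finset.induction_on with
    | empty =>
      intro L
      obtain ⟨a, h1, h2, h3⟩ := stepA hS hb F hF hFp L hε K
      exact ⟨a, h1, h2, h3, ∅, by simp⟩
    | insert x0 W _ ih =>
      intro L
      obtain ⟨a, h1, h2, h3, Z, hZ⟩ := ih (L + 2 * T.card * M)
      obtain ⟨a', h1', h2', h3', h4, y, y', h5⟩ := perturb hS hb hπ hT hM L K h1 h2 h3 Z x0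
      refine ⟨a', h1', h2', h3', insert y (insert y' Z), ?_⟩
      intro u hu
      rcases Finset.mem_insert.1 hu with rfl | hu
      · exact ⟨y, by simp, y', by simp, h5⟩
      · obtain ⟨p, hp, q, hq, h⟩ := hZ u hu
        refine ⟨p, by simp [hp], q, by simp [hq], fun D => ?_⟩
        rw [← h D]
        simp only [sig, h4 p hp, h4 q hq]
  obtain ⟨W, hW⟩ : ∃ W : Finset X, ∀ x, ∃ u ∈ W, ltype G b π (b u) = ltype G b π (b x) := by
    have hfin := (hb.lc_comp (lc_ltype hb hπ)).range_finite
    choose! u hu using fun (t : Multiset ℕ)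
      (ht : t ∈ Set.range fun x => ltype G b π (b x)) => ht
    refine ⟨hfin.toFinset.image u, fun x => ⟨u (ltype G b π (b x)), ?_, ?_⟩⟩
    · exact Finset.mem_image_of_mem _ (by simp)
    · exact hu _ ⟨x, rfl⟩
  obtain ⟨a, h1, h2, h3, Z, hZ⟩ := key W 0
  refine ⟨a, h1, h2, h3, fun w => ?_⟩
  by_cases hw : ∃ x, b x = w
  · obtain ⟨x, rfl⟩ := hw
    obtain ⟨u, hu, hut⟩ := hW x
    obtain ⟨y, -, y', -, h⟩ := hZ u hu
    exact ⟨y, y', fun D => by rw [h, sig_of_ltype hut]⟩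
  · refine ⟨w, w, fun D => ?_⟩
    have : fib G b w = ∅ := by
      ext x
      rw [mem_fib hb]
      simp only [Finset.notMem_empty, iff_false]
      exact fun h => hw ⟨x, h⟩
    rw [sub_self, sig, this, Finset.sum_empty]

end Rich

end

section

/-- Labels that are injective on fibres and determine the labelled shape of the fibre. -/
structure Lab {X : Type*} [TopologicalSpace X] (b : X → X) (π : X → ℕ) : Prop where
  lc : IsLocallyConstant π
  inj : ∀ x y, b x = b y → π x = π y → x = y
  shape : ∀ x y, π x = π y → ∀ x1, b x1 = b x → ∃ y1, b y1 = b y ∧ π y1 = π x1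

/-- One level of the approximation of the orbit relation. -/
structure Lev {G X : Type*} [CommGroup G] [TopologicalSpace X] [MulAction G X]
    (K : Finset G) (b : X → X) (π : X → ℕ) (C : Set X) : Prop where
  pw : PW G b
  lab : Lab b π
  clo : IsClopen C
  piC : ∀ x y, π x = π y → (x ∈ C ↔ y ∈ C)
  cutC : cut K b ⊆ C

/-- The relation between consecutive levels. -/
structure Nxt (G : Type*) {X : Type*} [CommGroup G] [TopologicalSpace X] [MulAction G X]
    [MeasurableSpace X] (μ : Measure X) (b : X → X) (π : X → ℕ) (C : Set X)
    (b' : X → X) (π' : X → ℕ) (C' : Set X) : Prop where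
  step : ∃ a, PW G a ∧ b' = a ∘ b
  ref : ∀ x y, π' x = π' y → π x = π y
  dec : C' ⊆ C
  sat : ∀ x ∈ C', ∀ y ∈ C, b x = b y → y ∈ C'
  rich : ∀ w, ∃ y y', ∀ D : ℕ → ℤ, sig G b' (fun x => D (π x)) y - sig G b' (fun x => D (π x)) y'
    = sig G b (fun x => D (π x)) w
  iota : ∃ i : X → ℤ, IsLocallyConstant i ∧ (∀ x y, π' x = π' y → i x = i y) ∧
    ing μ i = 0 ∧ ∃ z z', sig G b' i z = 1 ∧
    sig G b' i z' = 0 ∧ ∀ D : ℕ → ℤ, sig G b' (fun x => D (π x)) z = sig G b' (fun x => D (π x)) z'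

/-- The full tower of approximations. -/
structure Tower {G X : Type*} [CommGroup G] [TopologicalSpace X] [MulAction G X]
    [MeasurableSpace X] (μ : Measure X) (K : Finset G) (b : ℕ → X → X) (π : ℕ → X → ℕ)
    (C : ℕ → Set X) : Prop where
  lev : ∀ n, Lev K (b n) (π n) (C n)
  nxt : ∀ n, Nxt G μ (b n) (π n) (C n) (b (n + 1)) (π (n + 1)) (C (n + 1))
  zero : b 0 = id
  cof : ∀ f : X → ℕ, IsLocallyConstant f → ∃ n, ∀ x y, π n x = π n y → f x = f y
  meas : ∀ ε : ℝ, 0 < ε → ∃ n, μ.real (C n) < ε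
  pos : ∀ f : X → ℤ, IsLocallyConstant f → 0 < ing μ f →
    ∃ n, ∀ m, n ≤ m → ∀ x, 0 < sig G (b m) f (b m x)

section Tower

variable {G X : Type*} [CommGroup G] [TopologicalSpace X] [MulAction G X]
  [CompactSpace X] [FreeAct G X] [ContinuousConstSMul G X]

theorem exists_lab {b : X → X} (hb : PW G b) {q : X → ℕ} (hq : IsLocallyConstant q) :
    ∃ π : X → ℕ, Lab b π ∧ ∀ x y, π x = π y → q x = q y := by
  obtain ⟨θ, hθ, hbθ⟩ := id hb
  set S : X → Finset (G × ℕ) := fun z => (Phi G b z).image fun g => (g, q (g • z)) with hS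
  have lS : IsLocallyConstant S := by
    apply lc_of_ev
    intro z
    filter_upwards [lc_ev (lc_Phi hb) z, lc_finite_forall (Phi G b z) (f := fun g z => q (g • z))
      (fun g _ => lc_smul hq g) z] with y h1 h2
    simp only [hS, h1]
    exact Finset.image_congr fun g hg => by simp only [h2 g hg]
  have hmem : ∀ x z, b x = z → ((θ x)⁻¹, q x) ∈ S z := by
    rintro x _ rfl
    have e : (θ x)⁻¹ • b x = x := by rw [hbθ, inv_smul_smul]
    exact Finset.mem_image.2 ⟨(θ x)⁻¹, by rw [mem_Phi hb, e], by rw [e]⟩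
  have hS2 : ∀ g n z, (g, n) ∈ S z → b (g • z) = z ∧ q (g • z) = n ∧ θ (g • z) = g⁻¹ := by
    intro g n z h
    obtain ⟨g', h1, h2⟩ := Finset.mem_image.1 h
    rw [Prod.mk.injEq] at h2
    obtain ⟨rfl, h2⟩ := h2
    rw [mem_Phi hb] at h1
    refine ⟨h1, h2, ?_⟩
    have h3 := h1
    rw [hbθ, smul_smul] at h3
    exact eq_inv_of_mul_eq_one_left (FreeAct.eq_one _ _ h3)
  obtain ⟨π, hπ, hπe⟩ := lc_recode (lc_comp2 (fun a b => (a, b)) hθ (hb.lc_comp lS))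
  simp only [Prod.mk.injEq] at hπe
  refine ⟨π, ⟨hπ, ?_, ?_⟩, ?_⟩
  · intro x y hxy h
    have := ((hπe x y).1 h).1
    rw [hbθ, hbθ, this] at hxy
    exact MulAction.injective _ hxy
  · intro x y h x1 hx1
    have hSS := ((hπe x y).1 h).2
    have h1 := hmem x1 _ hx1
    rw [hSS] at h1
    obtain ⟨h2, h3, h4⟩ := hS2 _ _ _ h1
    refine ⟨(θ x1)⁻¹ • b y, h2, (hπe _ _).2 ⟨by rw [h4, inv_inv], ?_⟩⟩
    rw [h2, hx1, hSS]
  · intro x y h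
    obtain ⟨h1, h2⟩ := (hπe x y).1 h
    have h3 := hmem x _ rfl
    rw [h2, h1] at h3
    have := (hS2 _ _ _ h3).2.1
    rw [← this, hbθ, inv_smul_smul]

variable [T2Space X] [TotallyDisconnectedSpace X]
variable [MeasurableSpace X] [BorelSpace X] {μ : Measure X}
  [IsProbabilityMeasure μ] [SMulInvariantMeasure G X μ] [TopologicalSpace.MetrizableSpace X]

theorem nonempty_of (μ : Measure X) [IsProbabilityMeasure μ] : Nonempty X := by
  by_contra h
  rw [not_nonempty_iff] at h
  have := measure_univ (μ := μ)
  rw [Set.univ_eq_empty_iff.2 h] at this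
  simp at this

theorem exists_iota (hS : Sys G μ) {b : X → X} (hb : PW G b) {π : X → ℕ}
    (hπ : IsLocallyConstant π) :
    ∃ i : X → ℤ, IsLocallyConstant i ∧ ing μ i = 0 ∧ ∃ z z', sig G b i z = 1 ∧
    sig G b i z' = 0 ∧ ∀ D : ℕ → ℤ, sig G b (fun x => D (π x)) z = sig G b (fun x => D (π x)) z' := by
  obtain ⟨x⟩ := nonempty_of μ
  set z := b x with hz
  obtain ⟨g, hg⟩ := exists_smul_notMem hS x (fib G b z)
  rw [mem_fib hb] at hg
  obtain ⟨y, hyt, hyZ⟩ := exists_near hS x (lc_ev (hb.lc_comp (lc_ltype hb hπ)) x)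
    (fib G b z ∪ fib G b (b (g • x)))
  rw [Finset.mem_union, not_or, mem_fib hb, mem_fib hb] at hyZ
  set z' := b y with hz'
  set E : Finset X := fib G b z ∪ fib G b z' with hE
  obtain ⟨O, cO, hxO, hO⟩ := exists_clopen_ev ((ev_notMem E x).and
    (ev_notMem (E.image fun u => g⁻¹ • u) x))
  have key : ∀ u ∈ E, ind {u | g⁻¹ • u ∈ O} u = 0 := by
    intro u hu
    simp only [ind, Set.mem_ofPred_eq, ite_eq_right_iff, one_ne_zero, imp_false]
    intro h
    have := (hO _ h).2 (Finset.mem_image_of_mem _ hu)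
    rw [inv_smul_eq_iff] at this
    subst this
    rw [hE, Finset.mem_union, mem_fib hb, mem_fib hb] at hu
    rcases hu with h | h
    · exact hg h
    · exact hyZ.2 h.symm
  have key1 : ∀ u ∈ E, ind O u = if u = x then 1 else 0 := by
    intro u hu
    by_cases h : u = x
    · simp [ind, h, hxO]
    · have : u ∉ O := fun h' => h ((hO _ h').1 hu)
      simp [ind, h, this]
  have cgO := clopen_smul_pre cO g⁻¹
  refine ⟨ind O - ind {u | g⁻¹ • u ∈ O}, ?_, ?_, z, z', ?_, ?_, ?_⟩
  · exact lc_comp2 (fun a b => a - b) (lc_ind cO) (lc_ind cgO)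
  · rw [ing_sub (lc_ind cO) (lc_ind cgO), ing_ind cO, ing_ind cgO,
      real_smul_pre cO.isOpen.measurableSet, sub_self]
  · rw [sig, Finset.sum_congr rfl (g := fun u => if u = x then 1 else 0)]
    · simp [mem_fib hb, hz]
    · intro u hu
      rw [Pi.sub_apply, key u (Finset.mem_union_left _ hu), key1 u (Finset.mem_union_left _ hu),
        sub_zero]
  · rw [sig]
    refine Finset.sum_eq_zero fun u hu => ?_
    rw [Pi.sub_apply, key u (Finset.mem_union_right _ hu), key1 u (Finset.mem_union_right _ hu),
        sub_zero, if_neg]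
    rintro rfl
    rw [mem_fib hb] at hu
    exact hyZ.1 hu.symm
  · intro D
    exact (sig_of_ltype hyt D).symm

theorem finite_test (π : X → ℕ) (hπ : IsLocallyConstant π) (n : ℕ) :
    {f : X → ℤ | ∃ D : ℕ → ℤ, f = (fun x => D (π x)) ∧ ∀ x, |f x| ≤ n}.Finite := by
  have := hπ.range_finite.to_subtype
  have hfin : (Set.range fun (r : Set.range π → Set.Icc (-(n : ℤ)) n) (x : X) =>
    ((r ⟨π x, x, rfl⟩ : Set.Icc (-(n : ℤ)) n) : ℤ)).Finite := Set.finite_range _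
  refine hfin.subset ?_
  rintro f ⟨D, rfl, h⟩
  refine ⟨fun k => ⟨D k, ?_⟩, rfl⟩
  obtain ⟨_, x, rfl⟩ := k
  exact abs_le.1 (h x)

theorem level_step [Group.FG G] (hS : Sys G μ) {K : Finset G} {b : X → X} {π : X → ℕ} {C : Set X}
    (h : Lev K b π C) (n : ℕ) {ε : ℝ} (hε : 0 < ε) {q : X → ℕ} (hq : IsLocallyConstant q) :
    ∃ b' π' C', Lev K b' π' C' ∧ Nxt G μ b π C b' π' C' ∧ μ.real C' < ε ∧
      (∀ x y, π' x = π' y → q x = q y) ∧ ∀ D : ℕ → ℤ, (∀ x, |D (π x)| ≤ n) →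
        0 < ing μ (fun x => D (π x)) → ∀ x, 0 < sig G b' (fun x => D (π x)) (b' x) := by
  have hfin := finite_test π h.lab.lc n
  obtain ⟨T, hT⟩ := h.pw.bdd
  have hTp : (0 : ℝ) < (T.card : ℝ) * T.card + 1 := by positivity
  obtain ⟨a, pa, hpos, hcut, hrich⟩ := exists_rich hS h.pw h.lab.lc
    (hfin.toFinset.filter fun f => 0 < ing μ f) (by
      intro f hf
      simp only [Finset.mem_filter, Set.Finite.mem_toFinset] at hf
      obtain ⟨⟨D, rfl, -⟩, -⟩ := hf
      exact h.lab.lc.comp D) (by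
      intro f hf
      exact (Finset.mem_filter.1 hf).2) (ε := ε / (T.card * T.card + 1)) (by positivity) K
  set b' := a ∘ b with hb'
  have pb' : PW G b' := pa.comp h.pw
  set C' := C ∩ b ⁻¹' (b '' (C ∩ cut K b')) with hC'
  have ccut := clopen_cut pb' K
  have cC' : IsClopen C' :=
    h.clo.inter ((h.pw.clopen_image (h.clo.inter ccut)).preimage h.pw.continuous)
  obtain ⟨i, li, hi0, hi⟩ := exists_iota hS pb' h.lab.lc
  obtain ⟨r, hr, hre⟩ := lc_recode (lc_comp2 (fun a b => (a, b)) (lc_comp2 (fun a b => (a, b)) (lc_comp2 (fun a b => (a, b)) hq li)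
    h.lab.lc) (lc_mem cC'))
  simp only [Prod.mk.injEq] at hre
  obtain ⟨π', hl, hπ'⟩ := exists_lab pb' hr
  have hcutsub : cut K b' ⊆ C := by
    refine Set.Subset.trans ?_ h.cutC
    rintro x ⟨k, hk, hx⟩
    exact ⟨k, hk, fun h => hx (congrArg a h)⟩
  refine ⟨b', π', C', ⟨pb', hl, cC', ?_, ?_⟩, ⟨⟨a, pa, rfl⟩, ?_, ?_, ?_, hrich, i, li,
    fun x y hxy => ((hre x y).1 (hπ' x y hxy)).1.1.2, hi0, hi⟩,
    ?_, ?_, ?_⟩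
  · intro x y hxy
    have := ((hre x y).1 (hπ' x y hxy)).2
    exact eq_iff_iff.1 this
  · exact fun x hx => ⟨hcutsub hx, x, ⟨hcutsub hx, hx⟩, rfl⟩
  · exact fun x y hxy => ((hre x y).1 (hπ' x y hxy)).1.2
  · exact Set.inter_subset_left
  · rintro x ⟨-, hx⟩ y hy hxy
    refine ⟨hy, ?_⟩
    rw [Set.mem_preimage, ← hxy]; exact hx
  · have h1 : μ.real C' ≤ T.card * (T.card * μ.real (cut K b')) := by
      refine (rmono Set.inter_subset_right).trans ((real_pre_le hT
        (h.pw.clopen_image (h.clo.inter ccut)).isOpen.measurableSet).trans ?_)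
      gcongr
      refine (real_image_le (fun x _ => hT x) (h.clo.inter ccut).isOpen.measurableSet).trans ?_
      gcongr ?_ * ?_
      exact rmono (μ := μ) Set.inter_subset_right
    rw [lt_div_iff₀ hTp] at hcut
    have := measureReal_nonneg (μ := μ) (s := cut K b')
    nlinarith
  · exact fun x y hxy => ((hre x y).1 (hπ' x y hxy)).1.1.1
  · intro D hD hDp x
    refine hpos _ ?_ x
    simp only [Finset.mem_filter, Set.Finite.mem_toFinset]
    exact ⟨⟨D, rfl, hD⟩, hDp⟩

theorem exists_clopen_enum : ∃ A : ℕ → Set X, (∀ n, IsClopen (A n)) ∧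
    ∀ B : Set X, IsClopen B → ∃ n, A n = B := by
  have : Countable (TopologicalSpace.Clopens X) :=
    TopologicalSpace.Clopens.countable_iff_secondCountable.2 inferInstance
  obtain ⟨e, he⟩ := exists_surjective_nat (TopologicalSpace.Clopens X)
  refine ⟨fun n => e n, fun n => (e n).isClopen, fun B hB => ?_⟩
  obtain ⟨n, hn⟩ := he ⟨B, hB⟩
  exact ⟨n, by simp only [hn]; rfl⟩

theorem exists_tower [Group.FG G] (hS : Sys G μ) (K : Finset G) :
    ∃ b π C, Tower (G := G) (X := X) μ K b π C := by
  obtain ⟨A, cA, hA⟩ := exists_clopen_enum (X := X)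
  let P : ((X → X) × (X → ℕ) × Set X) → Prop := fun s => Lev K s.1 s.2.1 s.2.2
  have key : ∀ (n : ℕ) (s : {s // P s}), ∃ t : {s // P s},
      Nxt G μ s.1.1 s.1.2.1 s.1.2.2 t.1.1 t.1.2.1 t.1.2.2 ∧ μ.real t.1.2.2 < 1 / (n + 1) ∧
      (∀ x y, t.1.2.1 x = t.1.2.1 y → (x ∈ A n ↔ y ∈ A n)) ∧
      ∀ D : ℕ → ℤ, (∀ x, |D (s.1.2.1 x)| ≤ n) →
        0 < ing μ (fun x => D (s.1.2.1 x)) → ∀ x, 0 < sig G t.1.1 (fun x => D (s.1.2.1 x)) (t.1.1 x) := by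
    rintro n ⟨⟨b, π, C⟩, h⟩
    obtain ⟨q, hq, hqe⟩ := lc_recode (lc_mem (cA n))
    obtain ⟨b', π', C', h1, h2, h3, h4, h5⟩ := level_step hS h n
      (ε := 1 / ((n : ℝ) + 1)) (by positivity) hq
    exact ⟨⟨⟨b', π', C'⟩, h1⟩, h2, h3, fun x y hxy => eq_iff_iff.1 ((hqe x y).1 (h4 x y hxy)), h5⟩
  choose nx hnx hm hq hp using key
  obtain ⟨π0, hl0, -⟩ := exists_lab (G := G) (b := (id : X → X)) PW.id (IsLocallyConstant.const 0)
  let s0 : {s // P s} := ⟨⟨id, π0, Set.univ⟩, PW.id, hl0, isClopen_univ, by simp,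
    Set.subset_univ _⟩
  let s : ℕ → {s // P s} := fun n => Nat.rec s0 nx n
  have href : ∀ n m, n ≤ m → ∀ x y, (s m).1.2.1 x = (s m).1.2.1 y → (s n).1.2.1 x = (s n).1.2.1 y := by
    intro n m hnm
    induction m, hnm using Nat.le_induction with
    | base => exact fun x y h => h
    | succ m _ ih => exact fun x y h => ih x y ((hnx m (s m)).ref x y h)
  have hcof : ∀ f : X → ℕ, IsLocallyConstant f →
      ∃ n, ∀ x y, (s n).1.2.1 x = (s n).1.2.1 y → f x = f y := by
    intro f hf
    choose k hk using fun v => hA (f ⁻¹' {v}) (hf.isClopen_fiber v)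
    refine ⟨(hf.range_finite.toFinset.sup k) + 1, fun x y hxy => ?_⟩
    have h1 : k (f x) + 1 ≤ (hf.range_finite.toFinset.sup k) + 1 :=
      Nat.succ_le_succ (Finset.le_sup (f := k) (by simp))
    have := hq _ _ x y (href _ _ h1 x y hxy)
    rw [hk] at this
    exact (this.1 rfl).symm
  refine ⟨fun n => (s n).1.1, fun n => (s n).1.2.1, fun n => (s n).1.2.2,
    fun n => (s n).2, fun n => hnx n (s n), rfl, hcof, ?_, ?_⟩
  · intro ε hε
    obtain ⟨n, hn⟩ := exists_nat_one_div_lt hε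
    exact ⟨n + 1, (hm n (s n)).trans hn⟩
  · intro f hf hfp
    obtain ⟨q, hqq, hqe⟩ := lc_recode hf
    obtain ⟨n0, hn0⟩ := hcof q hqq
    obtain ⟨M, hM⟩ := (hf.comp (fun n : ℤ => n.natAbs)).range_finite.bddAbove
    refine ⟨max n0 M + 1, fun m hm' x => ?_⟩
    obtain ⟨m, rfl⟩ : ∃ k, m = k + 1 := ⟨m - 1, by omega⟩
    have h1 : ∀ x y, (s m).1.2.1 x = (s m).1.2.1 y → f x = f y := fun x y h =>
      (hqe x y).1 (hn0 x y (href _ _ (by omega) x y h))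
    obtain ⟨D, hD⟩ : ∃ D : ℕ → ℤ, f = fun x => D ((s m).1.2.1 x) := by
      refine ⟨fun k => if h : ∃ x, (s m).1.2.1 x = k then f h.choose else 0, ?_⟩
      ext x
      have hx : ∃ x', (s m).1.2.1 x' = (s m).1.2.1 x := ⟨x, rfl⟩
      simp only [dif_pos hx]
      exact (h1 _ _ hx.choose_spec).symm
    rw [hD]
    apply hp m (s m) D
    · intro x
      have : (f x).natAbs ≤ M := hM ⟨x, rfl⟩
      have e : D ((s m).1.2.1 x) = f x := by rw [hD]
      rw [e, Int.abs_eq_natAbs]; have := this.trans (le_max_right n0 M); omega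
    · rw [← hD]; exact hfp

end Tower

end

section

/-- Evaluation of the fibre sum at a point. -/
noncomputable def sgH (G : Type*) {X : Type*} [Group G] [MulAction G X] (b : X → X) (z : X) :
    (X → ℤ) →+ ℤ where
  toFun f := sig G b f z
  map_zero' := by simp [sig]
  map_add' f g := by simp [sig, Finset.sum_add_distrib]

/-- Functionals generated by the fibre sums. -/
noncomputable def Fn (G : Type*) {X : Type*} [Group G] [MulAction G X] (b : X → X) :
    AddSubgroup ((X → ℤ) →+ ℤ) := AddSubgroup.closure (Set.range (sgH G b))

/-- `f` is determined by the labels `π`. -/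
def Ref {X α : Type*} (π : X → ℕ) (f : X → α) : Prop := ∀ x y, π x = π y → f x = f y

/-- The level set `{x ∈ B | v x = k}`. -/
def lv {X : Type*} (B : Set X) (v : X → ℕ) (k : ℕ) : Set X := {x | x ∈ B ∧ v x = k}

/-- The functionals separate the level sets. -/
def Spl {X : Type*} (N : AddSubgroup ((X → ℤ) →+ ℤ)) (B : Set X) (v : X → ℕ) : Prop :=
  ∀ k ∈ v '' B, ∃ l ∈ N, ∀ j, l (ind (lv B v j)) = if j = k then 1 else 0

section Alg

theorem sum_delta {I : Finset ℕ} {i : ℕ} (hi : i ∈ I) {A : Type*} [AddCommGroup A] (f : ℕ → A) :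
    ∑ j ∈ I, (if i = j then (1 : ℤ) else 0) • f j = f i := by
  simp [ite_smul, hi]

/-- The corrected family used in the step lemma. -/
def cfam {A : Type*} [AddCommGroup A] (I V : Finset ℕ) (k l : ℕ → ℕ → ℤ) (c0 e io : ℕ → A) (i : ℕ) : A :=
  c0 i + ∑ v ∈ V, l i v • e v + io i - ∑ v ∈ V, l i v • ∑ j ∈ I, k v j • io j

variable {A : Type*} [AddCommGroup A] {I V : Finset ℕ} {k l : ℕ → ℕ → ℤ}

theorem sum_kl (hkl : ∀ u ∈ V, ∀ w ∈ V, ∑ i ∈ I, k u i * l i w = if u = w then 1 else 0)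
    {u : ℕ} (hu : u ∈ V) (f : ℕ → A) :
    ∑ i ∈ I, k u i • ∑ v ∈ V, l i v • f v = f u := by
  simp only [Finset.smul_sum, smul_smul]
  rw [Finset.sum_comm]
  simp only [← Finset.sum_smul]
  rw [← sum_delta hu f]
  exact Finset.sum_congr rfl fun v hv => by rw [hkl u hu v hv]

theorem cfam_sum (hkl : ∀ u ∈ V, ∀ w ∈ V, ∑ i ∈ I, k u i * l i w = if u = w then 1 else 0)
    (c0 e io : ℕ → A) {u : ℕ} (hu : u ∈ V) :
    ∑ i ∈ I, k u i • cfam I V k l c0 e io i = ∑ i ∈ I, k u i • c0 i + e u := by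
  simp only [cfam, smul_sub, smul_add, Finset.sum_sub_distrib, Finset.sum_add_distrib]
  rw [sum_kl hkl hu e, sum_kl hkl hu (fun v => ∑ j ∈ I, k v j • io j)]
  abel

theorem cfam_split {N : AddSubgroup (A →+ ℤ)}
    (hkl : ∀ u ∈ V, ∀ w ∈ V, ∑ i ∈ I, k u i * l i w = if u = w then 1 else 0)
    (c0 e io : ℕ → A)
    (hV : ∀ v ∈ V, ∃ f ∈ N, ∀ u ∈ V, f (∑ i ∈ I, k u i • c0 i + e u) = if u = v then 1 else 0)
    (hI : ∀ i ∈ I, ∃ f ∈ N, (∀ j ∈ I, f (io j) = if i = j then 1 else 0) ∧ (∀ j ∈ I, f (c0 j) = 0) ∧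
      ∀ v ∈ V, f (e v) = 0) :
    ∀ w ∈ I, ∃ f ∈ N, ∀ j ∈ I, f (cfam I V k l c0 e io j) = if j = w then 1 else 0 := by
  intro w hw
  choose! P hPN hP using hV
  choose! Q hQN hQ1 hQ2 hQ3 using hI
  set f0 : A →+ ℤ := ∑ v ∈ V, k v w • P v with hf0
  have hf0N : f0 ∈ N := sum_mem fun v hv => zsmul_mem (hPN v hv) _
  set a : ℕ → ℤ := fun j => f0 (cfam I V k l c0 e io j) with ha
  set z : ℕ → ℤ := fun j => (if j = w then 1 else 0) - a j with hz
  have hka : ∀ u ∈ V, ∑ j ∈ I, k u j * a j = k u w := by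
    intro u hu
    have := congrArg f0 (cfam_sum hkl c0 e io hu)
    simp only [map_sum, map_zsmul, smul_eq_mul] at this
    rw [this, hf0, AddMonoidHom.finsetSum_apply]
    have h2 : ∀ v ∈ V, (k v w • P v) (∑ i ∈ I, k u i • c0 i + e u) = if u = v then k v w else 0 := by
      intro v hv
      rw [AddMonoidHom.smul_apply, hP v hv u hu]; simp
    rw [Finset.sum_congr rfl h2]
    simp [hu]
  have hkz : ∀ u ∈ V, ∑ j ∈ I, k u j * z j = 0 := by
    intro u hu
    simp only [hz, mul_sub, Finset.sum_sub_distrib, hka u hu]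
    simp [hw]
  refine ⟨f0 + ∑ i ∈ I, z i • Q i, add_mem hf0N (sum_mem fun i hi => zsmul_mem (hQN i hi) _), ?_⟩
  intro j hj
  have h0 : f0 (cfam I V k l c0 e io j) = a j := rfl
  rw [AddMonoidHom.add_apply, h0, AddMonoidHom.finsetSum_apply]
  have h3 : ∀ i ∈ I, (z i • Q i) (cfam I V k l c0 e io j) =
      (if i = j then z i else 0) - ∑ v ∈ V, l j v * (k v i * z i) := by
    intro i hi
    have h4 : ∀ v ∈ V, (l j v) • ∑ x ∈ I, k v x • (Q i) (io x) = l j v * k v i := by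
      intro v _
      rw [Finset.sum_congr rfl fun x hx => by rw [hQ1 i hi x hx]]
      simp [hi]
    have h5 : ∑ v ∈ V, l j v • (Q i) (e v) = 0 :=
      Finset.sum_eq_zero fun v hv => by rw [hQ3 i hi v hv, smul_zero]
    rw [AddMonoidHom.smul_apply, cfam, map_sub, map_add, map_add, map_sum, map_sum]
    simp only [map_zsmul, map_sum]
    rw [h5, Finset.sum_congr rfl h4, hQ2 i hi j hj, hQ1 i hi j hj, smul_eq_mul, mul_sub,
      Finset.mul_sum]
    congr 1
    · split_ifs <;> simp
    · exact Finset.sum_congr rfl fun v _ => by ring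
  rw [Finset.sum_congr rfl h3, Finset.sum_sub_distrib, Finset.sum_comm]
  simp only [← Finset.mul_sum]
  rw [Finset.sum_eq_zero (s := V) (fun v hv => by rw [hkz v hv, mul_zero])]
  simp [hj, hz, ha]

end Alg

section Tower

variable {G X : Type*} [CommGroup G] [TopologicalSpace X] [MulAction G X]
  [CompactSpace X] [FreeAct G X] [ContinuousConstSMul G X]

theorem Ref.factor {X : Type*} {π : X → ℕ} {f : X → ℤ} (h : Ref π f) :
    ∃ D : ℕ → ℤ, f = fun x => D (π x) := by
  refine ⟨fun k => if h : ∃ x, π x = k then f h.choose else 0, ?_⟩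
  ext x
  have hx : ∃ x', π x' = π x := ⟨x, rfl⟩
  simp only [dif_pos hx]
  exact (h _ _ hx.choose_spec).symm

theorem sgH_mem (b : X → X) (z : X) : sgH G b z ∈ Fn G b :=
  AddSubgroup.subset_closure ⟨z, rfl⟩

theorem Fn_induction {N : AddSubgroup ((X → ℤ) →+ ℤ)} {b : X → X} {p : (X → ℤ) → (X → ℤ) → Prop}
    (h : ∀ z, ∃ l ∈ N, ∀ f g, p f g → l g = sig G b f z) {l : (X → ℤ) →+ ℤ} (hl : l ∈ Fn G b) :
    ∃ l' ∈ N, ∀ f g, p f g → l' g = l f := by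
  induction hl using AddSubgroup.closure_induction with
  | mem x hx =>
    obtain ⟨z, rfl⟩ := hx
    exact h z
  | zero => exact ⟨0, zero_mem _, by simp⟩
  | add x y _ _ h1 h2 =>
    obtain ⟨a, ha, h1⟩ := h1
    obtain ⟨b, hb, h2⟩ := h2
    exact ⟨a + b, add_mem ha hb, fun f g hfg => by
      rw [AddMonoidHom.add_apply, AddMonoidHom.add_apply, h1 f g hfg, h2 f g hfg]⟩
  | neg x _ h1 =>
    obtain ⟨a, ha, h1⟩ := h1
    exact ⟨-a, neg_mem ha, fun f g hfg => by
      rw [AddMonoidHom.neg_apply, AddMonoidHom.neg_apply, h1 f g hfg]⟩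

theorem Fn_congr {b : X → X} {f g : X → ℤ} (h : ∀ z, sig G b f z = sig G b g z)
    {l : (X → ℤ) →+ ℤ} (hl : l ∈ Fn G b) : l f = l g := by
  induction hl using AddSubgroup.closure_induction with
  | mem x hx =>
    obtain ⟨z, rfl⟩ := hx
    exact h z
  | zero => rfl
  | add x y _ _ h1 h2 => rw [AddMonoidHom.add_apply, AddMonoidHom.add_apply, h1, h2]
  | neg x _ h1 => rw [AddMonoidHom.neg_apply, AddMonoidHom.neg_apply, h1]

variable [MeasurableSpace X] {μ : Measure X}
variable {K : Finset G} {b : ℕ → X → X} {π : ℕ → X → ℕ} {C : ℕ → Set X}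

namespace Tower

theorem ref (hT : Tower μ K b π C) {n m : ℕ} (h : n ≤ m) : Ref (π m) (π n) := by
  induction m, h using Nat.le_induction with
  | base => exact fun x y h => h
  | succ m _ ih => exact fun x y h => ih x y ((hT.nxt m).ref x y h)

theorem ref_mono (hT : Tower μ K b π C) {n m : ℕ} (h : n ≤ m) {α : Type*} {f : X → α}
    (hf : Ref (π n) f) : Ref (π m) f := fun x y hxy => hf x y (hT.ref h x y hxy)

theorem step (hT : Tower μ K b π C) {n m : ℕ} (h : n ≤ m) : ∃ a, PW G a ∧ b m = a ∘ b n := by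
  induction m, h using Nat.le_induction with
  | base => exact ⟨id, PW.id, rfl⟩
  | succ m _ ih =>
    obtain ⟨a, ha, e⟩ := ih
    obtain ⟨a', ha', e'⟩ := (hT.nxt m).step
    exact ⟨a' ∘ a, ha'.comp ha, by rw [e', e, Function.comp_assoc]⟩

theorem ker_mono (hT : Tower μ K b π C) {n m : ℕ} (h : n ≤ m) {x y : X} (hxy : b n x = b n y) :
    b m x = b m y := by
  obtain ⟨a, -, e⟩ := hT.step h
  rw [e]; exact congrArg a hxy

theorem C_anti (hT : Tower μ K b π C) {n m : ℕ} (h : n ≤ m) : C m ⊆ C n := by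
  induction m, h using Nat.le_induction with
  | base => exact subset_rfl
  | succ m _ ih => exact (hT.nxt m).dec.trans ih

theorem lift (hT : Tower μ K b π C) {n m : ℕ} (h : n ≤ m) {l : (X → ℤ) →+ ℤ}
    (hl : l ∈ Fn G (b n)) : ∃ l' ∈ Fn G (b m), ∀ f, Ref (π n) f → l' f = l f := by
  induction m, h using Nat.le_induction with
  | base => exact ⟨l, hl, fun _ _ => rfl⟩
  | succ m hm ih =>
    obtain ⟨l1, h1, h2⟩ := ih
    obtain ⟨l2, h3, h4⟩ := Fn_induction (N := Fn G (b (m + 1)))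
      (p := fun f g => f = g ∧ Ref (π m) f) (by
        intro z
        obtain ⟨y, y', hy⟩ := (hT.nxt m).rich z
        refine ⟨sgH G (b (m + 1)) y - sgH G (b (m + 1)) y', sub_mem (sgH_mem _ _) (sgH_mem _ _), ?_⟩
        rintro f _ ⟨rfl, hf⟩
        obtain ⟨D, rfl⟩ := hf.factor
        exact hy D) h1
    exact ⟨l2, h3, fun f hf => (h4 f f ⟨rfl, hT.ref_mono hm hf⟩).trans (h2 f hf)⟩

theorem fresh (hT : Tower μ K b π C) (M r : ℕ) : ∃ io : ℕ → X → ℤ,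
    (∀ i, IsLocallyConstant (io i) ∧ ing μ (io i) = 0) ∧
    ∀ m, M + r ≤ m → ∀ i < r, ∃ f ∈ Fn G (b m), (∀ j < r, f (io j) = if i = j then 1 else 0) ∧
      ∀ g, Ref (π M) g → f g = 0 := by
  choose io lio rio iio z z' hz hz' hzz using fun n => (hT.nxt n).iota
  refine ⟨fun i => io (M + i), fun i => ⟨lio _, iio _⟩, ?_⟩
  induction r with
  | zero => simp
  | succ r ih =>
    intro m hm
    obtain ⟨L, hL, hLe⟩ := hT.lift (n := M + r + 1) (m := m) (by omega)
      (l := sgH G (b (M + r + 1)) (z (M + r)) - sgH G (b (M + r + 1)) (z' (M + r)))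
      (sub_mem (sgH_mem _ _) (sgH_mem _ _))
    have hL1 : ∀ g, Ref (π (M + r)) g → L g = 0 := by
      intro g hg
      rw [hLe g (hT.ref_mono (by omega) hg)]
      obtain ⟨D, rfl⟩ := hg.factor
      exact sub_eq_zero.2 (hzz (M + r) D)
    have hL2 : L (io (M + r)) = 1 := by
      rw [hLe _ (rio (M + r))]
      show sig G _ _ _ - sig G _ _ _ = 1
      rw [hz, hz', sub_zero]
    have hL3 : ∀ j < r, L (io (M + j)) = 0 := fun j hj => by
      apply hL1
      exact hT.ref_mono (n := M + j + 1) (by omega) (rio (M + j))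
    intro i hi
    rcases Nat.lt_succ_iff_lt_or_eq.1 hi with hi | rfl
    · obtain ⟨f, hf, h1, h2⟩ := ih m (by omega) i hi
      refine ⟨f - f (io (M + r)) • L, sub_mem hf (zsmul_mem hL _), ?_, ?_⟩
      · intro j hj
        rw [AddMonoidHom.sub_apply, AddMonoidHom.smul_apply]
        rcases Nat.lt_succ_iff_lt_or_eq.1 hj with hj | rfl
        · rw [h1 j hj, hL3 j hj]; simp
        · rw [hL2, if_neg hi.ne]; simp
      · intro g hg
        rw [AddMonoidHom.sub_apply, AddMonoidHom.smul_apply, h2 g hg,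
          hL1 g (hT.ref_mono (by omega) hg)]; simp
    · refine ⟨L, hL, ?_, fun g hg => hL1 g (hT.ref_mono (by omega) hg)⟩
      intro j hj
      rcases Nat.lt_succ_iff_lt_or_eq.1 hj with hj | rfl
      · rw [hL3 j hj, if_neg hj.ne']
      · rw [hL2, if_pos rfl]

theorem spl_mono (hT : Tower μ K b π C) {n m : ℕ} (h : n ≤ m) {B : Set X} {v : X → ℕ}
    (hB : Ref (π n) (fun x => x ∈ B)) (hv : Ref (π n) v) (hs : Spl (Fn G (b n)) B v) :
    Spl (Fn G (b m)) B v := by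
  intro k hk
  obtain ⟨l, hl, h1⟩ := hs k hk
  obtain ⟨l', hl', h2⟩ := hT.lift h hl
  refine ⟨l', hl', fun j => (h2 _ ?_).trans (h1 j)⟩
  intro x y hxy
  have : (x ∈ lv B v j) = (y ∈ lv B v j) := by
    have h3 : (x ∈ B) = (y ∈ B) := hB x y hxy
    simp only [lv, Set.mem_ofPred_eq, hv x y hxy, h3]
  simp only [ind, this]

theorem Fn_sig (hT : Tower μ K b π C) {n m : ℕ} (h : n ≤ m) {f g : X → ℤ}
    (hfg : ∀ z, sig G (b n) f z = sig G (b n) g z) {l : (X → ℤ) →+ ℤ} (hl : l ∈ Fn G (b m)) :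
    l f = l g := by
  obtain ⟨a, ha, e⟩ := hT.step h
  refine Fn_congr (fun z => ?_) hl
  rw [e, sig_comp ha (hT.lev n).pw, sig_comp ha (hT.lev n).pw, funext hfg]

end Tower

end Tower

end

section

section Pick

variable {G X : Type*} [CommGroup G] [TopologicalSpace X] [MulAction G X]
  [CompactSpace X] [FreeAct G X] [ContinuousConstSMul G X]

theorem PW.exists_smul {b : X → X} (hb : PW G b) {x y : X} (h : b x = b y) : ∃ g : G, y = g • x := by
  obtain ⟨θ, -, hθ⟩ := hb
  refine ⟨(θ y)⁻¹ * θ x, ?_⟩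
  rw [mul_smul, ← hθ x, h, hθ y, inv_smul_smul]

variable [T2Space X] [TotallyDisconnectedSpace X]

theorem PW.of_pick {b : X → X} (hb : PW G b) {p : X → X} {Q : X → X → Prop}
    (h1 : ∀ x, b (p x) = b x) (h2 : ∀ x, Q x (p x)) (h3 : ∀ x y, b y = b x → Q x y → y = p x)
    (h4 : ∀ x (g : G), b (g • x) = b x → Q x (g • x) → ∀ᶠ y in 𝓝 x, Q y (g • y)) : PW G p := by
  apply PW.of_local
  intro x
  obtain ⟨g, hg⟩ := hb.exists_smul (h1 x).symm
  refine ⟨g, ?_⟩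
  have hq := h2 x
  have hb1 := h1 x
  rw [hg] at hq hb1
  filter_upwards [h4 x g hb1 hq, hb.ev_eq g 1 x] with y hy hy'
  rw [one_smul, one_smul] at hy'
  exact (h3 y _ (hy'.2 hb1) hy).symm

/-- Properties of the retraction onto base floors at a level. -/
structure Base (b : X → X) (π : X → ℕ) (C B : Set X) (p : X → X) (τ : ℕ → ℕ) : Prop where
  off : ∀ x, x ∉ B → p x = x
  mem : ∀ x ∈ B, p x ∈ B
  fibre : ∀ x, b (p x) = b x
  lab : ∀ x ∈ B, π (p x) = τ (π x)
  ker : ∀ x ∈ B, ∀ y ∈ B, b x = b y → p x = p y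
  memC : ∀ x ∈ B, x ∈ C → p x ∈ C
  idem : ∀ x ∈ B, τ (τ (π x)) = τ (π x)
  shape : ∀ x ∈ B, ∀ y ∈ B, τ (π y) = τ (π x) → ∃ x1 ∈ B, b x1 = b x ∧ π x1 = π y

theorem exists_base {K : Finset G} {b : X → X} {π : X → ℕ} {C B : Set X} (h : Lev K b π C)
    (hB : Ref π (fun x => x ∈ B)) : ∃ p τ, PW G p ∧ Base b π C B p τ := by
  have hB : ∀ x y, π x = π y → (x ∈ B ↔ y ∈ B) := fun x y hxy => eq_iff_iff.1 (hB x y hxy)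
  set T : X → Set ℕ := fun x => {k | ∃ y ∈ B, b y = b x ∧ π y = k} with hT
  have hTb : ∀ x y, b x = b y → T x = T y := fun x y hxy => by simp only [hT, hxy]
  have hTs : ∀ x y, π x = π y → T x ⊆ T y := by
    rintro x y hxy k ⟨x1, h1, h2, rfl⟩
    obtain ⟨y1, h3, h4⟩ := h.lab.shape x y hxy x1 h2
    exact ⟨y1, (hB _ _ h4).2 h1, h3, h4⟩
  have hTπ : ∀ x y, π x = π y → T x = T y := fun x y hxy =>
    (hTs x y hxy).antisymm (hTs y x hxy.symm)
  have hβ : ∃ β : Set ℕ → ℕ, ∀ S : Set ℕ, (S.Nonempty → β S ∈ S) ∧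
      ((∃ k ∈ S, ∃ y ∈ C, π y = k) → ∃ y ∈ C, π y = β S) := by
    have : ∀ S : Set ℕ, ∃ k, (S.Nonempty → k ∈ S) ∧
      ((∃ k ∈ S, ∃ y ∈ C, π y = k) → ∃ y ∈ C, π y = k) := by
      intro S
      by_cases h1 : ∃ k ∈ S, ∃ y ∈ C, π y = k
      · obtain ⟨k, hk, hy⟩ := h1
        exact ⟨k, fun _ => hk, fun _ => hy⟩
      · by_cases h2 : S.Nonempty
        · obtain ⟨k, hk⟩ := h2
          exact ⟨k, fun _ => hk, fun h => absurd h h1⟩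
        · exact ⟨0, fun h => absurd h h2, fun h => absurd h h1⟩
    choose β hβ using this
    exact ⟨β, hβ⟩
  obtain ⟨β, hβ⟩ := hβ
  have hself : ∀ x ∈ B, π x ∈ T x := fun x hx => ⟨x, hx, rfl, rfl⟩
  have hex : ∀ x, ∃ y, b y = b x ∧ (x ∈ B → y ∈ B ∧ π y = β (T x)) ∧ (x ∉ B → y = x) := by
    intro x
    by_cases hx : x ∈ B
    · obtain ⟨y, h1, h2, h3⟩ := (hβ (T x)).1 ⟨_, hself x hx⟩
      exact ⟨y, h2, fun _ => ⟨h1, h3⟩, fun h => absurd hx h⟩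
    · exact ⟨x, rfl, fun h => absurd h hx, fun _ => rfl⟩
  choose p hp1 hp2 hp3 using hex
  have hτ : ∃ τ : ℕ → ℕ, ∀ x, τ (π x) = β (T x) := by
    refine ⟨fun k => if h : ∃ x, π x = k then β (T h.choose) else 0, fun x => ?_⟩
    have hx : ∃ x', π x' = π x := ⟨x, rfl⟩
    simp only [dif_pos hx]
    rw [hTπ _ _ hx.choose_spec]
  obtain ⟨τ, hτ⟩ := hτ
  have hidem : ∀ x ∈ B, τ (τ (π x)) = τ (π x) := by
    intro x hx
    rw [hτ x, ← (hp2 x hx).2, hτ, hTb _ _ (hp1 x), (hp2 x hx).2]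
  refine ⟨p, τ, ?_, ⟨hp3, fun x hx => (hp2 x hx).1, hp1, fun x hx => by rw [hτ, (hp2 x hx).2], ?_,
    ?_, hidem, ?_⟩⟩
  · refine h.pw.of_pick (Q := fun x y => (x ∈ B → y ∈ B ∧ π y = τ (π x)) ∧ (x ∉ B → y = x)) hp1 ?_ ?_ ?_
    · exact fun x => ⟨fun hx => by rw [hτ]; exact hp2 x hx, hp3 x⟩
    · rintro x y hxy ⟨h1, h2⟩
      by_cases hx : x ∈ B
      · exact h.lab.inj _ _ (hxy.trans (hp1 x).symm) (by rw [(h1 hx).2, hτ, (hp2 x hx).2])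
      · rw [h2 hx, hp3 x hx]
    · rintro x g - ⟨h1, h2⟩
      filter_upwards [lc_ev h.lab.lc x, lc_ev (lc_smul h.lab.lc g) x] with y e1 e2
      refine ⟨fun hy => ?_, fun hy => ?_⟩
      · have := h1 ((hB _ _ e1).1 hy)
        exact ⟨(hB _ _ e2).2 this.1, by rw [e2, e1, this.2]⟩
      · have := h2 (fun h' => hy ((hB _ _ e1).2 h'))
        have : g = 1 := smul_inj.1 (this.trans (one_smul G x).symm)
        rw [this, one_smul]
  · intro x hx y hy hxy
    refine h.lab.inj _ _ (by rw [hp1, hp1, hxy]) ?_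
    rw [(hp2 x hx).2, (hp2 y hy).2, hTb x y hxy]
  · intro x hx hxC
    obtain ⟨y, hy, hye⟩ := (hβ (T x)).2 ⟨π x, hself x hx, x, hxC, rfl⟩
    rw [← (hp2 x hx).2] at hye
    exact (h.piC _ _ hye).1 hy
  · intro x hx y hy hxy
    have h1 : π (p y) = π (p x) := by rw [(hp2 y hy).2, (hp2 x hx).2, ← hτ, ← hτ, hxy]
    have h2 : π y ∈ T x := by
      rw [← hTb _ _ (hp1 x), ← hTπ _ _ h1, hTb _ _ (hp1 y)]
      exact hself y hy
    obtain ⟨x1, h3, h4, h5⟩ := h2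
    exact ⟨x1, h3, h4, h5⟩

end Pick

section Extend

theorem exists_bijOn_extend {α β : Type*} {D D0 : Finset α} {M : Finset β} {f : α → ℕ} {g : β → ℕ}
    (hcard : ∀ u, (D.filter (fun x => f x = u)).card = (M.filter (fun x => g x = u)).card)
    (hD : D0 ⊆ D) {e0 : α → β} (h0 : ∀ x ∈ D0, e0 x ∈ M) (hg : ∀ x ∈ D0, g (e0 x) = f x)
    (hinj : Set.InjOn e0 D0) :
    ∃ e : α → β, Set.BijOn e D M ∧ (∀ x ∈ D, g (e x) = f x) ∧ ∀ x ∈ D0, e x = e0 x := by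
  have key : ∀ u, ∃ E : (D.filter (fun x => f x = u)) ≃ (M.filter (fun x => g x = u)),
      ∀ x (hx : x ∈ D0) (hu : f x = u),
        (E ⟨x, Finset.mem_filter.2 ⟨hD hx, hu⟩⟩ : β) = e0 x := by
    intro u
    obtain ⟨E, hE⟩ := Finset.exists_equiv_extend_of_card_eq
      (α := (D.filter (fun x => f x = u))) (t := M.filter (fun x => g x = u))
      (by rw [Fintype.card_coe, hcard]) (s := Finset.univ.filter (fun x => (x : α) ∈ D0))
      (f := fun x => e0 x) (by
        intro y hy
        obtain ⟨x, hx, rfl⟩ := Finset.mem_image.1 hy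
        have hx := (Finset.mem_filter.1 hx).2
        exact Finset.mem_filter.2 ⟨h0 _ hx, by rw [hg _ hx]; exact (Finset.mem_filter.1 x.2).2⟩) (by
        intro x hx y hy hxy
        simp only [Finset.coe_filter, Finset.mem_univ, true_and, Set.mem_ofPred_eq] at hx hy
        exact Subtype.ext (hinj hx hy hxy))
    exact ⟨E, fun x hx hu => hE _ (Finset.mem_filter.2 ⟨Finset.mem_univ _, hx⟩)⟩
  choose E hE using key
  by_cases hβ : Nonempty β
  swap
  · rw [not_nonempty_iff] at hβ
    have hM : M = ∅ := Finset.eq_empty_of_isEmpty M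
    have hD' : D = ∅ := by
      rw [Finset.eq_empty_iff_forall_notMem]
      intro x hx
      have := hcard (f x)
      rw [hM, Finset.filter_empty, Finset.card_empty, Finset.card_eq_zero] at this
      have h2 : x ∈ D.filter (fun y => f y = f x) := Finset.mem_filter.2 ⟨hx, rfl⟩
      rw [this] at h2
      exact absurd h2 (Finset.notMem_empty x)
    subst hM hD'
    refine ⟨e0, by simp [Set.BijOn, Set.MapsTo, Set.SurjOn], by simp, fun x hx => rfl⟩
  obtain ⟨d⟩ := hβ
  let e : α → β := fun x => if hx : x ∈ D then E (f x) ⟨x, Finset.mem_filter.2 ⟨hx, rfl⟩⟩ else d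
  have he : ∀ x (hx : x ∈ D), e x = E (f x) ⟨x, Finset.mem_filter.2 ⟨hx, rfl⟩⟩ :=
    fun x hx => dif_pos hx
  have hm : ∀ x ∈ D, e x ∈ M ∧ g (e x) = f x := by
    intro x hx
    rw [he x hx]
    exact Finset.mem_filter.1 (E (f x) _).2
  have he' : ∀ x (hx : x ∈ D) u (hu : f x = u), e x = E u ⟨x, Finset.mem_filter.2 ⟨hx, hu⟩⟩ := by
    rintro x hx u rfl
    exact he x hx
  refine ⟨e, ⟨fun x hx => (hm x hx).1, ?_, ?_⟩, fun x hx => (hm x hx).2, fun x hx => ?_⟩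
  · intro x hx y hy hxy
    have hf : f y = f x := by rw [← (hm x hx).2, ← (hm y hy).2, hxy]
    rw [he x hx, he' y hy _ hf] at hxy
    have := (E (f x)).injective (Subtype.ext hxy)
    exact congrArg Subtype.val this
  · intro y hy
    obtain ⟨x, hx⟩ := (E (g y)).surjective ⟨y, Finset.mem_filter.2 ⟨hy, rfl⟩⟩
    have hx2 := Finset.mem_filter.1 x.2
    refine ⟨x, hx2.1, ?_⟩
    rw [he' _ hx2.1 _ hx2.2]
    exact congrArg Subtype.val hx
  · rw [he x (hD hx)]
    exact hE _ x hx rfl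

theorem exists_injOn_lt {α : Type*} (S : Finset α) : ∃ κ : α → ℕ, Set.InjOn κ S ∧ ∀ x ∈ S, κ x < S.card := by
  refine ⟨fun x => if h : x ∈ S then S.equivFin ⟨x, h⟩ else 0, ?_, ?_⟩
  · intro x hx y hy hxy
    rw [Finset.mem_coe] at hx hy
    simp only [hx, hy, dif_pos] at hxy
    have := S.equivFin.injective (Fin.ext hxy)
    exact congrArg Subtype.val this
  · intro x hx
    simp only [hx, dif_pos]
    exact (S.equivFin ⟨x, hx⟩).2

end Extend

end

section

section Realize

variable {G X : Type*} [CommGroup G] [TopologicalSpace X] [MulAction G X]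
  [CompactSpace X] [FreeAct G X] [ContinuousConstSMul G X]

theorem realize_fibre {b : X → X} (hb : PW G b) {B' Y C : Set X} {v' ℓ : X → ℕ} {p : X → X} {L : Finset ℕ}
    {s τ : ℕ → ℕ} {c : ℕ → X → ℤ} (hYC : Y ⊆ C)
    (hcount : ∀ u z, sig G b (ind (lv B' v' u)) z = ∑ l ∈ L.filter (fun l => s l = u), sig G b (c (τ l)) z)
    (hlow : ∀ x, ∀ l ∈ L, (((fib G b (b x)).filter (fun y => y ∈ C)).card : ℤ) ≤ sig G b (c (τ l)) (b x))
    (hYL : ∀ y ∈ Y, y ∈ B' → ℓ y ∈ L ∧ s (ℓ y) = v' y ∧ p y ∈ Y ∧ p y ∈ B' ∧ b (p y) = b y ∧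
      p (p y) = p y ∧ ℓ (p y) = τ (ℓ y))
    (hinj : ∀ y ∈ Y, y ∈ B' → ∀ y' ∈ Y, y' ∈ B' → ℓ y = ℓ y' → p y = p y' → y = y') (z : X) :
    ∃ e : X → (_ : ℕ) × ℕ,
      (∀ x ∈ B', b x = z → (e x).1 ∈ L ∧ (e x).2 < (sig G b (c (τ (e x).1)) z).toNat ∧ s (e x).1 = v' x) ∧
      (∀ x ∈ B', ∀ y ∈ B', b x = z → b y = z → e x = e y → x = y) ∧
      (∀ x, b x = z → ∀ l ∈ L, ∀ j < (sig G b (c (τ l)) z).toNat, ∃ x1 ∈ B', b x1 = z ∧ e x1 = ⟨l, j⟩) ∧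
      (∀ y ∈ Y, y ∈ B' → b y = z → (e y).1 = ℓ y ∧ e (p y) = ⟨τ (ℓ y), (e y).2⟩) := by
  have hnn : ∀ l ∈ L, 0 ≤ sig G b (c (τ l)) z := by
    intro l hl
    by_cases h : ∃ x, b x = z
    · obtain ⟨x, rfl⟩ := h
      exact le_trans (Int.natCast_nonneg _) (hlow x l hl)
    · rw [sig, Finset.sum_eq_zero]
      intro x hx
      rw [mem_fib hb] at hx
      exact absurd ⟨x, hx⟩ h
  set D := (fib G b z).filter (fun x => x ∈ B') with hD
  have mD : ∀ x, x ∈ D ↔ b x = z ∧ x ∈ B' := fun x => by rw [hD, Finset.mem_filter, mem_fib hb]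
  set M : Finset ((_ : ℕ) × ℕ) := L.sigma fun l => Finset.range (sig G b (c (τ l)) z).toNat with hM
  have mM : ∀ q, q ∈ M ↔ q.1 ∈ L ∧ q.2 < (sig G b (c (τ q.1)) z).toNat := fun q => by
    rw [hM, Finset.mem_sigma, Finset.mem_range]
  set S := (fib G b z).filter (fun y => y ∈ C) with hS
  obtain ⟨κ, hκ, hκc⟩ := exists_injOn_lt S
  have mS : ∀ y, y ∈ S ↔ b y = z ∧ y ∈ C := fun x => by rw [hS, Finset.mem_filter, mem_fib hb]
  have hD0 : ∀ y, y ∈ D.filter (fun y => y ∈ Y) ↔ (b y = z ∧ y ∈ B') ∧ y ∈ Y := fun y => by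
    rw [Finset.mem_filter, mD]
  have hpS : ∀ y, (b y = z ∧ y ∈ B') ∧ y ∈ Y → p y ∈ S := by
    rintro y ⟨⟨h1, h2⟩, h3⟩
    obtain ⟨-, -, h4, -, h5, -⟩ := hYL y h3 h2
    exact (mS _).2 ⟨h5.trans h1, hYC h4⟩
  obtain ⟨e, he1, he2, he3⟩ := exists_bijOn_extend (D := D) (M := M) (f := v') (g := fun q => s q.1)
    (D0 := D.filter (fun y => y ∈ Y)) (e0 := fun y => ⟨ℓ y, κ (p y)⟩) (by
      intro u
      have h1 : M.filter (fun q => s q.1 = u) = (L.filter (fun l => s l = u)).sigma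
          fun l => Finset.range (sig G b (c (τ l)) z).toNat := by
        ext q
        simp only [hM, Finset.mem_filter, Finset.mem_sigma]
        tauto
      have h2 : D.filter (fun x => v' x = u) = (fib G b z).filter (fun x => x ∈ lv B' v' u) := by
        ext x
        rw [Finset.mem_filter, Finset.mem_filter, Finset.mem_filter, mem_fib hb]
        exact and_assoc
      rw [h1, h2, Finset.card_sigma]
      have h3 := hcount u z
      rw [sig_ind] at h3
      simp only [Finset.card_range]
      apply Nat.cast_injective (R := ℤ)
      rw [Nat.cast_sum]
      refine h3.trans (Finset.sum_congr rfl fun l hl => ?_)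
      rw [Int.toNat_of_nonneg (hnn l (Finset.mem_filter.1 hl).1)])
    (Finset.filter_subset _ _) (by
      intro y hy
      rw [hD0] at hy
      obtain ⟨h1, -⟩ := hYL y hy.2 hy.1.2
      refine (mM _).2 ⟨h1, ?_⟩
      have h2 := hκc _ (hpS y hy)
      have h3 := hlow y _ h1
      rw [hy.1.1, ← hS] at h3
      show κ (p y) < (sig G b (c (τ (ℓ y))) z).toNat
      omega) (by
      intro y hy
      rw [hD0] at hy
      exact (hYL y hy.2 hy.1.2).2.1) (by
      intro y hy y' hy' h
      rw [Finset.mem_coe, hD0] at hy hy'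
      rw [Sigma.mk.injEq] at h
      exact hinj y hy.2 hy.1.2 y' hy'.2 hy'.1.2 h.1 (hκ (hpS y hy) (hpS y' hy') (eq_of_heq h.2)))
  refine ⟨e, ?_, ?_, ?_, ?_⟩
  · intro x hx hxz
    have h1 := (mD x).2 ⟨hxz, hx⟩
    have h2 := (mM _).1 (he1.mapsTo h1)
    exact ⟨h2.1, h2.2, he2 x h1⟩
  · intro x hx y hy hxz hyz h
    exact he1.injOn ((mD x).2 ⟨hxz, hx⟩) ((mD y).2 ⟨hyz, hy⟩) h
  · intro x hx l hl j hj
    obtain ⟨x1, h1, h2⟩ := he1.surjOn ((mM ⟨l, j⟩).2 ⟨hl, hj⟩)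
    obtain ⟨h3, h4⟩ := (mD x1).1 h1
    exact ⟨x1, h4, h3, h2⟩
  · intro y hy hyB hyz
    have h1 := he3 y ((hD0 y).2 ⟨⟨hyz, hyB⟩, hy⟩)
    obtain ⟨-, -, h4, h5, h6, h7, h8⟩ := hYL y hy hyB
    have h2 := he3 (p y) ((hD0 _).2 ⟨⟨h6.trans hyz, h5⟩, h4⟩)
    refine ⟨by rw [h1], ?_⟩
    rw [h2, h1, h7, h8]

variable [T2Space X] [TotallyDisconnectedSpace X]

theorem realize {b : X → X} (hb : PW G b) {B' Y C : Set X} {v' ℓ : X → ℕ} {p : X → X} {L : Finset ℕ}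
    {s τ : ℕ → ℕ} {c : ℕ → X → ℤ} (cB : IsClopen B') (hv' : IsLocallyConstant v')
    (hℓ : IsLocallyConstant ℓ) (hp : PW G p) (hc : ∀ l ∈ L, IsLocallyConstant (c (τ l)))
    (hY : IsClosed Y) (hYC : Y ⊆ C)
    (hcount : ∀ u z, sig G b (ind (lv B' v' u)) z = ∑ l ∈ L.filter (fun l => s l = u), sig G b (c (τ l)) z)
    (hlow : ∀ x, ∀ l ∈ L, (((fib G b (b x)).filter (fun y => y ∈ C)).card : ℤ) ≤ sig G b (c (τ l)) (b x))
    (hYL : ∀ y ∈ Y, y ∈ B' → ℓ y ∈ L ∧ s (ℓ y) = v' y ∧ p y ∈ Y ∧ p y ∈ B' ∧ b (p y) = b y ∧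
      p (p y) = p y ∧ ℓ (p y) = τ (ℓ y))
    (hinj : ∀ y ∈ Y, y ∈ B' → ∀ y' ∈ Y, y' ∈ B' → ℓ y = ℓ y' → p y = p y' → y = y') :
    ∃ e : X → (_ : ℕ) × ℕ, IsLocallyConstant e ∧
      (∀ x ∈ B', (e x).1 ∈ L ∧ (e x).2 < (sig G b (c (τ (e x).1)) (b x)).toNat ∧ s (e x).1 = v' x) ∧
      (∀ x ∈ B', ∀ y ∈ B', b x = b y → e x = e y → x = y) ∧
      (∀ x, ∀ l ∈ L, ∀ j < (sig G b (c (τ l)) (b x)).toNat, ∃ x1 ∈ B', b x1 = b x ∧ e x1 = ⟨l, j⟩) ∧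
      (∀ y ∈ Y, y ∈ B' → (e y).1 = ℓ y ∧ e (p y) = ⟨τ (ℓ y), (e y).2⟩) := by
  obtain ⟨α, hα, h⟩ := lc_select (α := G → (_ : ℕ) × ℕ) (P := fun z α =>
    (∀ g ∈ Phi G b z, g • z ∈ B' → (α g).1 ∈ L ∧ (α g).2 < (sig G b (c (τ (α g).1)) z).toNat ∧
      s (α g).1 = v' (g • z)) ∧
    (∀ g ∈ Phi G b z, ∀ h ∈ Phi G b z, g • z ∈ B' → h • z ∈ B' → α g = α h → g = h) ∧
    ((Phi G b z).Nonempty → ∀ l ∈ L, ∀ j < (sig G b (c (τ l)) z).toNat, ∃ g ∈ Phi G b z,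
      g • z ∈ B' ∧ α g = ⟨l, j⟩) ∧
    (∀ g ∈ Phi G b z, g • z ∈ Y → g • z ∈ B' → (α g).1 = ℓ (g • z) ∧
      ∀ h ∈ Phi G b z, p (g • z) = h • z → α h = ⟨τ (ℓ (g • z)), (α g).2⟩)) (by
    intro z
    obtain ⟨e, h1, h2, h3, h4⟩ := realize_fibre hb hYC hcount hlow hYL hinj z
    refine ⟨fun g => e (g • z), ?_⟩
    have hYev : ∀ᶠ y in 𝓝 z, ∀ g ∈ Phi G b z, g • y ∈ Y → g • z ∈ Y := by
      rw [Filter.eventually_all_finset]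
      intro g _
      by_cases hg : g • z ∈ Y
      · exact Eventually.of_forall fun _ _ => hg
      · filter_upwards [(hY.isOpen_compl.preimage (continuous_const_smul g)).mem_nhds hg] with y hy hy'
        exact absurd hy' hy
    have hpev : ∀ᶠ y in 𝓝 z, ∀ g ∈ Phi G b z, ∀ h ∈ Phi G b z,
        (p (g • y) = h • y ↔ p (g • z) = h • z) := by
      rw [Filter.eventually_all_finset]
      intro g _
      rw [Filter.eventually_all_finset]
      exact fun h _ => hp.ev_smul g h z
    filter_upwards [lc_ev (lc_Phi hb) z, hYev, hpev,
      lc_finite_forall (Phi G b z) (f := fun g y => g • y ∈ B') (fun g _ => lc_smul (lc_mem cB) g) z,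
      lc_finite_forall (Phi G b z) (f := fun g y => v' (g • y)) (fun g _ => lc_smul hv' g) z,
      lc_finite_forall (Phi G b z) (f := fun g y => ℓ (g • y)) (fun g _ => lc_smul hℓ g) z,
      lc_finite_forall L (f := fun l y => sig G b (c (τ l)) y) (fun l hl => lc_sig hb (hc l hl)) z]
      with y eP eY ep eB ev el ec
    rw [eP]
    have hΦ : ∀ g ∈ Phi G b z, b (g • z) = z := fun g hg => (mem_Phi hb).1 hg
    refine ⟨?_, ?_, ?_, ?_⟩
    · intro g hg hgB
      rw [eB g hg] at hgB
      obtain ⟨q1, q2, q3⟩ := h1 _ hgB (hΦ g hg)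
      exact ⟨q1, by rw [ec _ q1]; exact q2, by rw [ev g hg]; exact q3⟩
    · intro g hg h hh hgB hhB hgh
      rw [eB g hg] at hgB
      rw [eB h hh] at hhB
      exact smul_inj.1 (h2 _ hgB _ hhB (hΦ g hg) (hΦ h hh) hgh)
    · rintro ⟨g, hg⟩ l hl j hj
      rw [ec l hl] at hj
      obtain ⟨x1, q1, q2, q3⟩ := h3 _ (hΦ g hg) l hl j hj
      have q4 := (mem_fib hb).2 q2
      obtain ⟨g1, hg1, rfl⟩ := Finset.mem_image.1 q4
      exact ⟨g1, hg1, by rw [eB g1 hg1]; exact q1, q3⟩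
    · intro g hg hgY hgB
      rw [eB g hg] at hgB
      obtain ⟨q1, q2⟩ := h4 _ (eY g hg hgY) hgB (hΦ g hg)
      rw [el g hg]
      refine ⟨q1, fun h hh hph => ?_⟩
      rw [ep g hg h hh] at hph
      rw [hph] at q2
      exact q2)
  obtain ⟨θ, hθ, hbθ⟩ := id hb
  have hx : ∀ x, (θ x)⁻¹ ∈ Phi G b (b x) ∧ (θ x)⁻¹ • b x = x := by
    intro x
    have : (θ x)⁻¹ • b x = x := by rw [hbθ, inv_smul_smul]
    exact ⟨by rw [mem_Phi hb, this], this⟩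
  have hg : ∀ x, ∀ g ∈ Phi G b (b x), (θ (g • b x))⁻¹ = g ∧ b (g • b x) = b x := by
    intro x g hg
    rw [mem_Phi hb] at hg
    have h1 := (hx (g • b x)).2
    rw [hg] at h1
    exact ⟨smul_inj.1 h1, hg⟩
  refine ⟨fun x => α (b x) (θ x)⁻¹, lc_comp2 (fun a g => a g⁻¹) (hb.lc_comp hα) hθ, ?_, ?_, ?_, ?_⟩
  · intro x hxB
    have := (h (b x)).1 _ (hx x).1
    rw [(hx x).2] at this
    exact this hxB
  · intro x hxB y hyB hxy he
    have := (h (b x)).2.1 _ (hx x).1 (θ y)⁻¹ (by rw [hxy]; exact (hx y).1)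
    rw [(hx x).2, hxy, (hx y).2] at this
    have he' : α (b x) (θ x)⁻¹ = α (b y) (θ y)⁻¹ := he
    have h2 := this hxB hyB (by rw [← he', hxy])
    rw [← (hx x).2, h2, hxy, (hx y).2]
  · intro x l hl j hj
    obtain ⟨g, hg1, hg2, hg3⟩ := (h (b x)).2.2.1 ⟨_, (hx x).1⟩ l hl j hj
    refine ⟨g • b x, hg2, (hg x g hg1).2, ?_⟩
    show α (b (g • b x)) (θ (g • b x))⁻¹ = _
    rw [(hg x g hg1).1, (hg x g hg1).2, hg3]
  · intro y hy hyB
    have := (h (b y)).2.2.2 _ (hx y).1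
    rw [(hx y).2] at this
    obtain ⟨h1, h2⟩ := this hy hyB
    have hpy := (hYL y hy hyB).2.2.2.2.1
    refine ⟨h1, ?_⟩
    show α (b (p y)) (θ (p y))⁻¹ = _
    rw [hpy]
    exact h2 _ (by rw [← hpy]; exact (hx (p y)).1) (by rw [← hpy, (hx (p y)).2])

end Realize

end

section

theorem sum_count {A : Type*} [AddCommGroup A] (L : Finset ℕ) (s τ : ℕ → ℕ) (u : ℕ) (f : ℕ → A) :
    ∑ l ∈ L.filter (fun l => s l = u), f (τ l) =
      ∑ i ∈ L.image τ, ((L.filter (fun l => s l = u ∧ τ l = i)).card : ℤ) • f i := by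
  rw [← Finset.sum_fiberwise_of_maps_to (t := L.image τ) (g := τ)
    (fun l hl => Finset.mem_image_of_mem _ (Finset.mem_filter.1 hl).1)]
  refine Finset.sum_congr rfl fun i _ => ?_
  rw [Finset.filter_filter, natCast_zsmul, ← Finset.sum_const]
  exact Finset.sum_congr rfl fun l hl => by rw [(Finset.mem_filter.1 hl).2.2]

theorem Ref.factor_nat {X : Type*} {π f : X → ℕ} (h : Ref π f) : ∃ s : ℕ → ℕ, ∀ x, s (π x) = f x := by
  refine ⟨fun k => if h : ∃ x, π x = k then f h.choose else 0, fun x => ?_⟩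
  have hx : ∃ x', π x' = π x := ⟨x, rfl⟩
  simp only [dif_pos hx]
  exact h _ _ hx.choose_spec

theorem lc_zsmul {X : Type*} [TopologicalSpace X] {f : X → ℤ} (hf : IsLocallyConstant f) (n : ℤ) :
    IsLocallyConstant (n • f) := lc_comp2 (fun a _ => n * a) hf hf

theorem lc_sub {X : Type*} [TopologicalSpace X] {f g : X → ℤ} (hf : IsLocallyConstant f)
    (hg : IsLocallyConstant g) : IsLocallyConstant (f - g) := lc_comp2 (fun a b => a - b) hf hg

theorem lc_add {X : Type*} [TopologicalSpace X] {f g : X → ℤ} (hf : IsLocallyConstant f)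
    (hg : IsLocallyConstant g) : IsLocallyConstant (f + g) := lc_comp2 (fun a b => a + b) hf hg

theorem lv_clopen {X : Type*} [TopologicalSpace X] {B : Set X} (hB : IsClopen B) {v : X → ℕ}
    (hv : IsLocallyConstant v) (k : ℕ) : IsClopen (lv B v k) :=
  hB.inter (hv.isClopen_fiber k)

section Family

variable {G X : Type*} [CommGroup G] [TopologicalSpace X] [MulAction G X]
  [CompactSpace X] [FreeAct G X] [ContinuousConstSMul G X]
  [T2Space X] [TotallyDisconnectedSpace X]
  [MeasurableSpace X] [BorelSpace X] {μ : Measure X}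
  [IsProbabilityMeasure μ] [SMulInvariantMeasure G X μ]
  {K : Finset G} {b : ℕ → X → X} {π : ℕ → X → ℕ} {C : ℕ → Set X}

theorem Tower.ev_ref (hT : Tower μ K b π C) {α : Type*} {f : X → α} (hf : IsLocallyConstant f) :
    ∀ᶠ n in atTop, Ref (π n) f := by
  obtain ⟨q, hq, h⟩ := lc_recode hf
  obtain ⟨n, hn⟩ := hT.cof q hq
  filter_upwards [eventually_ge_atTop n] with m hm
  exact hT.ref_mono hm fun x y hxy => (h x y).1 (hn x y hxy)

/-- A family of functions with prescribed sums, prescribed integrals and independent functionals. -/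
theorem exists_family (hS : Sys G μ) (hT : Tower μ K b π C) {t : ℝ} (ht : 0 < t)
    (hE : ∀ f : X → ℤ, IsLocallyConstant f → ∃ g, IsLocallyConstant g ∧ ing μ g = t * ing μ f)
    {n : ℕ} {B B' : Set X} {v v' : X → ℕ} {L : Finset ℕ} {s τ : ℕ → ℕ} {F : ℕ → Set X}
    (cF : ∀ i, IsClopen (F i)) (cB : IsClopen B) (hv : IsLocallyConstant v)
    (cB' : IsClopen B') (hv' : IsLocallyConstant v')
    (hF : ∀ l ∈ L, ∀ z, sig G (b n) (ind (F l)) z = sig G (b n) (ind (F (τ l))) z)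
    (hsum : ∀ u, ind (lv B v u) = ∑ l ∈ L.filter (fun l => s l = u), ind (F l))
    (hV : ∀ u, u ∈ L.image s ↔ u ∈ v '' B)
    (hmeas : ∀ k, μ.real (lv B' v' k) = t * μ.real (lv B v k))
    (hspl : Spl (Fn G (b n)) B v) (hspl' : ∀ᶠ m in atTop, Spl (Fn G (b m)) B' v') :
    ∃ c : ℕ → X → ℤ, (∀ i, IsLocallyConstant (c i)) ∧
      (∀ u, ∑ l ∈ L.filter (fun l => s l = u), c (τ l) = ind (lv B' v' u)) ∧
      (∀ i, ing μ (c i) = t * ing μ (ind (F i))) ∧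
      ∀ᶠ m in atTop, ∀ w ∈ L.image τ, ∃ f ∈ Fn G (b m), ∀ j ∈ L.image τ, f (c j) = if j = w then 1 else 0 := by
  set I := L.image τ with hI
  set V := L.image s with hVdef
  set k : ℕ → ℕ → ℤ := fun u i => ((L.filter (fun l => s l = u ∧ τ l = i)).card : ℤ) with hk
  have hpw := (hT.lev n).pw
  have hlam : ∀ w, ∃ f : (X → ℤ) →+ ℤ, w ∈ V → f ∈ Fn G (b n) ∧
      ∀ u, f (ind (lv B v u)) = if u = w then 1 else 0 := by
    intro w
    by_cases hw : w ∈ V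
    · obtain ⟨f, h1, h2⟩ := hspl w ((hV w).1 hw)
      exact ⟨f, fun _ => ⟨h1, h2⟩⟩
    · exact ⟨0, fun h => absurd h hw⟩
  choose lam hlam using hlam
  set l : ℕ → ℕ → ℤ := fun i w => lam w (ind (F i)) with hl
  have hkl : ∀ u ∈ V, ∀ w ∈ V, ∑ i ∈ I, k u i * l i w = if u = w then 1 else 0 := by
    intro u _ w hw
    obtain ⟨h1, h2⟩ := hlam w hw
    rw [← h2 u, hsum u, map_sum]
    have h3 := sum_count L s τ u (fun i => lam w (ind (F i)))
    simp only [smul_eq_mul] at h3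
    rw [← h3]
    exact Finset.sum_congr rfl fun l hl => Fn_congr (fun z => (hF l (Finset.mem_filter.1 hl).1 z).symm) h1
  choose c0 lc0 ic0 using fun i => hE (ind (F i)) (lc_ind (cF i))
  have lks : ∀ u, IsLocallyConstant (∑ i ∈ I, k u i • c0 i) := fun u =>
    lc_sum_fun _ fun i _ => lc_zsmul (lc0 i) _
  set e : ℕ → X → ℤ := fun u => ind (lv B' v' u) - ∑ i ∈ I, k u i • c0 i with he
  have le : ∀ u, IsLocallyConstant (e u) := fun u => lc_sub (lc_ind (lv_clopen cB' hv' u)) (lks u)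
  have ie : ∀ u, ing μ (e u) = 0 := by
    intro u
    rw [he, ing_sub (lc_ind (lv_clopen cB' hv' u)) (lks u), ing_ind (lv_clopen cB' hv' u), hmeas,
      ← ing_ind (lv_clopen cB hv u), hsum u, ing_sum _ fun i _ => lc_ind (cF i),
      ing_sum _ fun i _ => lc_zsmul (lc0 i) _, sub_eq_zero]
    have h1 : ∀ i ∈ L.filter (fun l => s l = u), ing μ (ind (F i)) = ing μ (ind (F (τ i))) := by
      intro i hi
      rw [← ing_sig hpw (lc_ind (cF i)), ← ing_sig hpw (lc_ind (cF (τ i))),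
        funext (hF i (Finset.mem_filter.1 hi).1)]
    rw [Finset.sum_congr rfl h1, sum_count L s τ u (fun i => ing μ (ind (F i))), Finset.mul_sum]
    refine Finset.sum_congr rfl fun i _ => ?_
    rw [ing_zsmul, ic0, zsmul_eq_mul]
    ring
  obtain ⟨M, hM0, hMe⟩ : ∃ M, (∀ i ∈ I, Ref (π M) (c0 i)) ∧ ∀ u ∈ V, Ref (π M) (e u) :=
    (((Filter.eventually_all_finset I).2 fun i _ => hT.ev_ref (lc0 i)).and
      ((Filter.eventually_all_finset V).2 fun u _ => hT.ev_ref (le u))).exists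
  obtain ⟨r, hr⟩ : ∃ r, ∀ i ∈ I, i < r := ⟨I.sup id + 1, fun i hi =>
    Nat.lt_succ_of_le (Finset.le_sup (f := id) hi)⟩
  obtain ⟨io, hio, hfr⟩ := hT.fresh M r
  have lio : ∀ u, IsLocallyConstant (∑ j ∈ I, k u j • io j) := fun u =>
    lc_sum_fun _ fun i _ => lc_zsmul (hio i).1 _
  have l1 : ∀ i, IsLocallyConstant (∑ u ∈ V, l i u • e u) := fun i =>
    lc_sum_fun _ fun u _ => lc_zsmul (le u) _
  have l2 : ∀ i, IsLocallyConstant (∑ u ∈ V, l i u • ∑ j ∈ I, k u j • io j) := fun i =>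
    lc_sum_fun _ fun u _ => lc_zsmul (lio u) _
  have hV' : ∀ u, u ∈ V → u ∈ (v') '' B' := by
    intro u hu
    obtain ⟨x, hx, rfl⟩ := (hV u).1 hu
    have h1 : 0 < μ.real (lv B v (v x)) := real_pos hS (lv_clopen cB hv _) ⟨x, hx, rfl⟩
    have h2 : 0 < μ.real (lv B' v' (v x)) := by rw [hmeas]; positivity
    have h3 : (lv B' v' (v x)).Nonempty := by
      rw [Set.nonempty_iff_ne_empty]
      intro h
      rw [h, measureReal_empty] at h2
      exact lt_irrefl _ h2
    obtain ⟨y, hy⟩ := h3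
    exact ⟨y, hy.1, hy.2⟩
  have hsumE : ∀ u, ∑ i ∈ I, k u i • c0 i + e u = ind (lv B' v' u) := fun u =>
    add_sub_cancel _ _
  refine ⟨cfam I V k l c0 e io, fun i => ?_, fun u => ?_, fun i => ?_, ?_⟩
  · exact lc_sub (lc_add (lc_add (lc0 i) (l1 i)) (hio i).1) (l2 i)
  · by_cases hu : u ∈ V
    · rw [sum_count, ← hsumE u]
      exact cfam_sum hkl c0 e io hu
    · have h0 : L.filter (fun l => s l = u) = ∅ :=
        Finset.filter_eq_empty_iff.2 fun l hl h => hu (Finset.mem_image.2 ⟨l, hl, h⟩)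
      rw [h0, Finset.sum_empty]
      have h1 : lv B v u = ∅ := by
        by_contra h
        obtain ⟨y, hy⟩ := Set.nonempty_iff_ne_empty.2 h
        exact hu ((hV u).2 ⟨y, hy.1, hy.2⟩)
      have h2 : lv B' v' u = ∅ := by
        by_contra h
        have h3 := real_pos hS (lv_clopen cB' hv' u) (Set.nonempty_iff_ne_empty.2 h)
        rw [hmeas, h1, measureReal_empty, mul_zero] at h3
        exact lt_irrefl _ h3
      rw [h2]
      ext x
      simp [ind]
  · rw [cfam, ing_sub (lc_add (lc_add (lc0 i) (l1 i)) (hio i).1) (l2 i),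
      ing_add (lc_add (lc0 i) (l1 i)) (hio i).1, ing_add (lc0 i) (l1 i), ic0, (hio i).2,
      ing_sum _ fun u _ => lc_zsmul (le u) _, ing_sum _ fun u _ => lc_zsmul (lio u) _,
      Finset.sum_eq_zero fun u _ => by rw [ing_zsmul, ie, mul_zero],
      Finset.sum_eq_zero fun u _ => by
        rw [ing_zsmul, ing_sum _ fun j _ => lc_zsmul (hio j).1 _,
          Finset.sum_eq_zero fun j _ => by rw [ing_zsmul, (hio j).2, mul_zero], mul_zero]]
    ring
  · filter_upwards [hspl', eventually_ge_atTop (M + r)] with m hm hmM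
    refine cfam_split hkl c0 e io ?_ ?_
    · intro u hu
      obtain ⟨f, h1, h2⟩ := hm u (hV' u hu)
      exact ⟨f, h1, fun w _ => by rw [hsumE, h2]⟩
    · intro i hi
      obtain ⟨f, h1, h2, h3⟩ := hfr m hmM i (hr i hi)
      exact ⟨f, h1, fun j hj => h2 j (hr j hj), fun j hj => h3 _ (hM0 j hj), fun u hu => h3 _ (hMe u hu)⟩

end Family

end

section

/-- A pair of labelled clopen sets whose level sets have measures in ratio `t`, agreeing on `Y`. -/
structure St (G : Type*) {X : Type*} [Group G] [MulAction G X] [TopologicalSpace X] [MeasurableSpace X]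
    (μ : Measure X) (t : ℝ) (b : ℕ → X → X) (Y B : Set X) (v : X → ℕ) (B' : Set X) (v' : X → ℕ) :
    Prop where
  cB : IsClopen B
  cB' : IsClopen B'
  lc : IsLocallyConstant v
  lc' : IsLocallyConstant v'
  memY : ∀ x ∈ Y, (x ∈ B ↔ x ∈ B')
  valY : ∀ x ∈ Y, x ∈ B → v x = v' x
  meas : ∀ k, μ.real (lv B' v' k) = t * μ.real (lv B v k)
  spl : ∀ᶠ m in atTop, Spl (Fn G (b m)) B v
  spl' : ∀ᶠ m in atTop, Spl (Fn G (b m)) B' v'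

/-- One side of a refinement step. -/
structure Side (G : Type*) {X : Type*} [Group G] [MulAction G X] [TopologicalSpace X]
    (b : ℕ → X → X) (B : Set X) (p : X → X) (ℓ : X → ℕ) : Prop where
  pw : PW G p
  off : ∀ x, x ∉ B → p x = x
  mem : ∀ x ∈ B, p x ∈ B
  fib : ∃ n, ∀ x, b n (p x) = b n x
  idem : ∀ x ∈ B, p (p x) = p x
  inj : ∀ x ∈ B, ∀ y ∈ B, p x = p y → ℓ x = ℓ y → x = y

/-- A simultaneous refinement step. -/
structure Stp (G : Type*) {X : Type*} [Group G] [MulAction G X] [TopologicalSpace X]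
    (b : ℕ → X → X) (Y B : Set X) (v : X → ℕ) (B' : Set X) (v' : X → ℕ)
    (p : X → X) (ℓ : X → ℕ) (p' : X → X) (ℓ' : X → ℕ) : Prop where
  side : Side G b B p ℓ
  side' : Side G b B' p' ℓ'
  coarse : ∃ s : ℕ → ℕ, (∀ x ∈ B, s (ℓ x) = v x) ∧ ∀ x ∈ B', s (ℓ' x) = v' x
  shape : ∀ x ∈ B, ∀ x' ∈ B', ℓ (p x) = ℓ' (p' x') → ∀ k,
    (∃ y ∈ B, p y = p x ∧ ℓ y = k) ↔ ∃ y ∈ B', p' y = p' x' ∧ ℓ' y = k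
  root : ∃ τ : ℕ → ℕ, (∀ x ∈ B, ℓ (p x) = τ (ℓ x)) ∧ ∀ x ∈ B', ℓ' (p' x) = τ (ℓ' x)
  onY : ∀ y ∈ Y, y ∈ B → ℓ y = ℓ' y ∧ p y = p' y ∧ p y ∈ Y

section Step

variable {G X : Type*} [CommGroup G] [TopologicalSpace X] [MulAction G X]
  [CompactSpace X] [FreeAct G X] [ContinuousConstSMul G X]
  [T2Space X] [TotallyDisconnectedSpace X]

theorem St.symm [MeasurableSpace X] {μ : Measure X} {t : ℝ} (ht : t ≠ 0) {b : ℕ → X → X}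
    {Y B B' : Set X} {v v' : X → ℕ} (h : St G μ t b Y B v B' v') : St G μ t⁻¹ b Y B' v' B v where
  cB := h.cB'
  cB' := h.cB
  lc := h.lc'
  lc' := h.lc
  memY := fun x hx => (h.memY x hx).symm
  valY := fun x hx hB => (h.valY x hx ((h.memY x hx).2 hB)).symm
  meas := fun k => by rw [h.meas, inv_mul_cancel_left₀ ht]
  spl := h.spl'
  spl' := h.spl

theorem PW.clopen_fix {p : X → X} (hp : PW G p) : IsClopen {x | p x = x} := by
  have := clopen_of_lc (hp.lc_smul_eq 1 1)
  simpa using this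

/-- The retraction of a realised family onto its base floors. -/
theorem exists_retract {b : X → X} (hb : PW G b) {B' : Set X} (cB : IsClopen B') {L : Finset ℕ}
    {τ : ℕ → ℕ} {N : ℕ → X → ℕ} {e : X → (_ : ℕ) × ℕ} (he : IsLocallyConstant e)
    (hτ : ∀ l ∈ L, τ l ∈ L ∧ τ (τ l) = τ l)
    (h1 : ∀ x ∈ B', (e x).1 ∈ L ∧ (e x).2 < N (τ (e x).1) (b x))
    (h2 : ∀ x ∈ B', ∀ y ∈ B', b x = b y → e x = e y → x = y)
    (h3 : ∀ x, ∀ l ∈ L, ∀ j < N (τ l) (b x), ∃ x1 ∈ B', b x1 = b x ∧ e x1 = ⟨l, j⟩) :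
    ∃ p, PW G p ∧ (∀ x, x ∉ B' → p x = x) ∧ (∀ x, b (p x) = b x) ∧
      (∀ x ∈ B', p x ∈ B' ∧ e (p x) = ⟨τ (e x).1, (e x).2⟩) := by
  have hex : ∀ x, ∃ y, (x ∉ B' ∧ y = x ∨ x ∈ B' ∧ y ∈ B' ∧ e y = ⟨τ (e x).1, (e x).2⟩) ∧ b y = b x := by
    intro x
    by_cases hx : x ∈ B'
    · obtain ⟨h4, h5⟩ := h1 x hx
      obtain ⟨h6, h7⟩ := hτ _ h4
      obtain ⟨y, hy, hyb, hye⟩ := h3 x _ h6 (e x).2 (by rw [h7]; exact h5)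
      exact ⟨y, Or.inr ⟨hx, hy, hye⟩, hyb⟩
    · exact ⟨x, Or.inl ⟨hx, rfl⟩, rfl⟩
  choose p hp1 hp2 using hex
  refine ⟨p, ?_, fun x hx => ?_, hp2, fun x hx => ?_⟩
  · refine PW.of_pick hb (Q := fun x y => x ∉ B' ∧ y = x ∨ x ∈ B' ∧ y ∈ B' ∧ e y = ⟨τ (e x).1, (e x).2⟩)
      hp2 hp1 ?_ ?_
    · rintro x y hxy (⟨h4, rfl⟩ | ⟨h4, h5, h6⟩)
      · rcases hp1 y with ⟨-, h⟩ | ⟨h, -⟩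
        · exact h.symm
        · exact absurd h h4
      · rcases hp1 x with ⟨h, -⟩ | ⟨-, h7, h8⟩
        · exact absurd h4 h
        · exact h2 _ h5 _ h7 (hxy.trans (hp2 x).symm) (h6.trans h8.symm)
    · rintro x g - (⟨h4, h5⟩ | ⟨h4, h5, h6⟩)
      · have hg : g = 1 := smul_inj.1 (h5.trans (one_smul G x).symm)
        subst hg
        filter_upwards [cB.compl.isOpen.mem_nhds h4] with y hy
        exact Or.inl ⟨hy, one_smul G y⟩
      · filter_upwards [cB.isOpen.mem_nhds h4, (clopen_smul_pre cB g).isOpen.mem_nhds h5,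
          lc_ev he x, lc_ev (lc_smul he g) x] with y q1 q2 q3 q4
        exact Or.inr ⟨q1, q2, by rw [q3, q4, h6]⟩
  · rcases hp1 x with ⟨-, h⟩ | ⟨h, -⟩
    · exact h
    · exact absurd h hx
  · rcases hp1 x with ⟨h, -⟩ | ⟨-, h4, h5⟩
    · exact absurd hx h
    · exact ⟨h4, h5⟩

variable [MeasurableSpace X] [BorelSpace X] {μ : Measure X}
  [IsProbabilityMeasure μ] [SMulInvariantMeasure G X μ]
  {K : Finset G} {b : ℕ → X → X} {π : ℕ → X → ℕ} {C : ℕ → Set X}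

theorem Tower.sat_Y (hT : Tower μ K b π C) {n : ℕ} {x y : X} (hx : x ∈ ⋂ n, C n) (hy : y ∈ C n)
    (h : b n x = b n y) : y ∈ ⋂ n, C n := by
  rw [Set.mem_iInter] at hx ⊢
  have h1 : ∀ m, n ≤ m → y ∈ C m := by
    intro m hm
    induction m, hm using Nat.le_induction with
    | base => exact hy
    | succ m hm ih => exact (hT.nxt m).sat x (hx (m + 1)) y ih (hT.ker_mono hm h)
  intro m
  rcases le_total n m with hm | hm
  · exact h1 m hm
  · exact hT.C_anti hm hy

theorem sig_lv_lab {b : X → X} (hb : PW G b) {π : X → ℕ} (hπ : Lab b π) (B : Set X) (l : ℕ) (z : X) :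
    sig G b (ind (lv B π l)) z = if ∃ x ∈ B, b x = z ∧ π x = l then 1 else 0 := by
  rw [sig_ind]
  split_ifs with h
  · obtain ⟨x, hx, hxz, hxl⟩ := h
    have : (fib G b z).filter (· ∈ lv B π l) = {x} := by
      ext y
      rw [Finset.mem_filter, mem_fib hb, Finset.mem_singleton]
      constructor
      · rintro ⟨h1, h2, h3⟩
        exact hπ.inj _ _ (h1.trans hxz.symm) (h3.trans hxl.symm)
      · rintro rfl
        exact ⟨hxz, hx, hxl⟩
    rw [this]; rfl
  · have : (fib G b z).filter (· ∈ lv B π l) = ∅ := by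
      ext y
      rw [Finset.mem_filter, mem_fib hb]
      simp only [Finset.notMem_empty, iff_false]
      rintro ⟨h1, h2, h3⟩
      exact h ⟨y, h2, h1, h3⟩
    rw [this]; rfl

end Step

end

section

section Step

variable {G X : Type*} [CommGroup G] [TopologicalSpace X] [MulAction G X]
  [CompactSpace X] [FreeAct G X] [ContinuousConstSMul G X]
  [T2Space X] [TotallyDisconnectedSpace X]
  [MeasurableSpace X] [BorelSpace X] {μ : Measure X}
  [IsProbabilityMeasure μ] [SMulInvariantMeasure G X μ]
  {K : Finset G} {b : ℕ → X → X} {π : ℕ → X → ℕ} {C : ℕ → Set X}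

theorem ing_pos_ev (hT : Tower μ K b π C) {f : X → ℤ} (hf : IsLocallyConstant f) (hp : 0 < ing μ f) :
    ∀ᶠ m in atTop, ∀ x, (((fib G (b m) (b m x)).filter (fun y => y ∈ C m)).card : ℤ) ≤ sig G (b m) f (b m x) := by
  obtain ⟨M, hM⟩ := hT.meas _ hp
  have hc := (hT.lev M).clo
  obtain ⟨n, hn⟩ := hT.pos (f - ind (C M)) (lc_sub hf (lc_ind hc)) (by
    rw [ing_sub hf (lc_ind hc), ing_ind hc]; linarith)
  filter_upwards [eventually_ge_atTop n, eventually_ge_atTop M] with m hm hmM x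
  have h1 := hn m hm x
  have h2 : sig G (b m) (f - ind (C M)) (b m x) = sig G (b m) f (b m x) - sig G (b m) (ind (C M)) (b m x) :=
    map_sub (sgH G (b m) (b m x)) f (ind (C M))
  have h3 : (((fib G (b m) (b m x)).filter (fun y => y ∈ C m)).card : ℤ) ≤ sig G (b m) (ind (C M)) (b m x) := by
    rw [sig_ind]
    have : (fib G (b m) (b m x)).filter (fun y => y ∈ C m) ⊆ (fib G (b m) (b m x)).filter (fun y => y ∈ C M) := by
      intro y hy
      rw [Finset.mem_filter] at hy ⊢
      exact ⟨hy.1, hT.C_anti hmM hy.2⟩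
    exact_mod_cast Finset.card_le_card this
  omega

theorem sig_lv_retract {b : X → X} (hb : PW G b) {B' : Set X} {L : Finset ℕ}
    {τ : ℕ → ℕ} {c : ℕ → X → ℤ} {e : X → (_ : ℕ) × ℕ}
    (h1 : ∀ x ∈ B', (e x).1 ∈ L ∧ (e x).2 < (sig G b (c (τ (e x).1)) (b x)).toNat)
    (h2 : ∀ x ∈ B', ∀ y ∈ B', b x = b y → e x = e y → x = y)
    (h3 : ∀ x, ∀ l ∈ L, ∀ j < (sig G b (c (τ l)) (b x)).toNat, ∃ x1 ∈ B', b x1 = b x ∧ e x1 = ⟨l, j⟩)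
    {k : ℕ} (hk : k ∈ L) (hτk : τ k = k) (hnn : ∀ x, 0 ≤ sig G b (c k) (b x)) (z : X) :
    sig G b (ind (lv B' (fun x => (e x).1) k)) z = sig G b (c k) z := by
  by_cases hz : ∃ x, b x = z
  · obtain ⟨x, rfl⟩ := hz
    rw [sig_ind]
    have : ((fib G b (b x)).filter (· ∈ lv B' (fun x => (e x).1) k)).card =
        (Finset.range (sig G b (c k) (b x)).toNat).card := by
      refine Finset.card_bij (fun y _ => (e y).2) ?_ ?_ ?_
      · intro y hy
        rw [Finset.mem_filter, mem_fib hb] at hy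
        obtain ⟨h4, h5, h6⟩ := hy
        have h7 := (h1 y h5).2
        have h6' : (e y).1 = k := h6
        rw [h6', hτk, h4] at h7
        exact Finset.mem_range.2 h7
      · intro y hy y' hy' h
        rw [Finset.mem_filter, mem_fib hb] at hy hy'
        exact h2 _ hy.2.1 _ hy'.2.1 (hy.1.trans hy'.1.symm)
          (Sigma.ext (hy.2.2.trans hy'.2.2.symm) (heq_of_eq h))
      · intro j hj
        rw [Finset.mem_range] at hj
        obtain ⟨x1, h4, h5, h6⟩ := h3 x k hk j (by rw [hτk]; exact hj)
        refine ⟨x1, ?_, by rw [h6]⟩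
        rw [Finset.mem_filter, mem_fib hb]
        refine ⟨h5, h4, ?_⟩
        show (e x1).1 = k
        rw [h6]
    rw [this, Finset.card_range, Int.toNat_of_nonneg (hnn x)]
  · have h0 : fib G b z = ∅ := by
      ext y
      rw [mem_fib hb]
      simp only [Finset.notMem_empty, iff_false]
      exact fun h => hz ⟨y, h⟩
    rw [sig, sig, h0, Finset.sum_empty, Finset.sum_empty]

set_option maxHeartbeats 2000000 in
theorem exists_step (hS : Sys G μ) (hT : Tower μ K b π C) {t : ℝ} (ht : 0 < t)
    (hE : ∀ f : X → ℤ, IsLocallyConstant f → ∃ g, IsLocallyConstant g ∧ ing μ g = t * ing μ f)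
    {B B' : Set X} {v v' : X → ℕ} (hst : St G μ t b (⋂ n, C n) B v B' v')
    {α : Type*} {Q : X → α} (hQ : IsLocallyConstant Q) (N : ℕ) :
    ∃ n p ℓ p' ℓ', N ≤ n ∧ Stp G b (⋂ n, C n) B v B' v' p ℓ p' ℓ' ∧
      St G μ t b (⋂ n, C n) {x | x ∈ B ∧ p x = x} ℓ {x | x ∈ B' ∧ p' x = x} ℓ' ∧
      (∀ x ∈ B, ∀ y ∈ B, b n x = b n y → p x = p y) ∧ Ref ℓ Q := by
  obtain ⟨n, hnN, hnB, hnv, hnQ, hnS⟩ := ((eventually_ge_atTop N).and ((hT.ev_ref (lc_mem hst.cB)).and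
    ((hT.ev_ref hst.lc).and ((hT.ev_ref hQ).and hst.spl)))).exists
  have hlab := (hT.lev n).lab
  have hpw := (hT.lev n).pw
  obtain ⟨p, τ, hp, hbase⟩ := exists_base (hT.lev n) hnB
  obtain ⟨s, hs⟩ := hnv.factor_nat
  have hfin : ((π n) '' B).Finite := hlab.lc.range_finite.subset (Set.image_subset_range _ _)
  set L := hfin.toFinset with hL
  have mL : ∀ l, l ∈ L ↔ ∃ x ∈ B, π n x = l := fun l => by rw [hL, Set.Finite.mem_toFinset]; rfl
  have mLB : ∀ x ∈ B, π n x ∈ L := fun x hx => (mL _).2 ⟨x, hx, rfl⟩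
  have hτ : ∀ l ∈ L, τ l ∈ L ∧ τ (τ l) = τ l := by
    intro l hl
    obtain ⟨x, hx, rfl⟩ := (mL l).1 hl
    exact ⟨(mL _).2 ⟨p x, hbase.mem x hx, hbase.lab x hx⟩, hbase.idem x hx⟩
  have cF : ∀ i, IsClopen (lv B (π n) i) := lv_clopen hst.cB hlab.lc
  have hF : ∀ l ∈ L, ∀ z, sig G (b n) (ind (lv B (π n) l)) z = sig G (b n) (ind (lv B (π n) (τ l))) z := by
    intro l hl z
    rw [sig_lv_lab hpw hlab, sig_lv_lab hpw hlab]
    have : (∃ x ∈ B, b n x = z ∧ π n x = l) ↔ ∃ x ∈ B, b n x = z ∧ π n x = τ l := by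
      constructor
      · rintro ⟨x, hx, h1, rfl⟩
        exact ⟨p x, hbase.mem x hx, (hbase.fibre x).trans h1, hbase.lab x hx⟩
      · rintro ⟨x, hx, h1, h2⟩
        obtain ⟨y, hy, rfl⟩ := (mL l).1 hl
        obtain ⟨x1, h3, h4, h5⟩ := hbase.shape x hx y hy (by rw [h2, hbase.idem y hy])
        exact ⟨x1, h3, h4.trans h1, h5⟩
    simp only [this]
  have hsum : ∀ u, ind (lv B v u) = ∑ l ∈ L.filter (fun l => s l = u), ind (lv B (π n) l) := by
    intro u
    ext x
    rw [Finset.sum_apply]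
    by_cases hx : x ∈ lv B v u
    · rw [Finset.sum_eq_single (π n x)]
      · have : x ∈ lv B (π n) (π n x) := ⟨hx.1, rfl⟩
        simp only [ind, if_pos hx, if_pos this]
      · intro l _ hl
        have : x ∉ lv B (π n) l := fun h => hl h.2.symm
        simp only [ind, if_neg this]
      · intro h
        have h1 : s (π n x) = u := (hs x).trans hx.2
        exact absurd (Finset.mem_filter.2 ⟨mLB x hx.1, h1⟩) h
    · rw [Finset.sum_eq_zero]
      · simp only [ind, if_neg hx]
      · intro l hl
        have : x ∉ lv B (π n) l := by
          rintro ⟨h1, rfl⟩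
          exact hx ⟨h1, (hs x).symm.trans (Finset.mem_filter.1 hl).2⟩
        simp only [ind, if_neg this]
  have hV : ∀ u, u ∈ L.image s ↔ u ∈ v '' B := by
    intro u
    rw [Finset.mem_image]
    constructor
    · rintro ⟨l, hl, rfl⟩
      obtain ⟨x, hx, rfl⟩ := (mL l).1 hl
      exact ⟨x, hx, (hs x).symm⟩
    · rintro ⟨x, hx, rfl⟩
      exact ⟨π n x, mLB x hx, hs x⟩
  obtain ⟨c, lc, hcs, hci, hcf⟩ := exists_family hS hT ht hE cF hst.cB hst.lc hst.cB' hst.lc' hF hsum hV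
    hst.meas hnS hst.spl'
  have hFpos : ∀ i ∈ L.image τ, 0 < ing μ (c i) := by
    intro i hi
    obtain ⟨l, hl, rfl⟩ := Finset.mem_image.1 hi
    obtain ⟨y, hy, hy2⟩ := (mL _).1 (hτ l hl).1
    rw [hci, ing_ind (cF _)]
    exact mul_pos ht (real_pos hS (cF _) ⟨y, hy, hy2⟩)
  have hevlow := (Filter.eventually_all_finset (L.image τ)).2 fun i hi => ing_pos_ev hT (lc i) (hFpos i hi)
  obtain ⟨m, hnm, hmf, hlow⟩ := ((eventually_ge_atTop n).and (hcf.and hevlow)).exists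
  have hmpw := (hT.lev m).pw
  have hlow' : ∀ x, ∀ l ∈ L, (((fib G (b m) (b m x)).filter (fun y => y ∈ C m)).card : ℤ)
      ≤ sig G (b m) (c (τ l)) (b m x) := fun x l hl => hlow _ (Finset.mem_image_of_mem τ hl) x
  have hYcl : IsClosed (⋂ n, C n) := isClosed_iInter fun n => (hT.lev n).clo.isClosed
  have pY : ∀ y ∈ ⋂ n, C n, y ∈ B → p y ∈ ⋂ n, C n := fun y hy hyB =>
    hT.sat_Y hy (hbase.memC y hyB (Set.mem_iInter.1 hy n)) (hbase.fibre y).symm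
  obtain ⟨e, le, he1, he2, he3, he4⟩ := realize (b := b m) hmpw (B' := B') (Y := ⋂ n, C n) (C := C m)
    (v' := v') (ℓ := π n) (p := p) (L := L) (s := s) (τ := τ) (c := c) hst.cB' hst.lc' hlab.lc hp
    (fun l _ => lc _) hYcl (Set.iInter_subset _ _) (by
      intro u z
      rw [← hcs u]
      exact map_sum (sgH G (b m) z) _ _) hlow' (by
      intro y hy hyB'
      have hyB := (hst.memY y hy).2 hyB'
      have h1 := pY y hy hyB
      refine ⟨mLB y hyB, (hs y).trans (hst.valY y hy hyB), h1, (hst.memY _ h1).1 (hbase.mem y hyB),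
        hT.ker_mono hnm (hbase.fibre y), ?_, hbase.lab y hyB⟩
      exact hbase.ker _ (hbase.mem y hyB) _ hyB (hbase.fibre y)) (by
      intro y hy hyB y' hy' hyB' h1 h2
      exact hlab.inj _ _ (by rw [← hbase.fibre y, h2, hbase.fibre]) h1)
  have he1' : ∀ x ∈ B', (e x).1 ∈ L ∧ (e x).2 < (sig G (b m) (c (τ (e x).1)) (b m x)).toNat :=
    fun x hx => ⟨(he1 x hx).1, (he1 x hx).2.1⟩
  obtain ⟨p', hp', hoff', hfib', hmem'⟩ := exists_retract hmpw hst.cB' (N := fun l z => (sig G (b m) (c l) z).toNat)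
    le hτ he1' he2 he3
  have hidem : ∀ x ∈ B, p (p x) = p x := fun x hx =>
    hbase.ker _ (hbase.mem x hx) _ hx (hbase.fibre x)
  have hkey' : ∀ x ∈ B', ∀ y ∈ B', b m x = b m y → (e (p' x)) = e (p' y) → p' x = p' y := fun x hx y hy h1 h2 =>
    he2 _ (hmem' x hx).1 _ (hmem' y hy).1 (by rw [hfib', hfib', h1]) h2
  have hfixB : ∀ x ∈ B, ∀ y ∈ B, π n x = τ (π n y) → p x = x := by
    intro x hx y hy h
    refine hlab.inj _ _ (hbase.fibre x) ?_
    rw [hbase.lab x hx, h, hbase.idem y hy]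
  have hfixB' : ∀ x ∈ B', ∀ l ∈ L, (e x).1 = τ l → p' x = x := by
    intro x hx l hl h
    refine he2 _ (hmem' x hx).1 _ hx (hfib' x) ?_
    rw [(hmem' x hx).2, h, (hτ l hl).2, ← h]
  have hlvB : ∀ l ∈ L, lv {x | x ∈ B ∧ p x = x} (π n) (τ l) = lv B (π n) (τ l) := by
    intro l hl
    obtain ⟨y, hy, rfl⟩ := (mL l).1 hl
    ext x
    exact ⟨fun h => ⟨h.1.1, h.2⟩, fun h => ⟨⟨h.1, hfixB x h.1 y hy h.2⟩, h.2⟩⟩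
  have hlvB' : ∀ l ∈ L, lv {x | x ∈ B' ∧ p' x = x} (fun x => (e x).1) (τ l) = lv B' (fun x => (e x).1) (τ l) := by
    intro l hl
    ext x
    exact ⟨fun h => ⟨h.1.1, h.2⟩, fun h => ⟨⟨h.1, hfixB' x h.1 l hl h.2⟩, h.2⟩⟩
  have hlv0 : ∀ k, k ∉ L.image τ → lv {x | x ∈ B ∧ p x = x} (π n) k = ∅ := by
    intro k hk
    ext x
    simp only [Set.mem_empty_iff_false, iff_false]
    rintro ⟨⟨h1, h2⟩, rfl⟩
    refine hk (Finset.mem_image.2 ⟨π n x, mLB x h1, ?_⟩)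
    rw [← hbase.lab x h1, h2]
  have hlv0' : ∀ k, k ∉ L.image τ → lv {x | x ∈ B' ∧ p' x = x} (fun x => (e x).1) k = ∅ := by
    intro k hk
    ext x
    simp only [Set.mem_empty_iff_false, iff_false]
    rintro ⟨⟨h1, h2⟩, h3⟩
    refine hk (Finset.mem_image.2 ⟨(e x).1, (he1 x h1).1, ?_⟩)
    have h4 := (hmem' x h1).2
    rw [h2] at h4
    have h5 : (e x).1 = τ (e x).1 := congrArg Sigma.fst h4
    rw [← h5]
    exact h3
  have lℓ' : IsLocallyConstant (fun x => (e x).1) := le.comp (fun q => q.1)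
  have hsig' : ∀ l ∈ L, ∀ z, sig G (b m) (ind (lv B' (fun x => (e x).1) (τ l))) z = sig G (b m) (c (τ l)) z := by
    intro l hl z
    exact sig_lv_retract hmpw he1' he2 he3 (hτ l hl).1 (hτ l hl).2
      (fun x => le_trans (Int.natCast_nonneg _) (hlow' x l hl)) z
  have cB1 : IsClopen {x | x ∈ B ∧ p x = x} := hst.cB.inter hp.clopen_fix
  have cB1' : IsClopen {x | x ∈ B' ∧ p' x = x} := hst.cB'.inter hp'.clopen_fix
  have honY : ∀ y ∈ ⋂ n, C n, y ∈ B → π n y = (e y).1 ∧ p y = p' y ∧ p y ∈ ⋂ n, C n := by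
    intro y hy hyB
    have hyB' := (hst.memY y hy).1 hyB
    obtain ⟨h1, h2⟩ := he4 y hy hyB'
    have h3 := pY y hy hyB
    refine ⟨h1.symm, ?_, h3⟩
    refine he2 _ ((hst.memY _ h3).1 (hbase.mem y hyB)) _ (hmem' y hyB').1 ?_ ?_
    · rw [hfib', hT.ker_mono hnm (hbase.fibre y)]
    · rw [h2, (hmem' y hyB').2, h1]
  refine ⟨n, p, π n, p', fun x => (e x).1, hnN, ?_, ?_, hbase.ker, hnQ⟩
  · refine ⟨⟨hp, hbase.off, hbase.mem, ⟨n, hbase.fibre⟩, hidem, ?_⟩,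
      ⟨hp', hoff', fun x hx => (hmem' x hx).1, ⟨m, hfib'⟩, ?_, ?_⟩, ⟨s, fun x _ => hs x, fun x hx => (he1 x hx).2.2⟩,
      ?_, ⟨τ, hbase.lab, fun x hx => by rw [(hmem' x hx).2]⟩, honY⟩
    · intro x _ y _ h1 h2
      exact hlab.inj _ _ (by rw [← hbase.fibre x, h1, hbase.fibre]) h2
    · intro x hx
      have h1 := (hmem' x hx).1
      refine hkey' _ h1 _ hx (hfib' x) ?_
      rw [(hmem' _ h1).2, (hmem' x hx).2, (hτ _ (he1 x hx).1).2]
    · intro x hx y hy h1 h2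
      refine he2 _ hx _ hy (by rw [← hfib' x, h1, hfib']) (Sigma.ext h2 (heq_of_eq ?_))
      have h3 := (hmem' x hx).2
      rw [h1, (hmem' y hy).2] at h3
      exact (congrArg Sigma.snd h3).symm
    · intro x hx x' hx' h k
      have hi : τ (π n x) = τ (e x').1 := by
        rw [← hbase.lab x hx, h, (hmem' x' hx').2]
      constructor
      · rintro ⟨y, hy, h1, rfl⟩
        have h2 : τ (π n y) = τ (e x').1 := by rw [← hi, ← hbase.lab y hy, ← hbase.lab x hx, h1]
        obtain ⟨y', h3, h4, h5⟩ := he3 x' (π n y) (mLB y hy) (e x').2 (by rw [h2]; exact (he1' x' hx').2)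
        refine ⟨y', h3, hkey' _ h3 _ hx' h4 ?_, by rw [h5]⟩
        rw [(hmem' y' h3).2, (hmem' x' hx').2, h5, h2]
      · rintro ⟨y', hy', h1, h2⟩
        obtain ⟨w, hw, h3⟩ := (mL k).1 (h2 ▸ (he1 y' hy').1)
        have h4 : τ (e y').1 = τ (e x').1 := by
          have := (hmem' y' hy').2
          rw [h1, (hmem' x' hx').2] at this
          exact (congrArg Sigma.fst this).symm
        have h2' : (e y').1 = k := h2
        obtain ⟨x1, h5, h6, h7⟩ := hbase.shape x hx w hw (by rw [h3, ← h2', h4, hi])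
        exact ⟨x1, h5, hbase.ker _ h5 _ hx h6, h7.trans h3⟩
  · refine ⟨cB1, cB1', hlab.lc, lℓ', ?_, fun x hx hxB => (honY x hx hxB.1).1, ?_, ?_, ?_⟩
    · intro x hx
      constructor
      · rintro ⟨h1, h2⟩
        exact ⟨(hst.memY x hx).1 h1, by rw [← (honY x hx h1).2.1, h2]⟩
      · rintro ⟨h1, h2⟩
        have h3 := (hst.memY x hx).2 h1
        exact ⟨h3, by rw [(honY x hx h3).2.1, h2]⟩
    · intro k
      by_cases hk : k ∈ L.image τ
      · obtain ⟨l, hl, rfl⟩ := Finset.mem_image.1 hk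
        have c1 := lv_clopen hst.cB' lℓ' (τ l)
        rw [hlvB l hl, hlvB' l hl, ← ing_ind (cF _), ← hci, ← ing_ind c1, ← ing_sig hmpw (lc_ind c1),
          ← ing_sig hmpw (lc (τ l)), funext (hsig' l hl)]
      · rw [hlv0 k hk, hlv0' k hk, measureReal_empty, mul_zero]
    · have hsp : Spl (Fn G (b n)) {x | x ∈ B ∧ p x = x} (π n) := by
        rintro _ ⟨x, ⟨hx, hpx⟩, rfl⟩
        refine ⟨sgH G (b n) (b n x), sgH_mem _ _, fun j => ?_⟩
        refine (sig_lv_lab hpw hlab _ j _).trans ?_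
        congr 1
        rw [eq_iff_iff]
        constructor
        · rintro ⟨y, ⟨h1, h2⟩, h3, rfl⟩
          rw [← h2, hbase.ker y h1 x hx h3, hpx]
        · rintro rfl
          exact ⟨x, ⟨hx, hpx⟩, rfl, rfl⟩
      filter_upwards [eventually_ge_atTop n] with q hq
      refine hT.spl_mono hq ?_ (fun _ _ h => h) hsp
      have hmono : ∀ x y, π n x = π n y → (x ∈ B ∧ p x = x) → (y ∈ B ∧ p y = y) := by
        rintro x y hxy ⟨h1, h2⟩
        have h3 : y ∈ B := (eq_iff_iff.1 (hnB x y hxy)).1 h1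
        exact ⟨h3, hfixB y h3 x h1 (by rw [← hxy, ← hbase.lab x h1, h2])⟩
      intro x y hxy
      exact propext ⟨hmono x y hxy, hmono y x hxy.symm⟩
    · filter_upwards [hcf, eventually_ge_atTop m] with q hq hmq
      rintro _ ⟨x, ⟨hx, hpx⟩, rfl⟩
      have hk : (e x).1 ∈ L.image τ := by
        by_contra h
        have := hlv0' _ h
        exact (Set.ext_iff.1 this x).1 ⟨⟨hx, hpx⟩, rfl⟩
      obtain ⟨f, hf, hfc⟩ := hq _ hk
      refine ⟨f, hf, fun j => ?_⟩
      by_cases hj : j ∈ L.image τ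
      · obtain ⟨l, hl, rfl⟩ := Finset.mem_image.1 hj
        rw [hlvB' l hl, hT.Fn_sig hmq (hsig' l hl) hf, hfc _ hj]
      · rw [hlv0' j hj]
        have h0 : ind (∅ : Set X) = 0 := by ext x; simp [ind]
        rw [h0, map_zero, if_neg]
        rintro rfl
        exact hj hk

end Step

end

section

/-- The data of a finite stage of the construction of an orbit equivalence. -/
structure CSt (X : Type*) where
  B : Set X
  B' : Set X
  v : X → ℕ
  v' : X → ℕ
  P : X → X
  P' : X → X
  cd : X → ℕ
  cd' : X → ℕ

/-- Exchange of the two sides. -/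
def CSt.swap {X : Type*} (σ : CSt X) : CSt X := ⟨σ.B', σ.B, σ.v', σ.v, σ.P', σ.P, σ.cd', σ.cd⟩

/-- The invariants of a finite stage. -/
structure Inv (G : Type*) {X : Type*} [Group G] [MulAction G X] [TopologicalSpace X] [MeasurableSpace X]
    (μ : Measure X) (t : ℝ) (b : ℕ → X → X) (Y U U' : Set X) (σ : CSt X) : Prop where
  st : St G μ t b Y σ.B σ.v σ.B' σ.v'
  pw : PW G σ.P
  pw' : PW G σ.P'
  lcd : IsLocallyConstant σ.cd
  lcd' : IsLocallyConstant σ.cd'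
  maps : ∀ x ∈ U, σ.P x ∈ σ.B
  maps' : ∀ x ∈ U', σ.P' x ∈ σ.B'
  fix : ∀ x ∈ σ.B, x ∈ U ∧ σ.P x = x
  fix' : ∀ x ∈ σ.B', x ∈ U' ∧ σ.P' x = x
  fib : ∃ n, ∀ x ∈ U, b n (σ.P x) = b n x
  fib' : ∃ n, ∀ x ∈ U', b n (σ.P' x) = b n x
  inj : ∀ x ∈ U, ∀ y ∈ U, σ.P x = σ.P y → σ.cd x = σ.cd y → x = y
  inj' : ∀ x ∈ U', ∀ y ∈ U', σ.P' x = σ.P' y → σ.cd' x = σ.cd' y → x = y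
  shape : ∀ x ∈ U, ∀ x' ∈ U', σ.v (σ.P x) = σ.v' (σ.P' x') → ∀ k,
    (∃ y ∈ U, σ.P y = σ.P x ∧ σ.cd y = k) ↔ ∃ y ∈ U', σ.P' y = σ.P' x' ∧ σ.cd' y = k
  root : ∃ ρ : ℕ → ℕ, (∀ x ∈ U, σ.v (σ.P x) = ρ (σ.cd x)) ∧ ∀ x ∈ U', σ.v' (σ.P' x) = ρ (σ.cd' x)
  onY : ∀ y ∈ Y, y ∈ U → σ.cd y = σ.cd' y ∧ σ.P y = σ.P' y ∧ σ.P y ∈ Y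

/-- The side independent part of the passage from a stage to a later one. -/
structure Dev {X : Type*} (σ σ2 : CSt X) : Prop where
  mono : ∀ x y, σ.P x = σ.P y → σ2.P x = σ2.P y
  mono' : ∀ x y, σ.P' x = σ.P' y → σ2.P' x = σ2.P' y
  dec : ∃ d : ℕ → ℕ, (∀ x, σ.cd x = d (σ2.cd x)) ∧ ∀ x, σ.cd' x = d (σ2.cd' x)
  prop : ∀ x y x' y', σ.P x = σ.P y → σ.P' x' = σ.P' y' → σ2.cd x = σ2.cd' x' → σ.cd y = σ.cd' y' →
    σ2.cd y = σ2.cd' y'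

/-- The stage `σ` decides level `N` on the first side. -/
structure Dcd {X : Type*} (b : ℕ → X → X) (π : ℕ → X → ℕ) (N : ℕ) (U : Set X) (σ : CSt X) : Prop where
  lab : ∀ x ∈ U, ∀ y ∈ U, σ.cd x = σ.cd y → π N x = π N y
  ker : ∀ x ∈ U, ∀ y ∈ U, b N x = b N y → σ.P x = σ.P y

theorem Dev.swap {X : Type*} {σ σ2 : CSt X} (h : Dev σ σ2) : Dev σ.swap σ2.swap where
  mono := h.mono'
  mono' := h.mono
  dec := by obtain ⟨d, h1, h2⟩ := h.dec; exact ⟨d, h2, h1⟩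
  prop := fun x y x' y' h1 h2 h3 h4 => (h.prop x' y' x y h2 h1 h3.symm h4.symm).symm

theorem Dev.trans {X : Type*} {σ σ1 σ2 : CSt X} (h : Dev σ σ1) (h' : Dev σ1 σ2) : Dev σ σ2 where
  mono := fun x y hxy => h'.mono x y (h.mono x y hxy)
  mono' := fun x y hxy => h'.mono' x y (h.mono' x y hxy)
  dec := by
    obtain ⟨d, h1, h2⟩ := h.dec
    obtain ⟨d', h3, h4⟩ := h'.dec
    exact ⟨fun k => d (d' k), fun x => by rw [h1, h3], fun x => by rw [h2, h4]⟩
  prop := fun x y x' y' h1 h2 h3 h4 => by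
    obtain ⟨d, h5, h6⟩ := h'.dec
    exact h'.prop x y x' y' (h.mono _ _ h1) (h.mono' _ _ h2) h3
      (h.prop x y x' y' h1 h2 (by rw [h5, h6, h3]) h4)

theorem Dev.refl {X : Type*} (σ : CSt X) : Dev σ σ :=
  ⟨fun _ _ h => h, fun _ _ h => h, ⟨id, fun _ => rfl, fun _ => rfl⟩, fun _ _ _ _ _ _ _ h => h⟩

theorem Dcd.mono {X : Type*} {b : ℕ → X → X} {π : ℕ → X → ℕ} {N : ℕ} {U : Set X} {σ σ2 : CSt X}
    (h : Dcd b π N U σ) (h' : Dev σ σ2) : Dcd b π N U σ2 where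
  lab := fun x hx y hy hxy => by
    obtain ⟨d, h1, -⟩ := h'.dec
    exact h.lab x hx y hy (by rw [h1, h1, hxy])
  ker := fun x hx y hy hxy => h'.mono _ _ (h.ker x hx y hy hxy)

section Recursion

variable {G X : Type*} [CommGroup G] [TopologicalSpace X] [MulAction G X]
  [CompactSpace X] [FreeAct G X] [ContinuousConstSMul G X]
  [T2Space X] [TotallyDisconnectedSpace X]

theorem lc_fib_image {b : X → X} (hb : PW G b) {α : Type*} [DecidableEq α] {f : X → α} (hf : IsLocallyConstant f) :
    IsLocallyConstant (fun z => (fib G b z).image f) := by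
  have h : ∀ z, (fib G b z).image f = (Phi G b z).image fun g => f (g • z) := fun z => by
    rw [fib, Finset.image_image]; rfl
  apply lc_of_ev
  intro z
  filter_upwards [lc_ev (lc_Phi hb) z, lc_finite_forall (Phi G b z) (f := fun g z => f (g • z))
    (fun g _ => lc_smul hf g) z] with y h1 h2
  rw [h, h, h1]
  exact Finset.image_congr fun g hg => h2 g hg

variable [MeasurableSpace X] [BorelSpace X] {μ : Measure X}
  [IsProbabilityMeasure μ] [SMulInvariantMeasure G X μ]
  {K : Finset G} {b : ℕ → X → X} {π : ℕ → X → ℕ} {C : ℕ → Set X} {t : ℝ} {Y U U' : Set X}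

theorem Inv.swap (ht : t ≠ 0) (hU : ∀ x ∈ Y, (x ∈ U ↔ x ∈ U')) {σ : CSt X} (h : Inv G μ t b Y U U' σ) :
    Inv G μ t⁻¹ b Y U' U σ.swap where
  st := h.st.symm ht
  pw := h.pw'
  pw' := h.pw
  lcd := h.lcd'
  lcd' := h.lcd
  maps := h.maps'
  maps' := h.maps
  fix := h.fix'
  fix' := h.fix
  fib := h.fib'
  fib' := h.fib
  inj := h.inj'
  inj' := h.inj
  shape := fun x hx x' hx' e k => (h.shape x' hx' x hx e.symm k).symm
  root := by obtain ⟨s, h1, h2⟩ := h.root; exact ⟨s, h2, h1⟩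
  onY := fun y hy hB => by
    obtain ⟨h1, h2, h3⟩ := h.onY y hy ((hU y hy).2 hB)
    exact ⟨h1.symm, h2.symm, by show σ.P' y ∈ Y; rw [← h2]; exact h3⟩

theorem Inv.next (hker : ∀ n m, n ≤ m → ∀ x y, b n x = b n y → b m x = b m y)
    {σ : CSt X} (h : Inv G μ t b Y U U' σ)
    {p p' : X → X} {ℓ ℓ' : X → ℕ} (hs : Stp G b Y σ.B σ.v σ.B' σ.v' p ℓ p' ℓ')
    (hst : St G μ t b Y {x | x ∈ σ.B ∧ p x = x} ℓ {x | x ∈ σ.B' ∧ p' x = x} ℓ') :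
    Inv G μ t b Y U U' ⟨{x | x ∈ σ.B ∧ p x = x}, {x | x ∈ σ.B' ∧ p' x = x}, ℓ, ℓ', p ∘ σ.P, p' ∘ σ.P',
      fun x => Nat.pair (σ.cd x) (ℓ (σ.P x)), fun x => Nat.pair (σ.cd' x) (ℓ' (σ.P' x))⟩ := by
  refine ⟨hst, hs.side.pw.comp h.pw, hs.side'.pw.comp h.pw', lc_comp2 Nat.pair h.lcd (h.pw.lc_comp hst.lc),
    lc_comp2 Nat.pair h.lcd' (h.pw'.lc_comp hst.lc'), ?_, ?_, ?_, ?_, ?_, ?_, ?_, ?_, ?_, ?_, ?_⟩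
  · exact fun x hx => ⟨hs.side.mem _ (h.maps x hx), hs.side.idem _ (h.maps x hx)⟩
  · exact fun x hx => ⟨hs.side'.mem _ (h.maps' x hx), hs.side'.idem _ (h.maps' x hx)⟩
  · rintro x ⟨h1, h2⟩
    refine ⟨(h.fix x h1).1, ?_⟩
    show p (σ.P x) = x
    rw [(h.fix x h1).2, h2]
  · rintro x ⟨h1, h2⟩
    refine ⟨(h.fix' x h1).1, ?_⟩
    show p' (σ.P' x) = x
    rw [(h.fix' x h1).2, h2]
  · obtain ⟨n, hn⟩ := h.fib
    obtain ⟨m, hm⟩ := hs.side.fib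
    exact ⟨max n m, fun x hx => (hker m _ (le_max_right _ _) _ _ (hm _)).trans
      (hker n _ (le_max_left _ _) _ _ (hn x hx))⟩
  · obtain ⟨n, hn⟩ := h.fib'
    obtain ⟨m, hm⟩ := hs.side'.fib
    exact ⟨max n m, fun x hx => (hker m _ (le_max_right _ _) _ _ (hm _)).trans
      (hker n _ (le_max_left _ _) _ _ (hn x hx))⟩
  · intro x hx y hy h1 h2
    obtain ⟨h3, h4⟩ := Nat.pair_eq_pair.1 h2
    exact h.inj x hx y hy (hs.side.inj _ (h.maps x hx) _ (h.maps y hy) h1 h4) h3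
  · intro x hx y hy h1 h2
    obtain ⟨h3, h4⟩ := Nat.pair_eq_pair.1 h2
    exact h.inj' x hx y hy (hs.side'.inj _ (h.maps' x hx) _ (h.maps' y hy) h1 h4) h3
  · intro x hx x' hx' h1 k
    obtain ⟨s, hs1, hs2⟩ := hs.coarse
    constructor
    · rintro ⟨y, hy, h2, rfl⟩
      obtain ⟨w, hw, h3, h4⟩ := (hs.shape _ (h.maps x hx) _ (h.maps' x' hx') h1 (ℓ (σ.P y))).1
        ⟨_, h.maps y hy, h2, rfl⟩
      obtain ⟨h5, h6⟩ := h.fix' w hw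
      obtain ⟨y', h7, h8, h9⟩ := (h.shape y hy w h5 (by
        rw [h6, ← hs1 _ (h.maps y hy), ← hs2 _ hw, h4]) (σ.cd y)).1 ⟨y, hy, rfl, rfl⟩
      refine ⟨y', h7, ?_, ?_⟩
      · show p' (σ.P' y') = p' (σ.P' x')
        rw [h8, h6, h3]
      · show Nat.pair _ _ = Nat.pair _ _
        rw [h9, h8, h6, h4]
    · rintro ⟨y, hy, h2, rfl⟩
      obtain ⟨w, hw, h3, h4⟩ := (hs.shape _ (h.maps x hx) _ (h.maps' x' hx') h1 (ℓ' (σ.P' y))).2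
        ⟨_, h.maps' y hy, h2, rfl⟩
      obtain ⟨h5, h6⟩ := h.fix w hw
      obtain ⟨y', h7, h8, h9⟩ := (h.shape w h5 y hy (by
        rw [h6, ← hs2 _ (h.maps' y hy), ← hs1 _ hw, h4]) (σ.cd' y)).2 ⟨y, hy, rfl, rfl⟩
      refine ⟨y', h7, ?_, ?_⟩
      · show p (σ.P y') = p (σ.P x)
        rw [h8, h6, h3]
      · show Nat.pair _ _ = Nat.pair _ _
        rw [h9, h8, h6, h4]
  · obtain ⟨τ, h1, h2⟩ := hs.root
    refine ⟨fun k => τ k.unpair.2, fun x hx => ?_, fun x hx => ?_⟩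
    · simp only [Nat.unpair_pair]
      exact h1 _ (h.maps x hx)
    · simp only [Nat.unpair_pair]
      exact h2 _ (h.maps' x hx)
  · intro y hy hyU
    obtain ⟨h1, h2, h3⟩ := h.onY y hy hyU
    obtain ⟨h4, h5, h6⟩ := hs.onY _ h3 (h.maps y hyU)
    refine ⟨?_, ?_, h6⟩
    · show Nat.pair _ _ = Nat.pair _ _
      rw [h1, ← h2, h4]
    · show p _ = p' _
      rw [← h2, h5]

theorem Inv.half (hS : Sys G μ) (hT : Tower μ K b π C) (ht : 0 < t)
    (hE : ∀ f : X → ℤ, IsLocallyConstant f → ∃ g, IsLocallyConstant g ∧ ing μ g = t * ing μ f)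
    (cU : IsClopen U) {σ : CSt X}
    (h : Inv G μ t b (⋂ n, C n) U U' σ) (N : ℕ) :
    ∃ σ1, Inv G μ t b (⋂ n, C n) U U' σ1 ∧ Dev σ σ1 ∧ Dcd b π N U σ1 := by
  obtain ⟨q, hq⟩ := h.fib
  obtain ⟨n, p, ℓ, p', ℓ', hn, hs, hst, hker, href⟩ := exists_step hS hT ht hE h.st
    (Q := fun z => (CantorFund.fib G σ.P z).image fun x => (x ∈ U, σ.cd x, π N x))
    (lc_fib_image h.pw (lc_comp2 (fun a b => (a, b)) (lc_mem cU)
      (lc_comp2 (fun a b => (a, b)) h.lcd (hT.lev N).lab.lc))) (max N q)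
  have hnN := le_trans (le_max_left _ _) hn
  have hnq := le_trans (le_max_right _ _) hn
  have hker' : ∀ n m, n ≤ m → ∀ x y, b n x = b n y → b m x = b m y := fun n m hnm x y hxy =>
    hT.ker_mono hnm hxy
  refine ⟨_, h.next hker' hs hst, ⟨?_, ?_, ?_, ?_⟩, ⟨?_, ?_⟩⟩
  · exact fun x y hxy => congrArg p hxy
  · exact fun x y hxy => congrArg p' hxy
  · exact ⟨fun k => k.unpair.1, fun x => by simp only [Nat.unpair_pair], fun x => by simp only [Nat.unpair_pair]⟩
  · intro x y x' y' h1 h2 h3 h4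
    obtain ⟨h5, h6⟩ := Nat.pair_eq_pair.1 h3
    show Nat.pair _ _ = Nat.pair _ _
    rw [h4, ← h1, ← h2, h6]
  · intro x hx y hy hxy
    obtain ⟨h5, h6⟩ := Nat.pair_eq_pair.1 hxy
    have h7 := href _ _ h6
    simp only at h7
    have h8 : (x ∈ U, σ.cd x, π N x) ∈ (CantorFund.fib G σ.P (σ.P x)).image fun x => (x ∈ U, σ.cd x, π N x) :=
      Finset.mem_image_of_mem _ ((mem_fib h.pw).2 rfl)
    rw [h7] at h8
    obtain ⟨w, hw, hwe⟩ := Finset.mem_image.1 h8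
    rw [mem_fib h.pw] at hw
    rw [Prod.mk.injEq, Prod.mk.injEq] at hwe
    obtain ⟨h9, h10, h11⟩ := hwe
    have hwU : w ∈ U := h9.symm ▸ hx
    rw [← h11, h.inj w hwU y hy hw (h10.trans h5)]
  · intro x hx y hy hxy
    refine hker _ (h.maps x hx) _ (h.maps y hy) ?_
    rw [hT.ker_mono hnq (hq x hx), hT.ker_mono hnq (hq y hy), hT.ker_mono hnN hxy]

theorem Inv.full (hS : Sys G μ) (hT : Tower μ K b π C) (ht : 0 < t)
    (hE : ∀ f : X → ℤ, IsLocallyConstant f → ∃ g, IsLocallyConstant g ∧ ing μ g = t * ing μ f)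
    (hE' : ∀ f : X → ℤ, IsLocallyConstant f → ∃ g, IsLocallyConstant g ∧ ing μ g = t⁻¹ * ing μ f)
    (cU : IsClopen U) (cU' : IsClopen U') (hU : ∀ x ∈ ⋂ n, C n, (x ∈ U ↔ x ∈ U')) {σ : CSt X}
    (h : Inv G μ t b (⋂ n, C n) U U' σ) (N : ℕ) :
    ∃ σ1, Inv G μ t b (⋂ n, C n) U U' σ1 ∧ Dev σ σ1 ∧ Dcd b π N U σ1 ∧ Dcd b π N U' σ1.swap := by
  obtain ⟨σ1, h1, h2, h3⟩ := h.half hS hT ht hE cU N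
  have hU' : ∀ x ∈ ⋂ n, C n, (x ∈ U' ↔ x ∈ U) := fun x hx => (hU x hx).symm
  obtain ⟨σ2, h4, h5, h6⟩ := (h1.swap ht.ne' hU).half hS hT (inv_pos.2 ht) hE' cU' N
  have h7 := h4.swap (inv_pos.2 ht).ne' hU'
  rw [inv_inv] at h7
  exact ⟨σ2.swap, h7, h2.trans h5.swap, h3.mono h5.swap, h6⟩

theorem exists_stages (hS : Sys G μ) (hT : Tower μ K b π C) (ht : 0 < t)
    (hE : ∀ f : X → ℤ, IsLocallyConstant f → ∃ g, IsLocallyConstant g ∧ ing μ g = t * ing μ f)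
    (hE' : ∀ f : X → ℤ, IsLocallyConstant f → ∃ g, IsLocallyConstant g ∧ ing μ g = t⁻¹ * ing μ f)
    (hst : St G μ t b (⋂ n, C n) U (fun _ => 0) U' (fun _ => 0)) :
    ∃ σ : ℕ → CSt X, (∀ k, Inv G μ t b (⋂ n, C n) U U' (σ k)) ∧ (∀ k, Dev (σ k) (σ (k + 1))) ∧
      (∀ k, Dcd b π k U (σ (k + 1))) ∧ ∀ k, Dcd b π k U' (σ (k + 1)).swap := by
  have h0 : Inv G μ t b (⋂ n, C n) U U' ⟨U, U', fun _ => 0, fun _ => 0, id, id, fun _ => 0, fun _ => 0⟩ := by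
    refine ⟨hst, PW.id, PW.id, IsLocallyConstant.const _, IsLocallyConstant.const _, fun x hx => hx,
      fun x hx => hx, fun x hx => ⟨hx, rfl⟩, fun x hx => ⟨hx, rfl⟩, ⟨0, fun _ _ => rfl⟩, ⟨0, fun _ _ => rfl⟩,
      fun x _ y _ h _ => h, fun x _ y _ h _ => h, ?_, ⟨fun _ => 0, fun _ _ => rfl, fun _ _ => rfl⟩,
      fun y hy _ => ⟨rfl, rfl, hy⟩⟩
    intro x hx x' hx' _ k
    constructor
    · rintro ⟨y, -, -, rfl⟩; exact ⟨x', hx', rfl, rfl⟩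
    · rintro ⟨y, -, -, rfl⟩; exact ⟨x, hx, rfl, rfl⟩
  have hstep : ∀ k (σ : {σ : CSt X // Inv G μ t b (⋂ n, C n) U U' σ}),
      ∃ σ1 : {σ : CSt X // Inv G μ t b (⋂ n, C n) U U' σ},
        Dev σ.1 σ1.1 ∧ Dcd b π k U σ1.1 ∧ Dcd b π k U' σ1.1.swap := by
    rintro k ⟨σ, hσ⟩
    obtain ⟨σ1, h1, h2⟩ := hσ.full hS hT ht hE hE' hst.cB hst.cB' hst.memY k
    exact ⟨⟨σ1, h1⟩, h2⟩
  choose nx hnx using hstep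
  let σ : ℕ → {σ : CSt X // Inv G μ t b (⋂ n, C n) U U' σ} := fun k => Nat.rec ⟨_, h0⟩ (fun k s => nx k s) k
  exact ⟨fun k => (σ k).1, fun k => (σ k).2, fun k => (hnx k (σ k)).1, fun k => (hnx k (σ k)).2.1,
    fun k => (hnx k (σ k)).2.2⟩

end Recursion

end

section

/-- A coherent sequence of stages deciding every level on both sides. -/
structure Stg (G : Type*) {X : Type*} [Group G] [MulAction G X] [TopologicalSpace X] [MeasurableSpace X]
    (μ : Measure X) (t : ℝ) (b : ℕ → X → X) (π : ℕ → X → ℕ) (Y U U' : Set X) (σ : ℕ → CSt X) : Prop where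
  inv : ∀ k, Inv G μ t b Y U U' (σ k)
  dev : ∀ k, Dev (σ k) (σ (k + 1))
  dcd : ∀ k, Dcd b π k U (σ (k + 1))
  dcd' : ∀ k, Dcd b π k U' (σ (k + 1)).swap

section Limit

variable {G X : Type*} [CommGroup G] [TopologicalSpace X] [MulAction G X]
  [CompactSpace X] [FreeAct G X] [ContinuousConstSMul G X]
  [T2Space X] [TotallyDisconnectedSpace X]
  [MeasurableSpace X] [BorelSpace X] {μ : Measure X}
  [IsProbabilityMeasure μ] [SMulInvariantMeasure G X μ]
  {K : Finset G} {b : ℕ → X → X} {π : ℕ → X → ℕ} {C : ℕ → Set X} {t : ℝ} {Y U U' : Set X}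
  {σ : ℕ → CSt X}

theorem Stg.swap (ht : t ≠ 0) (hU : ∀ x ∈ Y, (x ∈ U ↔ x ∈ U')) (h : Stg G μ t b π Y U U' σ) :
    Stg G μ t⁻¹ b π Y U' U fun k => (σ k).swap :=
  ⟨fun k => (h.inv k).swap ht hU, fun k => (h.dev k).swap, h.dcd', h.dcd⟩

theorem Stg.dev_le (h : Stg G μ t b π Y U U' σ) {k m : ℕ} (hkm : k ≤ m) : Dev (σ k) (σ m) := by
  induction m, hkm using Nat.le_induction with
  | base => exact Dev.refl _
  | succ m _ ih => exact ih.trans (h.dev m)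

theorem Tower.eq_of_lab (hT : Tower μ K b π C) {x y : X} (h : ∀ n, π n x = π n y) : x = y := by
  by_contra hne
  obtain ⟨V, hV, hx, hy⟩ := exists_isClopen_of_totally_separated hne
  obtain ⟨n, hn⟩ := (hT.ev_ref (lc_mem hV)).exists
  exact hy ((iff_of_eq (hn x y (h n))).1 hx)

theorem Stg.eq_of_code (hT : Tower μ K b π C) (h : Stg G μ t b π Y U U' σ) {x y : X} (hx : x ∈ U)
    (hy : y ∈ U) (k0 : ℕ) (hxy : ∀ k, k0 ≤ k → (σ k).cd x = (σ k).cd y) : x = y := by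
  refine hT.eq_of_lab fun n => (h.dcd n).lab x hx y hy ?_
  obtain ⟨d, hd, -⟩ := (h.dev_le (le_max_right k0 (n + 1))).dec
  rw [hd, hd, hxy _ (le_max_left _ _)]

theorem Stg.exists_match (hS : Sys G μ) (ht : 0 < t) (hst : IsClopen U')
    (h : Stg G μ t b π Y U U' σ) {x : X} (hx : x ∈ U) :
    ∃ x' ∈ U', ∀ k, (σ k).cd' x' = (σ k).cd x := by
  have h1 : ∀ k, ({y | y ∈ U' ∧ (σ k).cd' y = (σ k).cd x}).Nonempty := by
    intro k
    have hk := h.inv k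
    have h2 := hk.st.meas ((σ k).v ((σ k).P x))
    have h3 : 0 < μ.real (lv (σ k).B (σ k).v ((σ k).v ((σ k).P x))) :=
      real_pos hS (lv_clopen hk.st.cB hk.st.lc _) ⟨_, hk.maps x hx, rfl⟩
    have h4 : (lv (σ k).B' (σ k).v' ((σ k).v ((σ k).P x))).Nonempty := by
      by_contra hne
      rw [Set.not_nonempty_iff_eq_empty.1 hne, measureReal_empty] at h2
      exact (mul_pos ht h3).ne h2
    obtain ⟨w, hw, hwv⟩ := h4
    obtain ⟨h5, h6⟩ := hk.fix' w hw
    obtain ⟨y, hy, -, hyk⟩ := (hk.shape x hx w h5 (by rw [h6, hwv]) _).1 ⟨x, hx, rfl, rfl⟩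
    exact ⟨y, hy, hyk⟩
  have h2 : ∀ k, IsClosed {y | y ∈ U' ∧ (σ k).cd' y = (σ k).cd x} := fun k =>
    (lv_clopen hst (h.inv k).lcd' _).isClosed
  obtain ⟨x', hx'⟩ := IsCompact.nonempty_iInter_of_sequence_nonempty_isCompact_isClosed _
    (fun k => by
      rintro y ⟨hy, hyk⟩
      obtain ⟨d, hd, hd'⟩ := (h.dev k).dec
      exact ⟨hy, by rw [hd, hd', hyk]⟩) h1 (h2 0).isCompact h2
  rw [Set.mem_iInter] at hx'
  exact ⟨x', (hx' 0).1, fun k => (hx' k).2⟩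

theorem Stg.continuous (hT : Tower μ K b π C) (h : Stg G μ t b π Y U U' σ) (f : U → U')
    (hf : ∀ (x : U) k, (σ k).cd' (f x) = (σ k).cd x) : Continuous f := by
  refine Continuous.subtype_mk (f := fun x => (f x : X)) ?_ _
  rw [(isTopologicalBasis_isClopen (X := X)).continuous_iff]
  intro V hV
  rw [isOpen_iff_mem_nhds]
  intro x hx
  obtain ⟨n, hn⟩ := (hT.ev_ref (lc_mem hV)).exists
  filter_upwards [continuous_subtype_val.continuousAt.eventually (lc_ev (h.inv (n + 1)).lcd x)] with y hy
  have h1 := (h.dcd' n).lab (f y) (f y).2 (f x) (f x).2 (by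
    show (σ (n + 1)).cd' _ = (σ (n + 1)).cd' _
    rw [hf, hf, hy])
  exact (iff_of_eq (hn _ _ h1)).2 hx

theorem Stg.ker (hT : Tower μ K b π C) (ht : t ≠ 0) (hU : ∀ x ∈ Y, (x ∈ U ↔ x ∈ U'))
    (h : Stg G μ t b π Y U U' σ) {x y x' y' : X} (hx : x ∈ U) (hy : y ∈ U)
    (hx' : x' ∈ U') (hy' : y' ∈ U') (hxx : ∀ k, (σ k).cd' x' = (σ k).cd x)
    (hyy : ∀ k, (σ k).cd' y' = (σ k).cd y) {N : ℕ} (hN : b N x = b N y) : ∃ q, b q x' = b q y' := by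
  have hk := h.inv (N + 1)
  have h1 := (h.dcd N).ker x hx y hy hN
  obtain ⟨ρ, h2, h3⟩ := hk.root
  obtain ⟨z, hz, h4, h5⟩ := (hk.shape x hx x' hx' (by rw [h2 x hx, h3 x' hx', hxx]) _).1
    ⟨y, hy, h1.symm, rfl⟩
  have h6 : z = y' := (h.swap ht hU).eq_of_code hT hz hy' (N + 1) fun k hk => by
    show (σ k).cd' z = (σ k).cd' y'
    rw [hyy, (h.dev_le hk).prop x y x' z h1 h4.symm (hxx k).symm h5.symm]
  obtain ⟨q, hq⟩ := hk.fib'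
  exact ⟨q, by rw [← hq x' hx', ← h4, hq z hz, h6]⟩

/-- The limit homeomorphism preserves the approximating relation and fixes `Y` pointwise. -/
theorem exists_limit (hS : Sys G μ) (hT : Tower μ K b π C) (ht : 0 < t)
    (hE : ∀ f : X → ℤ, IsLocallyConstant f → ∃ g, IsLocallyConstant g ∧ ing μ g = t * ing μ f)
    (hE' : ∀ f : X → ℤ, IsLocallyConstant f → ∃ g, IsLocallyConstant g ∧ ing μ g = t⁻¹ * ing μ f)
    (hst : St G μ t b (⋂ n, C n) U (fun _ => 0) U' (fun _ => 0)) :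
    ∃ h : U ≃ₜ U', (∀ x : U, (x : X) ∈ ⋂ n, C n → (h x : X) = x) ∧
      ∀ x y : U, (∃ n, b n (x : X) = b n y) ↔ ∃ n, b n (h x : X) = b n (h y) := by
  obtain ⟨σ, h1, h2, h3, h4⟩ := exists_stages hS hT ht hE hE' hst
  have h : Stg G μ t b π (⋂ n, C n) U U' σ := ⟨h1, h2, h3, h4⟩
  have h' := h.swap ht.ne' hst.memY
  have hU' : ∀ x ∈ ⋂ n, C n, (x ∈ U' ↔ x ∈ U) := fun x hx => (hst.memY x hx).symm
  have m1 : ∀ x : U, ∃ x' : U', ∀ k, (σ k).cd' x' = (σ k).cd x := fun x => by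
    obtain ⟨x', hx', e⟩ := h.exists_match hS ht hst.cB' x.2
    exact ⟨⟨x', hx'⟩, e⟩
  have m2 : ∀ x : U', ∃ x' : U, ∀ k, (σ k).cd x' = (σ k).cd' x := fun x => by
    obtain ⟨x', hx', e⟩ := h'.exists_match hS (inv_pos.2 ht) hst.cB x.2
    exact ⟨⟨x', hx'⟩, e⟩
  choose f hf using m1
  choose g hg using m2
  refine ⟨⟨⟨f, g, fun x => ?_, fun x => ?_⟩, h.continuous hT f hf, h'.continuous hT g hg⟩, fun x hx => ?_,
    fun x y => ⟨?_, ?_⟩⟩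
  · exact Subtype.ext (h.eq_of_code hT (g (f x)).2 x.2 0 fun k _ => by rw [hg, hf])
  · refine Subtype.ext (h'.eq_of_code hT (f (g x)).2 x.2 0 fun k _ => ?_)
    show (σ k).cd' _ = (σ k).cd' _
    rw [hf, hg]
  · refine h'.eq_of_code hT (f x).2 ((hst.memY _ hx).1 x.2) 0 fun k _ => ?_
    show (σ k).cd' (f x) = (σ k).cd' x
    rw [hf, ((h.inv k).onY _ hx x.2).1]
  · rintro ⟨n, hn⟩
    exact h.ker hT ht.ne' hst.memY x.2 y.2 (f x).2 (f y).2 (hf x) (hf y) hn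
  · rintro ⟨n, hn⟩
    exact h'.ker hT (inv_pos.2 ht).ne' hU' (f x).2 (f y).2 x.2 y.2 (fun k => (hf x k).symm)
      (fun k => (hf y k).symm) hn

end Limit

end

section

section Shrink

variable {G X : Type*} [CommGroup G] [TopologicalSpace X] [MulAction G X]
  [CompactSpace X] [FreeAct G X] [ContinuousConstSMul G X]
  [T2Space X] [TotallyDisconnectedSpace X]
  [MeasurableSpace X] [BorelSpace X] {μ : Measure X}
  [IsProbabilityMeasure μ] [SMulInvariantMeasure G X μ]
  {K : Finset G} {b : ℕ → X → X} {π : ℕ → X → ℕ} {C : ℕ → Set X} {t : ℝ}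

theorem spl_const {N : AddSubgroup ((X → ℤ) →+ ℤ)} {B : Set X} {f : (X → ℤ) →+ ℤ} (hf : f ∈ N)
    (h : f (ind B) = 1) : Spl N B fun _ => 0 := by
  rintro k ⟨x, hx, rfl⟩
  refine ⟨f, hf, fun j => ?_⟩
  split_ifs with hj
  · rw [← h]
    congr 2
    ext x
    simp [lv, hj]
  · have : lv B (fun _ => 0) j = ∅ := by
      ext x
      simp [lv, Ne.symm hj]
    rw [this, ← map_zero f]
    congr 1
    funext x
    simp [ind]

theorem Tower.spl_univ (hT : Tower μ K b π C) [Nonempty X] (m : ℕ) :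
    Spl (Fn G (b m)) (Set.univ : Set X) fun _ => 0 := by
  refine hT.spl_mono (Nat.zero_le m) (fun _ _ _ => rfl) (fun _ _ _ => rfl) ?_
  refine spl_const (sgH_mem (b 0) (Classical.arbitrary X)) ?_
  show sig G (b 0) _ _ = 1
  rw [hT.zero, sig_id]
  simp [ind]

theorem exists_start (hT : Tower μ K b π C) (ht : 0 < t) (ht1 : t < 1)
    {c0 : X → ℤ} (hc0 : IsLocallyConstant c0) (hi : ing μ c0 = t) :
    ∃ U, IsClopen U ∧ ⋂ n, C n ⊆ U ∧ μ.real U = t ∧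
      ∀ᶠ m in atTop, Spl (Fn G (b m)) U fun _ => 0 := by
  obtain ⟨M, hM⟩ := (hT.ev_ref hc0).exists
  obtain ⟨io, hio, hf⟩ := hT.fresh M 1
  let c : X → ℤ := c0 + io 0
  have hc : IsLocallyConstant c := lc_add hc0 (hio 0).1
  have hone : IsLocallyConstant (ind (Set.univ : Set X)) := lc_ind isClopen_univ
  have hc' : IsLocallyConstant (ind (Set.univ : Set X) - c) := lc_sub hone hc
  have ic : ing μ c = t := by rw [ing_add hc0 (hio 0).1, hi, (hio 0).2, add_zero]
  have ic' : ing μ (ind (Set.univ : Set X) - c) = 1 - t := by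
    rw [ing_sub hone hc, ic, ing_ind isClopen_univ]
    simp
  obtain ⟨m, h1, h2⟩ := ((ing_pos_ev hT hc (by rw [ic]; exact ht)).and
    (ing_pos_ev hT hc' (by rw [ic']; linarith))).exists
  have hb := (hT.lev m).pw
  let cc : ℕ → X → ℤ := fun k => if k = 0 then ind (Set.univ : Set X) - c else c
  have hcc : ∀ k, IsLocallyConstant (cc k) := by
    intro k
    by_cases hk : k = 0
    · simpa [cc, hk] using hc'
    · simpa [cc, hk] using hc
  have hlow : ∀ k x, (((fib G (b m) (b m x)).filter (fun y => y ∈ C m)).card : ℤ) ≤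
      sig G (b m) (cc k) (b m x) := by
    intro k x
    by_cases hk : k = 0
    · simpa [cc, hk] using h2 x
    · simpa [cc, hk] using h1 x
  obtain ⟨e, he, e1, e2, e3, e4⟩ := realize hb (B' := Set.univ) (Y := ⋂ n, C n) (C := C m)
    (v' := fun _ => 0) (ℓ := fun _ => 1) (p := id) (L := {0, 1}) (s := fun _ => 0) (τ := id) (c := cc)
    isClopen_univ (IsLocallyConstant.const _) (IsLocallyConstant.const _) PW.id
    (fun l _ => hcc l) (isClosed_iInter fun n => (hT.lev n).clo.isClosed) (Set.iInter_subset _ m)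
    (by
      intro u z
      by_cases hu : u = 0
      · subst hu
        have h3 : lv (Set.univ : Set X) (fun _ => 0) 0 = Set.univ := by ext; simp [lv]
        rw [h3, Finset.filter_true_of_mem (fun _ _ => rfl), Finset.sum_pair zero_ne_one]
        show sgH G (b m) z _ = sgH G (b m) z _ + sgH G (b m) z _
        rw [← map_add]
        congr 1
        simp [cc]
      · have h3 : lv (Set.univ : Set X) (fun _ => 0) u = ∅ := by
          ext; simp [lv, Ne.symm hu]
        rw [h3, Finset.filter_false_of_mem (fun _ _ => Ne.symm hu), Finset.sum_empty]
        simp [sig_ind])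
    (fun x l _ => hlow l x) (fun y hy _ => ⟨by simp, rfl, hy, trivial, rfl, rfl, rfl⟩)
    (fun y _ _ y' _ _ _ h => h)
  have hle : IsLocallyConstant fun x => (e x).1 := he.comp Sigma.fst
  have cU := lv_clopen (B := (Set.univ : Set X)) isClopen_univ hle 1
  have hsU : ∀ z, sig G (b m) (ind (lv (Set.univ : Set X) (fun x => (e x).1) 1)) z = sig G (b m) c z := by
    intro z
    have := sig_lv_retract (c := cc) (τ := id) (L := {0, 1}) hb (fun x hx => ⟨(e1 x hx).1, (e1 x hx).2.1⟩) e2 e3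
      (k := 1) (by simp) rfl (fun x => le_trans (Int.natCast_nonneg _) (hlow 1 x)) z
    rw [this]
    simp [cc]
  refine ⟨_, cU, fun y hy => ⟨trivial, (e4 y hy trivial).1⟩, ?_, ?_⟩
  · rw [← ing_ind cU, ← ing_sig (G := G) hb (lc_ind cU), ← ic, ← ing_sig (G := G) hb hc, funext hsU]
  · filter_upwards [eventually_ge_atTop (max m (M + 1))] with n hn
    obtain ⟨f, hfn, f1, f2⟩ := hf n (le_trans (le_max_right _ _) hn) 0 zero_lt_one
    refine spl_const hfn ?_
    rw [hT.Fn_sig (le_trans (le_max_left _ _) hn) hsU hfn, map_add, f2 c0 hM, f1 0 zero_lt_one]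
    simp

theorem GenSet.induct (hK : GenSet K) {P : G → Prop} (h1 : ∀ k ∈ K, P k)
    (h2 : ∀ g h, P g → P h → P (g * h)) (g : G) : P g := by
  obtain ⟨s, hs⟩ := hK.gen g
  induction s generalizing g with
  | zero =>
    rw [pow_zero, Finset.mem_one] at hs
    exact hs ▸ h1 1 hK.one
  | succ s ih =>
    rw [pow_succ] at hs
    obtain ⟨a, ha, k, hk, rfl⟩ := Finset.mem_mul.1 hs
    exact h2 a k (ih a ha) (h1 k hk)

theorem Tower.gen_cases (hK : GenSet K) (hT : Tower μ K b π C) {k : G} (hk : k ∈ K) (x : X) :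
    (∃ n, b n x = b n (k • x)) ∨ (x ∈ ⋂ n, C n) ∧ k • x ∈ ⋂ n, C n := by
  by_cases h : ∃ n, b n x = b n (k • x)
  · exact Or.inl h
  · push Not at h
    refine Or.inr ⟨Set.mem_iInter.2 fun n => (hT.lev n).cutC ⟨k, hk, (h n).symm⟩,
      Set.mem_iInter.2 fun n => (hT.lev n).cutC ⟨k⁻¹, hK.symm k hk, ?_⟩⟩
    rw [inv_smul_smul]
    exact h n

theorem Tower.rel_trans (hT : Tower μ K b π C) {x y z : X} (h : ∃ n, b n x = b n y)
    (h' : ∃ n, b n y = b n z) : ∃ n, b n x = b n z := by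
  obtain ⟨n, hn⟩ := h
  obtain ⟨m, hm⟩ := h'
  exact ⟨max n m, (hT.ker_mono (le_max_left _ _) hn).trans (hT.ker_mono (le_max_right _ _) hm)⟩

theorem rel_orbit (hT : Tower μ K b π C) {x y : X} (h : ∃ n, b n x = b n y) : ∃ g : G, g • x = y := by
  obtain ⟨n, hn⟩ := h
  obtain ⟨g, hg⟩ := (hT.lev n).pw.exists_smul hn
  exact ⟨g, hg.symm⟩

theorem orbit_trans {x y z : X} (h : ∃ g : G, g • x = y) (h' : ∃ g : G, g • y = z) : ∃ g : G, g • x = z := by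
  obtain ⟨g, rfl⟩ := h
  obtain ⟨g', rfl⟩ := h'
  exact ⟨g' * g, mul_smul _ _ _⟩

/-- For every `t < 1` multiplying the value group onto itself there is a clopen set of measure `t` on which
the induced relation is orbit equivalent to the full one. -/
theorem exists_shrink [Group.FG G] [Nonempty X] [TopologicalSpace.MetrizableSpace X] (hS : Sys G μ) (ht : 0 < t) (ht1 : t < 1)
    (hE : ∀ f : X → ℤ, IsLocallyConstant f → ∃ g, IsLocallyConstant g ∧ ing μ g = t * ing μ f)
    (hE' : ∀ f : X → ℤ, IsLocallyConstant f → ∃ g, IsLocallyConstant g ∧ ing μ g = t⁻¹ * ing μ f) :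
    ∃ U : Set X, IsClopen U ∧ μ.real U = t ∧ ∃ h : X ≃ₜ U, ∀ x y,
      (∃ g : G, g • x = y) ↔ ∃ g : G, g • (h x : X) = h y := by
  obtain ⟨K, hK⟩ := exists_genSet (G := G)
  obtain ⟨b, π, C, hT⟩ := exists_tower hS K
  obtain ⟨c0, hc0, hi⟩ := hE (ind Set.univ) (lc_ind isClopen_univ)
  rw [ing_ind isClopen_univ, probReal_univ, mul_one] at hi
  obtain ⟨U, cU, hYU, hU, hspl⟩ := exists_start hT ht ht1 hc0 hi
  have hst : St G μ t b (⋂ n, C n) Set.univ (fun _ => 0) U (fun _ => 0) := by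
    refine ⟨isClopen_univ, cU, IsLocallyConstant.const _, IsLocallyConstant.const _,
      fun x hx => ⟨fun _ => hYU hx, fun _ => trivial⟩, fun _ _ _ => rfl, fun k => ?_,
      Eventually.of_forall fun m => hT.spl_univ m, hspl⟩
    by_cases hk : 0 = k
    · simp [lv, hk, hU]
    · simp [lv, hk]
  obtain ⟨h0, hfix0, hS0⟩ := exists_limit hS hT ht hE hE' hst
  let h : X ≃ₜ U := (Homeomorph.Set.univ X).symm.trans h0
  have hfix : ∀ x ∈ ⋂ n, C n, (h x : X) = x := fun x hx => hfix0 ⟨x, trivial⟩ hx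
  have hrel : ∀ x y, (∃ n, b n x = b n y) ↔ ∃ n, b n (h x : X) = b n (h y) := fun x y =>
    hS0 ⟨x, trivial⟩ ⟨y, trivial⟩
  refine ⟨U, cU, hU, h, fun x y => ⟨?_, ?_⟩⟩
  · rintro ⟨g, rfl⟩
    revert x
    refine hK.induct (P := fun g => ∀ x, ∃ g' : G, g' • (h x : X) = h (g • x)) ?_ ?_ g
    · intro k hk x
      rcases hT.gen_cases hK hk x with h1 | ⟨h1, h2⟩
      · exact rel_orbit hT ((hrel _ _).1 h1)
      · exact ⟨k, by rw [hfix _ h1, hfix _ h2]⟩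
    · intro g g' h1 h2 x
      have := orbit_trans (h2 x) (h1 (g' • x))
      rwa [mul_smul]
  · rintro ⟨g, hg⟩
    have hmeet : ∀ x, ∃ u : X, ∃ n, b n x = b n (h u : X) := by
      intro x
      obtain ⟨n, hn⟩ := hT.pos (ind U) (lc_ind cU) (by rw [ing_ind cU, hU]; exact ht)
      have h1 := hn n le_rfl x
      rw [sig_ind, Nat.cast_pos, Finset.card_pos] at h1
      obtain ⟨y, hy⟩ := h1
      rw [Finset.mem_filter, mem_fib (hT.lev n).pw] at hy
      exact ⟨h.symm ⟨y, hy.2⟩, n, by rw [h.apply_symm_apply]; exact hy.1.symm⟩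
    have hsymm : ∀ x y : X, (∃ n, b n x = b n y) → ∃ n, b n y = b n x := fun x y ⟨n, hn⟩ => ⟨n, hn.symm⟩
    have key := hK.induct (P := fun g => ∀ x u w : X, (∃ n, b n x = b n (h u : X)) →
      (∃ n, b n (g • x) = b n (h w : X)) → ∃ g' : G, g' • u = w) ?_ ?_ g
    · exact key (h x) x y ⟨0, rfl⟩ ⟨0, by rw [hg]⟩
    · intro k hk x u w h1 h2
      rcases hT.gen_cases hK hk x with h3 | ⟨h3, h4⟩
      · exact rel_orbit hT ((hrel _ _).2 (hT.rel_trans (hT.rel_trans (hsymm _ _ h1) h3) h2))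
      · have h5 : ∃ n, b n u = b n x := (hrel _ _).2 (by rw [hfix _ h3]; exact hsymm _ _ h1)
        have h6 : ∃ n, b n (k • x) = b n w := (hrel _ _).2 (by rw [hfix _ h4]; exact h2)
        exact orbit_trans (orbit_trans (rel_orbit hT h5) ⟨k, rfl⟩) (rel_orbit hT h6)
    · intro g g' h1 h2 x u w h3 h4
      obtain ⟨v, hv⟩ := hmeet (g' • x)
      rw [mul_smul] at h4
      exact orbit_trans (h2 x u v h3 hv) (h1 (g' • x) v w hv h4)

end Shrink

end

section

theorem countable_of_fg {G : Type*} [CommGroup G] [Group.FG G] : Countable G := by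
  obtain ⟨K, hK⟩ := exists_genSet (G := G)
  have h : (⋃ s : ℕ, ((K ^ s : Finset G) : Set G)) = Set.univ :=
    Set.eq_univ_of_forall fun g => Set.mem_iUnion.2 ((hK.gen g).imp fun s hs => by exact_mod_cast hs)
  rw [← Set.countable_univ_iff, ← h]
  exact Set.countable_iUnion fun s => (Finset.finite_toSet _).countable

/-- Two embeddings which piecewise differ by measure preserving homeomorphisms transport measure equally. -/
theorem measure_image_eq {X Z : Type*} [TopologicalSpace X] [MeasurableSpace X] [BorelSpace X]
    [TopologicalSpace Z] [MeasurableSpace Z] [BorelSpace Z] [T2Space Z] {ν : Measure Z}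
    {ι : Type*} [Countable ι] [Nonempty ι] {τ : ι → Z ≃ₜ Z} (hτ : ∀ s, MeasurePreserving (τ s) ν ν)
    {F₁ F₂ : X → Z} (c₁ : Continuous F₁) (c₂ : Continuous F₂) (e₁ : MeasurableEmbedding F₁)
    (e₂ : MeasurableEmbedding F₂) (h : ∀ x, ∃ s, F₂ x = τ s (F₁ x)) {B : Set X} (hB : MeasurableSet B) :
    ν (F₂ '' B) = ν (F₁ '' B) := by
  obtain ⟨q, hq⟩ := exists_surjective_nat ι
  let D : ℕ → Set X := fun n => {x | F₂ x = τ (q n) (F₁ x)}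
  have hD : ∀ n, MeasurableSet (D n) := fun n =>
    (isClosed_eq c₂ ((τ (q n)).continuous.comp c₁)).measurableSet
  have hDu : (⋃ n, disjointed D n) = Set.univ := by
    rw [iUnion_disjointed]
    refine Set.eq_univ_of_forall fun x => ?_
    obtain ⟨s, hs⟩ := h x
    obtain ⟨n, rfl⟩ := hq s
    exact Set.mem_iUnion.2 ⟨n, hs⟩
  have hm : ∀ n, MeasurableSet (B ∩ disjointed D n) := fun n =>
    hB.inter (MeasurableSet.disjointed hD n)
  have hBu : B = ⋃ n, B ∩ disjointed D n := by rw [← Set.inter_iUnion, hDu, Set.inter_univ]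
  have hdis : Pairwise fun i j => Disjoint (B ∩ disjointed D i) (B ∩ disjointed D j) := fun i j hij =>
    (disjoint_disjointed D hij).mono Set.inter_subset_right Set.inter_subset_right
  have hsum : ∀ {F : X → Z}, MeasurableEmbedding F → ν (F '' B) = ∑' n, ν (F '' (B ∩ disjointed D n)) := by
    intro F hF
    conv_lhs => rw [hBu]
    rw [Set.image_iUnion, measure_iUnion (fun i j hij => (Set.disjoint_image_iff hF.injective).2 (hdis hij))
      fun n => hF.measurableSet_image.2 (hm n)]
  rw [hsum e₁, hsum e₂]
  congr 1
  funext n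
  have h1 : F₂ '' (B ∩ disjointed D n) = τ (q n) '' (F₁ '' (B ∩ disjointed D n)) := by
    rw [Set.image_image]
    exact Set.image_congr fun x hx => disjointed_subset D n hx.2
  rw [h1, ← (τ (q n)).coe_toEquiv, Equiv.image_eq_preimage_symm]
  have h2 := (hτ (q n)).measure_preimage (s := (τ (q n)).toEquiv.symm ⁻¹' (F₁ '' (B ∩ disjointed D n)))
    (((τ (q n)).symm.continuous.measurable (e₁.measurableSet_image.2 (hm n))).nullMeasurableSet)
  rw [← h2]
  congr 1
  ext z
  simp

section Prod

variable {G X : Type*} [CommGroup G] [TopologicalSpace X] [MulAction G X]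
  [CompactSpace X] [ContinuousConstSMul G X]
  [T2Space X] [MeasurableSpace X] [BorelSpace X] {μ : Measure X}
  [IsProbabilityMeasure μ] [SMulInvariantMeasure G X μ]

theorem prod_count_apply {n : ℕ} {W : Set (X × Fin n)} (hW : MeasurableSet W) :
    (μ.prod Measure.count) W = ∑ i, μ {x | (x, i) ∈ W} := by
  rw [Measure.prod_apply_symm hW, lintegral_count, tsum_fintype]
  rfl

theorem prod_count_ne_top {n : ℕ} (W : Set (X × Fin n)) : (μ.prod Measure.count) W ≠ ∞ :=
  measure_ne_top _ _

/-- The homeomorphism of the amplification given by a group element and a permutation. -/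
def ampHomeo (X : Type*) [TopologicalSpace X] [MulAction G X] [ContinuousConstSMul G X] {n : ℕ}
    (p : G × Equiv.Perm (Fin n)) : X × Fin n ≃ₜ X × Fin n :=
  (Homeomorph.smul p.1).prodCongr p.2.toHomeomorphOfDiscrete

theorem ampHomeo_preserving {n : ℕ} (p : G × Equiv.Perm (Fin n)) :
    MeasurePreserving (ampHomeo X p) (μ.prod Measure.count) (μ.prod Measure.count) := by
  refine ⟨(ampHomeo X p).continuous.measurable, Measure.ext fun W hW => ?_⟩
  rw [Measure.map_apply (ampHomeo X p).continuous.measurable hW, prod_count_apply hW,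
    prod_count_apply ((ampHomeo X p).continuous.measurable hW), ← Equiv.sum_comp p.2 fun i => μ {x | (x, i) ∈ W}]
  refine Finset.sum_congr rfl fun i _ => ?_
  have h : MeasurableSet {x | (x, p.2 i) ∈ W} := measurable_prodMk_right hW
  exact measure_preimage_smul_of_nullMeasurableSet h.nullMeasurableSet p.1

/-- An orbit equivalence onto a clopen part of the amplification scales the measure. -/
theorem measure_image_orbitEquiv [Countable G] (hS : Sys G μ) {n : ℕ} {U : Set (X × Fin n)} (hU : IsClopen U)
    (F : X ≃ₜ U) (hF : ∀ (x : X) (g : G), ∃ g' : G, g' • (F x : X × Fin n).1 = (F (g • x) : X × Fin n).1)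
    {B : Set X} (hB : MeasurableSet B) :
    (μ.prod Measure.count) ((fun x => (F x : X × Fin n)) '' B) = (μ.prod Measure.count) U * μ B := by
  let F₁ : X → X × Fin n := fun x => F x
  have hcl : IsClosedEmbedding F₁ := hU.isClosed.isClosedEmbedding_subtypeVal.comp F.isClosedEmbedding
  have h1 : MeasurableEmbedding F₁ := hcl.measurableEmbedding
  let ν : Measure X := (μ.prod Measure.count).comap F₁
  have hν : ∀ B, MeasurableSet B → ν B = (μ.prod Measure.count) (F₁ '' B) := fun B _ =>
    h1.comap_apply _ _
  have huniv : ν Set.univ = (μ.prod Measure.count) U := by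
    rw [hν _ MeasurableSet.univ]
    congr 1
    ext z
    constructor
    · rintro ⟨x, -, rfl⟩
      exact (F x).2
    · exact fun hz => ⟨F.symm ⟨z, hz⟩, trivial, by simp [F₁]⟩
  have hinv : ∀ g : G, ν.map (fun x => g • x) = ν := by
    intro g
    refine Measure.ext fun B hB => ?_
    have hg : Measurable fun x : X => g • x := (continuous_const_smul g).measurable
    rw [Measure.map_apply hg hB, hν _ (hg hB), hν _ hB]
    have h2 : F₁ '' B = (fun x => F₁ (g • x)) '' ((fun x => g • x) ⁻¹' B) := by
      rw [← Set.image_image F₁ (fun x => g • x), Set.image_preimage_eq _ (MulAction.surjective g)]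
    rw [h2]
    refine (measure_image_eq (ampHomeo_preserving (G := G) (μ := μ) (n := n)) hcl.continuous
      (hcl.continuous.comp (continuous_const_smul g)) h1
      (h1.comp (Homeomorph.smul g).measurableEmbedding) (fun x => ?_) (hg hB)).symm
    obtain ⟨g', hg'⟩ := hF x g
    exact ⟨(g', Equiv.swap (F₁ x).2 (F₁ (g • x)).2), Prod.ext hg'.symm (Equiv.swap_apply_left _ _).symm⟩
  by_cases h0 : ν Set.univ = 0
  · rw [← hν _ hB, ← huniv, h0, zero_mul, Measure.measure_univ_eq_zero.1 h0, Measure.coe_zero, Pi.zero_apply]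
  · have htop : ν Set.univ ≠ ∞ := by rw [huniv]; exact prod_count_ne_top _
    have h2 : (ν Set.univ)⁻¹ • ν = μ := by
      refine hS.uniq _ ⟨?_⟩ fun g => ?_
      · rw [Measure.smul_apply, smul_eq_mul, ENNReal.inv_mul_cancel h0 htop]
      · rw [Measure.map_smul, hinv]
    rw [← hν _ hB, ← huniv, ← congrArg (fun m : Measure X => m B) h2, Measure.smul_apply, smul_eq_mul,
      ← mul_assoc, ENNReal.mul_inv_cancel h0 htop, one_mul]

end Prod

end

section

section Values

variable {X : Type*} [TopologicalSpace X] [CompactSpace X] [MeasurableSpace X] [BorelSpace X]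
  {μ : Measure X} [IsProbabilityMeasure μ]

theorem lc_eq_sum {f : X → ℤ} (hf : IsLocallyConstant f) :
    f = ∑ v ∈ hf.range_finite.toFinset, v • ind (f ⁻¹' {v}) := by
  funext x
  rw [Finset.sum_apply, Finset.sum_eq_single (f x)]
  · simp [ind]
  · intro v _ hv
    simp [ind, hv.symm]
  · intro h
    simp at h

theorem real_mem_clopenValueGroup {V : Set X} (hV : IsClopen V) : μ.real V ∈ clopenValueGroup μ :=
  AddSubgroup.subset_closure ⟨V, hV, rfl⟩

theorem mem_clopenValueGroup_iff {r : ℝ} :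
    r ∈ clopenValueGroup μ ↔ ∃ f : X → ℤ, IsLocallyConstant f ∧ ing μ f = r := by
  constructor
  · intro h
    induction h using AddSubgroup.closure_induction with
    | mem r hr =>
      obtain ⟨V, hV, rfl⟩ := hr
      exact ⟨ind V, lc_ind hV, ing_ind hV⟩
    | zero => exact ⟨0, IsLocallyConstant.const 0, ing_zero⟩
    | add x y _ _ h1 h2 =>
      obtain ⟨f, hf, rfl⟩ := h1
      obtain ⟨g, hg, rfl⟩ := h2
      exact ⟨f + g, lc_add hf hg, ing_add hf hg⟩
    | neg x _ h1 =>
      obtain ⟨f, hf, rfl⟩ := h1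
      exact ⟨(-1 : ℤ) • f, lc_zsmul hf _, by rw [ing_zsmul]; push_cast; ring⟩
  · rintro ⟨f, hf, rfl⟩
    have hc : ∀ v, IsClopen (f ⁻¹' {v}) := fun v => hf.isClopen_fiber v
    rw [lc_eq_sum hf, ing_sum _ fun v _ => lc_zsmul (lc_ind (hc v)) v]
    refine AddSubgroup.sum_mem _ fun v _ => ?_
    rw [ing_zsmul, ing_ind (hc v), ← zsmul_eq_mul]
    exact AddSubgroup.zsmul_mem _ (real_mem_clopenValueGroup (hc v)) v

end Values

section Main

variable {G X : Type*} [CommGroup G] [TopologicalSpace X] [MulAction G X]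
  [CompactSpace X] [FreeAct G X] [ContinuousConstSMul G X]
  [T2Space X] [TotallyDisconnectedSpace X] [MeasurableSpace X] [BorelSpace X] {μ : Measure X}
  [IsProbabilityMeasure μ] [SMulInvariantMeasure G X μ]

theorem clopen_section {n : ℕ} {W : Set (X × Fin n)} (hW : IsClopen W) (i : Fin n) :
    IsClopen {x | (x, i) ∈ W} := hW.preimage (by fun_prop : Continuous fun x : X => (x, i))

theorem prod_count_toReal {n : ℕ} {W : Set (X × Fin n)} (hW : IsClopen W) :
    ((μ.prod Measure.count) W).toReal = ∑ i, μ.real {x | (x, i) ∈ W} := by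
  rw [prod_count_apply hW.isOpen.measurableSet, ENNReal.toReal_sum fun i _ => measure_ne_top _ _]
  rfl

theorem prod_count_slice {n : ℕ} {A : Set X} (i : Fin n) :
    ((μ.prod (Measure.count : Measure (Fin n))) (A ×ˢ {i})).toReal = μ.real A := by
  rw [Measure.prod_prod, Measure.count_singleton, mul_one]
  rfl

/-- A locally constant choice of group elements moving every point into a given clopen set. -/
theorem exists_lc_into (hS : Sys G μ) {W : Set X} (hW : IsClopen W) (hne : W.Nonempty) :
    ∃ γ : X → G, IsLocallyConstant γ ∧ (∀ x, γ x • x ∈ W) ∧ ∀ x ∈ W, γ x = 1 := by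
  obtain ⟨γ, hγ, h⟩ := lc_select (X := X) (P := fun x (g : G) => g • x ∈ W) fun x => by
    obtain ⟨g, hg⟩ := hS.dense x W hW.isOpen hne
    exact ⟨g, (clopen_smul_pre hW g).isOpen.mem_nhds hg⟩
  refine ⟨fun x => if x ∈ W then 1 else γ x, lc_ite hW (IsLocallyConstant.const _) hγ, fun x => ?_, fun x hx => ?_⟩
  · by_cases hx : x ∈ W
    · simp [hx]
    · simpa [hx] using h x
  · simp [hx]

theorem mem_IMplus [Countable G] [Nonempty X] (hS : Sys G μ) {n : ℕ} {U : Set (X × Fin n)} (hU : IsClopen U)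
    (F : X ≃ₜ U) (hF : ∀ x y, (∃ g : G, g • x = y) ↔
      ∃ g : G, g • (F x : X × Fin n).1 = (F y : X × Fin n).1) :
    ((μ.prod Measure.count) U).toReal ∈ IMplus (clopenValueGroup μ) := by
  set l := ((μ.prod Measure.count) U).toReal with hl
  have hM : ∀ {B : Set X}, MeasurableSet B →
      ((μ.prod Measure.count) ((fun x => (F x : X × Fin n)) '' B)).toReal = l * μ.real B := fun hB => by
    rw [measure_image_orbitEquiv hS hU F (fun x g => (hF x _).1 ⟨g, rfl⟩) hB, ENNReal.toReal_mul]
    rfl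
  have hco : IsOpenEmbedding fun x => (F x : X × Fin n) :=
    hU.isOpen.isOpenEmbedding_subtypeVal.comp F.isOpenEmbedding
  have hcc : IsClosedEmbedding fun x => (F x : X × Fin n) :=
    hU.isClosed.isClosedEmbedding_subtypeVal.comp F.isClosedEmbedding
  have h1 : ∀ x ∈ clopenValueGroup μ, l * x ∈ clopenValueGroup μ := by
    intro x hx
    induction hx using AddSubgroup.closure_induction with
    | mem r hr =>
      obtain ⟨V, hV, rfl⟩ := hr
      have hc : IsClopen ((fun x => (F x : X × Fin n)) '' V) :=
        ⟨hcc.isClosedMap _ hV.isClosed, hco.isOpenMap _ hV.isOpen⟩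
      have h2 := hM hV.isOpen.measurableSet
      rw [prod_count_toReal hc] at h2
      show l * μ.real V ∈ _
      rw [← h2]
      exact AddSubgroup.sum_mem _ fun i _ => real_mem_clopenValueGroup (clopen_section hc i)
    | zero => rw [mul_zero]; exact AddSubgroup.zero_mem _
    | add x y _ _ h1 h2 => rw [mul_add]; exact AddSubgroup.add_mem _ h1 h2
    | neg x _ h1 => rw [mul_neg]; exact AddSubgroup.neg_mem _ h1
  obtain ⟨x0⟩ := ‹Nonempty X›
  let i0 := (F x0 : X × Fin n).2
  let W : Set X := {x | (x, i0) ∈ U}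
  have hW : IsClopen W := clopen_section hU i0
  have hWne : W.Nonempty := ⟨(F x0 : X × Fin n).1, (F x0).2⟩
  obtain ⟨γ, hγ, hγW, -⟩ := exists_lc_into hS hW hWne
  have hslice : ∀ A : Set X, IsClopen A → A ⊆ W →
      μ.real A ∈ (clopenValueGroup μ).map (AddMonoidHom.mulLeft l) := by
    intro A hA hAW
    let B : Set X := (fun x => (F x : X × Fin n)) ⁻¹' (A ×ˢ {i0})
    have hB : IsClopen B := (hA.prod (isClopen_discrete _)).preimage hco.continuous
    refine ⟨μ.real B, real_mem_clopenValueGroup hB, ?_⟩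
    show l * μ.real B = _
    rw [← hM hB.isOpen.measurableSet, ← prod_count_slice i0, Set.image_preimage_eq_of_subset]
    rintro ⟨x, i⟩ ⟨hx, hi⟩
    obtain rfl : i = i0 := hi
    exact ⟨F.symm ⟨(x, _), hAW hx⟩, by simp⟩
  have h2 : ∀ x ∈ clopenValueGroup μ, x ∈ (clopenValueGroup μ).map (AddMonoidHom.mulLeft l) := by
    suffices h : clopenValueGroup μ ≤ (clopenValueGroup μ).map (AddMonoidHom.mulLeft l) from fun x hx => h hx
    refine (AddSubgroup.closure_le _).2 ?_
    rintro r ⟨V, hV, rfl⟩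
    have hpc : ∀ g, IsClopen (V ∩ γ ⁻¹' {g}) := fun g => hV.inter (hγ.isClopen_fiber g)
    have hsum : μ.real V = ∑ g ∈ hγ.range_finite.toFinset, μ.real (V ∩ γ ⁻¹' {g}) := by
      rw [← measureReal_biUnion_finset]
      · congr 1
        ext x
        simp
      · intro g _ g' _ hg
        refine Set.disjoint_left.2 fun x hx hx' => hg ?_
        rw [← hx.2, ← hx'.2]
      · exact fun g _ => (hpc g).isOpen.measurableSet
    show μ.real V ∈ _
    rw [hsum]
    refine AddSubgroup.sum_mem _ fun g _ => ?_
    have h3 := clopen_smul_pre (hpc g) g⁻¹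
    rw [← real_smul_pre (hpc g).isOpen.measurableSet g⁻¹]
    refine hslice _ h3 fun x hx => ?_
    have h4 := hγW (g⁻¹ • x)
    rwa [show γ (g⁻¹ • x) = g from hx.2, smul_inv_smul] at h4
  have hone : (1 : ℝ) ∈ clopenValueGroup μ := by
    have := real_mem_clopenValueGroup (μ := μ) isClopen_univ
    rwa [probReal_univ] at this
  have hpos : 0 < l := by
    have h3 : 0 < μ.real W := real_pos hS hW hWne
    rw [hl, prod_count_toReal hU]
    exact lt_of_lt_of_le h3 (Finset.single_le_sum (f := fun i => μ.real {x | (x, i) ∈ U})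
      (fun _ _ => measureReal_nonneg) (Finset.mem_univ i0))
  refine ⟨hpos, ?_, ?_, ?_⟩
  · simpa using h1 1 hone
  · obtain ⟨y, hy, hy1⟩ := h2 1 hone
    have : l⁻¹ = y := by
      rw [inv_eq_iff_eq_inv, eq_inv_of_mul_eq_one_left hy1]
    rw [this]
    exact hy
  · ext x
    constructor
    · rintro ⟨y, hy, rfl⟩
      exact h1 y hy
    · intro hx
      obtain ⟨y, hy, hyx⟩ := h2 x hx
      exact ⟨y, hy, hyx⟩

theorem exists_amp_of_clopen {V : Set X} (hV : IsClopen V) (h : X ≃ₜ V)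
    (hh : ∀ x y, (∃ g : G, g • x = y) ↔ ∃ g : G, g • (h x : X) = h y) :
    ∃ (n : ℕ) (U : Set (X × Fin n)), IsClopen U ∧ ∃ F : X ≃ₜ U,
      (∀ x y, (∃ g : G, g • x = y) ↔ ∃ g : G, g • (F x : X × Fin n).1 = (F y : X × Fin n).1) ∧
      μ.real V = ((μ.prod Measure.count) U).toReal := by
  refine ⟨1, V ×ˢ {0}, hV.prod (isClopen_discrete _), ⟨⟨fun x => ⟨(h x, 0), (h x).2, rfl⟩,
    fun p => h.symm ⟨p.1.1, p.2.1⟩, fun x => h.symm_apply_apply x, ?_⟩, ?_, ?_⟩, hh, (prod_count_slice 0).symm⟩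
  · rintro ⟨⟨x, i⟩, hx, hi⟩
    obtain rfl : i = 0 := hi
    simp
  · exact Continuous.subtype_mk ((continuous_subtype_val.comp h.continuous).prodMk continuous_const) _
  · exact h.symm.continuous.comp
      (Continuous.subtype_mk (continuous_fst.comp continuous_subtype_val) _)

theorem exists_amp_of_clopen_inv [Countable G] (hS : Sys G μ) {V : Set X} (hV : IsClopen V)
    (hne : V.Nonempty) (h : X ≃ₜ V)
    (hh : ∀ x y, (∃ g : G, g • x = y) ↔ ∃ g : G, g • (h x : X) = h y) :
    ∃ (n : ℕ) (U : Set (X × Fin n)), IsClopen U ∧ ∃ F : X ≃ₜ U,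
      (∀ x y, (∃ g : G, g • x = y) ↔ ∃ g : G, g • (F x : X × Fin n).1 = (F y : X × Fin n).1) ∧
      (μ.real V)⁻¹ = ((μ.prod Measure.count) U).toReal := by
  obtain ⟨γ, hγ, hγV, hγ1⟩ := exists_lc_into hS hV hne
  let S : Finset G := hγ.range_finite.toFinset
  let e : Fin S.card ≃ S := S.equivFin.symm
  have hmem : ∀ x, γ x ∈ S := fun x => by simp [S]
  let c : X → Fin S.card := fun x => e.symm ⟨γ x, hmem x⟩
  have hec : ∀ x, (e (c x) : G) = γ x := fun x => by simp [c]
  let ψ : X × Fin S.card → X := fun p => (e p.2 : G)⁻¹ • (h p.1 : X)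
  have hψ : Continuous ψ := by
    refine continuous_prod_of_discrete_right.2 fun i => ?_
    exact (continuous_const_smul ((e i : G)⁻¹)).comp (continuous_subtype_val.comp h.continuous)
  let U : Set (X × Fin S.card) := {p | γ (ψ p) = e p.2}
  have hγψ : IsLocallyConstant fun p => γ (ψ p) := hγ.comp_continuous hψ
  have heL : IsLocallyConstant fun p : X × Fin S.card => (e p.2 : G) :=
    (IsLocallyConstant.of_discrete fun i : Fin S.card => (e i : G)).comp_continuous continuous_snd
  have hU : IsClopen U := clopen_of_lc (lc_comp2 (fun a b => a = b) hγψ heL)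
  let f : X → X × Fin S.card := fun x => (h.symm ⟨γ x • x, hγV x⟩, c x)
  have hψf : ∀ x, ψ (f x) = x := fun x => by simp [ψ, f, hec]
  have hf : Continuous f := by
    refine Continuous.prodMk (h.symm.continuous.comp (Continuous.subtype_mk ?_ _)) ?_
    · rw [continuous_iff_continuousAt]
      intro x
      refine ((continuous_const_smul (γ x)).continuousAt).congr ?_
      filter_upwards [lc_ev hγ x] with y hy
      rw [hy]
    · have : IsLocallyConstant c := lc_of_ev fun x => by
        filter_upwards [lc_ev hγ x] with y hy
        simp [c, hy]
      exact this.continuous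
  have hfU : ∀ x, f x ∈ U := fun x => by
    show γ (ψ (f x)) = e (c x)
    rw [hψf, hec]
  have hfψ : ∀ p ∈ U, f (ψ p) = p := by
    rintro ⟨y, i⟩ hp
    have hp' : γ (ψ (y, i)) = e i := hp
    refine Prod.ext ?_ ?_
    · have : (⟨γ (ψ (y, i)) • ψ (y, i), hγV _⟩ : V) = h y := Subtype.ext (by
        show γ (ψ (y, i)) • ψ (y, i) = h y
        rw [hp']
        exact smul_inv_smul _ _)
      show h.symm ⟨_, _⟩ = y
      rw [this, h.symm_apply_apply]
    · show e.symm _ = i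
      rw [e.symm_apply_eq]
      exact Subtype.ext hp'
  let F : X ≃ₜ U := ⟨⟨fun x => ⟨f x, hfU x⟩, fun p => ψ p, hψf, fun p => Subtype.ext (hfψ p p.2)⟩,
    hf.subtype_mk _, hψ.comp continuous_subtype_val⟩
  have hF : ∀ x y, (∃ g : G, g • x = y) ↔ ∃ g : G, g • (F x : X × Fin S.card).1 = (F y : X × Fin S.card).1 := by
    intro x y
    have h1 := hh (f x).1 (f y).1
    have h2 : ∀ x, (h (f x).1 : X) = γ x • x := fun x => by simp [f]
    rw [h2, h2] at h1
    show _ ↔ ∃ g : G, g • (f x).1 = (f y).1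
    rw [h1]
    constructor
    · rintro ⟨g, rfl⟩
      exact ⟨γ (g • x) * g * (γ x)⁻¹, by simp [mul_smul]⟩
    · rintro ⟨g, hg⟩
      exact ⟨(γ y)⁻¹ * g * γ x, by simp [mul_smul, hg]⟩
  refine ⟨_, U, hU, F, hF, ?_⟩
  have hM := measure_image_orbitEquiv hS hU F (fun x g => (hF x _).1 ⟨g, rfl⟩) hV.isOpen.measurableSet
  obtain ⟨v, hv⟩ := hne
  have himg : (fun x => (F x : X × Fin S.card)) '' V = Set.univ ×ˢ {c v} := by
    have hc : ∀ x ∈ V, c x = c v := fun x hx => by simp [c, hγ1 x hx, hγ1 v hv]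
    ext ⟨y, i⟩
    constructor
    · rintro ⟨x, hx, hxy⟩
      have h2 : c x = i := congrArg Prod.snd hxy
      exact ⟨trivial, by rw [← h2]; exact hc x hx⟩
    · rintro ⟨-, hi⟩
      obtain rfl : i = c v := hi
      refine ⟨h y, (h y).2, ?_⟩
      show f (h y) = _
      refine Prod.ext ?_ (hc _ (h y).2)
      show h.symm ⟨_, _⟩ = y
      rw [h.symm_apply_eq]
      refine Subtype.ext ?_
      show γ (h y) • (h y : X) = h y
      rw [hγ1 _ (h y).2, one_smul]
  have h3 := congrArg ENNReal.toReal hM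
  rw [himg, prod_count_slice, probReal_univ, ENNReal.toReal_mul] at h3
  exact inv_eq_of_mul_eq_one_left h3.symm

theorem exists_amp_of_IMplus [Group.FG G] [Nonempty X] [TopologicalSpace.MetrizableSpace X] (hS : Sys G μ)
    {t : ℝ} (ht : t ∈ IMplus (clopenValueGroup μ)) :
    ∃ (n : ℕ) (U : Set (X × Fin n)), IsClopen U ∧ ∃ F : X ≃ₜ U,
      (∀ x y, (∃ g : G, g • x = y) ↔ ∃ g : G, g • (F x : X × Fin n).1 = (F y : X × Fin n).1) ∧
      t = ((μ.prod Measure.count) U).toReal := by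
  have := countable_of_fg (G := G)
  obtain ⟨h0, -, -, himg⟩ := ht
  have hE : ∀ f : X → ℤ, IsLocallyConstant f → ∃ g, IsLocallyConstant g ∧ ing μ g = t * ing μ f := by
    intro f hf
    rw [← mem_clopenValueGroup_iff, ← SetLike.mem_coe, ← himg]
    exact ⟨_, mem_clopenValueGroup_iff.2 ⟨f, hf, rfl⟩, rfl⟩
  have hE' : ∀ f : X → ℤ, IsLocallyConstant f → ∃ g, IsLocallyConstant g ∧ ing μ g = t⁻¹ * ing μ f := by
    intro f hf
    have h1 : ing μ f ∈ clopenValueGroup μ := mem_clopenValueGroup_iff.2 ⟨f, hf, rfl⟩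
    rw [← SetLike.mem_coe, ← himg] at h1
    obtain ⟨y, hy, hyf⟩ := h1
    rw [← mem_clopenValueGroup_iff, ← hyf]
    rwa [inv_mul_cancel_left₀ h0.ne']
  rcases lt_trichotomy t 1 with h1 | rfl | h1
  · obtain ⟨U, hU, rfl, h, hh⟩ := exists_shrink hS h0 h1 hE hE'
    exact exists_amp_of_clopen hU h hh
  · have := exists_amp_of_clopen (G := G) (μ := μ) isClopen_univ (Homeomorph.Set.univ X).symm
      fun x y => Iff.rfl
    rwa [probReal_univ] at this
  · obtain ⟨U, hU, hUt, h, hh⟩ := exists_shrink hS (inv_pos.2 h0) (inv_lt_one_of_one_lt₀ h1) hE'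
      (by rwa [inv_inv])
    have hne : U.Nonempty := ⟨_, (h (Classical.arbitrary X)).2⟩
    have := exists_amp_of_clopen_inv hS hU hne h hh
    rwa [hUt, inv_inv] at this

end Main

end

section

section Bridge

variable {G : Type*} [CommGroup G] {X : Type*} [TopologicalSpace X]

/-- The action by homeomorphisms as a `MulAction`. -/
@[reducible] def actionOf (φ : G →* (X ≃ₜ X)) : MulAction G X where
  smul g x := φ g x
  one_smul x := by
    show φ 1 x = x
    rw [map_one]
    rfl
  mul_smul g h x := by
    show φ (g * h) x = φ g (φ h x)
    rw [map_mul]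
    rfl

theorem isInvariantMeasure_orbitRelOf [Countable G] [T2Space X] [MeasurableSpace X] [BorelSpace X]
    {φ : G →* (X ≃ₜ X)} {ν : Measure X} (hν : ∀ g, ν.map (φ g) = ν) :
    IsInvariantMeasure (orbitRelOf φ) ν := by
  intro h hh
  ext A hA
  rw [Measure.map_apply h.continuous.measurable hA]
  have h1 := measure_image_eq (ν := ν) (τ := fun g => φ g)
    (fun g => ⟨(φ g).continuous.measurable, hν g⟩) continuous_id h.continuous
    MeasurableEmbedding.id h.measurableEmbedding (fun x => by
      obtain ⟨g, hg⟩ := hh x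
      exact ⟨g, hg.symm⟩) (h.continuous.measurable hA)
  rw [Set.image_preimage_eq _ h.surjective, Set.image_id] at h1
  exact h1.symm

theorem fundGroup_eq_IMplus [Group.FG G] [CompactSpace X] [TopologicalSpace.MetrizableSpace X]
    [TotallyDisconnectedSpace X] [Nonempty X] [MeasurableSpace X] [BorelSpace X]
    (hperf : Perfect (Set.univ : Set X))
    (φ : G →* (X ≃ₜ X)) (hfree : IsFreeAction φ) (hmin : IsMinimalRel (orbitRelOf φ))
    (μ : Measure X) [IsProbabilityMeasure μ] (hinv : IsInvariantMeasure (orbitRelOf φ) μ)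
    (huniq : ∀ ν : Measure X, IsProbabilityMeasure ν → IsInvariantMeasure (orbitRelOf φ) ν → ν = μ) :
    fundGroup (orbitRelOf φ) μ = IMplus (clopenValueGroup μ) := by
  let _ : MulAction G X := actionOf φ
  have : Countable G := countable_of_fg
  have : FreeAct G X := ⟨fun g x h => by_contra fun hg => hfree g hg x h⟩
  have : ContinuousConstSMul G X := ⟨fun g => (φ g).continuous⟩
  have hmap : ∀ g, μ.map (φ g) = μ := fun g => hinv (φ g) fun x => ⟨g, rfl⟩
  have : SMulInvariantMeasure G X μ := ⟨fun g s hs => by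
    have h1 := congrArg (fun m => m s) (hmap g)
    simp only [Measure.map_apply (φ g).continuous.measurable hs] at h1
    exact h1⟩
  have hS : Sys G μ :=
    { uniq := fun ν hν h => huniq ν hν (isInvariantMeasure_orbitRelOf h)
      dense := fun x U hU hne => by
        obtain ⟨y, ⟨g, hg⟩, hy⟩ := (hmin x).exists_mem_open hU hne
        refine ⟨g, ?_⟩
        show φ g x ∈ U
        rwa [show φ g x = y from hg]
      perf := fun U hU hne => by
        obtain ⟨x, hx⟩ := hne
        have h1 := hperf.acc x trivial
        have : (𝓝[≠] x).NeBot := by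
          simpa [AccPt] using h1
        exact infinite_of_mem_nhds x (hU.mem_nhds hx) }
  ext l
  constructor
  · rintro ⟨n, U, hU, ⟨F, hF⟩, rfl⟩
    exact mem_IMplus hS hU F hF
  · intro hl
    obtain ⟨n, U, hU, F, hF, h⟩ := exists_amp_of_IMplus hS hl
    exact ⟨n, U, hU, ⟨F, hF⟩, h⟩

end Bridge

end

end CantorFund

/-- For a uniquely ergodic Cantor minimal system arising from a free action of
a finitely generated abelian group, `F(R) = IM₊(E_μ)`. -/
theorem statement9 {G : Type*} [CommGroup G] [Group.FG G] {X : Type*} [TopologicalSpace X] [CompactSpace X]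
    [TopologicalSpace.MetrizableSpace X] [TotallyDisconnectedSpace X] [Nonempty X]
    [MeasurableSpace X] [BorelSpace X]
    (hperf : Perfect (Set.univ : Set X))
    (φ : G →* (X ≃ₜ X)) (hfree : IsFreeAction φ) (hmin : IsMinimalRel (orbitRelOf φ))
    (μ : Measure X) [IsProbabilityMeasure μ] (hinv : IsInvariantMeasure (orbitRelOf φ) μ)
    (huniq : ∀ ν : Measure X, IsProbabilityMeasure ν → IsInvariantMeasure (orbitRelOf φ) ν → ν = μ) :
    fundGroup (orbitRelOf φ) μ = IMplus (clopenValueGroup μ) := by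
  exact CantorFund.fundGroup_eq_IMplus hperf φ hfree hmin μ hinv huniq
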